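/- arXiv:2311.14257 — 8 statements merged into one kernel-verified Lean document; each statement's English description precedes it below -/
import Mathlib

section
/- Let M be an atomic von Neumann algebra on a complex Hilbert space H that is not σ-finite, i.e. M contains an uncountable family of pairwise orthogonal nonzero projections. Then M, regarded as a normed space with the operator norm, does not have the ball-covering property. -/
noncomputable section

variable {H : Type*} [NormedAddCommGroup H] [InnerProductSpace ℂ H] [CompleteSpace H]

/-- `p` is a projection of the von Neumann algebra `M` : `p ∈ M`, `p = p*`, `p ∘ p = p`. -/
def IsProjectionIn (M : VonNeumannAlgebra H) (p : H →L[ℂ] H) : Prop :=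
  p ∈ M ∧ star p = p ∧ p * p = p

/-- `p` is a minimal projection of `M`. -/
def IsMinimalProjectionIn (M : VonNeumannAlgebra H) (p : H →L[ℂ] H) : Prop :=
  IsProjectionIn M p ∧ p ≠ 0 ∧
    ∀ q, IsProjectionIn M q → p * q = q → q = 0 ∨ q = p

/-- `M` is atomic: every nonzero projection of `M` dominates a minimal projection. -/
def VonNeumannAlgebra.Atomic (M : VonNeumannAlgebra H) : Prop :=
  ∀ p, IsProjectionIn M p → p ≠ 0 → ∃ q, IsMinimalProjectionIn M q ∧ p * q = q

/-- `M` is σ-finite if every set of pairwise orthogonal nonzero projections of `M` is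
countable. -/
def VonNeumannAlgebra.SigmaFinite (M : VonNeumannAlgebra H) : Prop :=
  ∀ S : Set (H →L[ℂ] H), (∀ p ∈ S, IsProjectionIn M p ∧ p ≠ 0) →
    (S.Pairwise fun p q => p * q = 0) → S.Countable

/-- A subset `S` of a normed space has the ball-covering property if there is a countable
family of open balls with centers in `S`, none of which contains the origin, whose union
covers `{x ∈ S : ‖x‖ = 1}`. -/
def HasBCPOn {E : Type*} [NormedAddCommGroup E] (S : Set E) : Prop :=
  ∃ (c : ℕ → E) (r : ℕ → ℝ), (∀ n, c n ∈ S) ∧ (∀ n, r n ≤ ‖c n‖) ∧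
    ∀ x ∈ S, ‖x‖ = 1 → ∃ n, ‖x - c n‖ < r n

theorem proj_inner_aux {p q : H →L[ℂ] H} (hp : star p = p) (ξ η : H) :
    inner ℂ (p ξ) (q η) = inner ℂ ξ ((p * q) η) := by
  conv_lhs => rw [← hp]
  rw [ContinuousLinearMap.star_eq_adjoint, ContinuousLinearMap.adjoint_inner_left]
  rfl

/-- Only countably many members of an orthogonal family of projections act nontrivially on a
given vector. -/
theorem countable_nonvanishing (S : Set (H →L[ℂ] H))
    (hS : ∀ p ∈ S, star p = p ∧ p * p = p)
    (hpw : S.Pairwise fun p q => p * q = 0) (ξ : H) :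
    {p ∈ S | p ξ ≠ 0}.Countable := by
  let T := {p ∈ S | p ξ ≠ 0}
  let e : T → H := fun p => ((‖p.1 ξ‖⁻¹ : ℝ) : ℂ) • p.1 ξ
  have hne : ∀ p : T, ‖p.1 ξ‖ ≠ 0 := fun p => norm_ne_zero_iff.mpr p.2.2
  have he : Orthonormal ℂ e := by
    constructor
    · intro p
      simp only [e, norm_smul, Complex.norm_real, norm_inv, norm_norm]
      exact inv_mul_cancel₀ (hne p)
    · intro p q hpq
      have h0 : p.1 * q.1 = 0 := hpw p.2.1 q.2.1 (fun h => hpq (Subtype.ext h))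
      simp only [e, inner_smul_left, inner_smul_right]
      rw [proj_inner_aux (hS p.1 p.2.1).1, h0]
      simp
  have hsum := he.inner_products_summable ξ
  have hc := hsum.countable_support
  have huniv : Function.support (fun p : T => ‖inner ℂ (e p) ξ‖ ^ 2) = Set.univ := by
    ext p
    have h1 : inner ℂ (p.1 ξ) ξ = inner ℂ (p.1 ξ) (p.1 ξ) := by
      have h := proj_inner_aux (q := p.1) (hS p.1 p.2.1).1 ξ ξ
      have h' := proj_inner_aux (q := 1) (hS p.1 p.2.1).1 ξ ξ
      rw [(hS p.1 p.2.1).2] at h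
      rw [mul_one] at h'
      rw [h, ← h']
      rfl
    have h2 : inner ℂ (p.1 ξ) (p.1 ξ) ≠ 0 := inner_self_ne_zero.mpr p.2.2
    simp only [Function.mem_support, Set.mem_univ, iff_true, e, inner_smul_left, h1]
    refine pow_ne_zero _ (norm_ne_zero_iff.mpr (mul_ne_zero ?_ h2))
    simpa using p.2.2
  rw [huniv] at hc
  exact Set.countable_coe_iff.mp (Set.countable_univ_iff.mp hc)

/-- An atomic von Neumann algebra which is not σ-finite fails the
ball-covering property. -/
theorem atomic_not_sigmaFinite_not_BCP
    (M : VonNeumannAlgebra H) (hM : M.Atomic) (hσ : ¬ M.SigmaFinite) :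
    ¬ HasBCPOn (M : Set (H →L[ℂ] H)) := by
  rintro ⟨c, r, -, hr, hcov⟩
  apply hσ
  intro S hS hpw
  have hex : ∀ n k : ℕ, ∃ ξ : H, ‖ξ‖ < 1 ∧ ‖c n‖ - 1 / ((k : ℝ) + 1) < ‖c n ξ‖ := by
    intro n k
    apply ContinuousLinearMap.exists_lt_apply_of_lt_opNorm
    have : (0 : ℝ) < 1 / ((k : ℝ) + 1) := by positivity
    linarith
  choose ξ hξ1 hξ2 using hex
  have hcount : (⋃ n, ⋃ k, {p ∈ S | p (ξ n k) ≠ 0}).Countable :=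
    Set.countable_iUnion fun n => Set.countable_iUnion fun k =>
      countable_nonvanishing S (fun p hp => (hS p hp).1.2) hpw (ξ n k)
  refine hcount.mono ?_
  intro p hp
  by_contra hnot
  simp only [Set.mem_iUnion, Set.mem_setOf_eq, not_exists, not_and, not_not] at hnot
  obtain ⟨⟨hpM, hsa, hid⟩, hp0⟩ := hS p hp
  have hnorm : ‖p‖ = 1 := by
    have h := CStarRing.norm_star_mul_self (x := p)
    rw [hsa, hid] at h
    have h0 : ‖p‖ ≠ 0 := norm_ne_zero_iff.mpr hp0
    exact (mul_right_cancel₀ h0 (by rw [one_mul]; exact h)).symm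
  obtain ⟨n, hn⟩ := hcov p hpM hnorm
  have hlt : ‖p - c n‖ < ‖c n‖ := hn.trans_le (hr n)
  obtain ⟨k, hk⟩ := exists_nat_one_div_lt (sub_pos.mpr hlt)
  have h1 := (p - c n).le_opNorm (ξ n k)
  rw [ContinuousLinearMap.sub_apply, hnot n k hp, zero_sub, norm_neg] at h1
  have h2 : ‖p - c n‖ * ‖ξ n k‖ ≤ ‖p - c n‖ :=
    mul_le_of_le_one_right (norm_nonneg _) (hξ1 n k).le
  have h3 := hξ2 n k
  linarith
end
end

section
/- Let M be a von Neumann algebra on a complex Hilbert space H. If M has the ball-covering property, then M is atomic and σ-finite. -/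
noncomputable section

variable {H : Type*} [NormedAddCommGroup H] [InnerProductSpace ℂ H] [CompleteSpace H]

open scoped InnerProductSpace

namespace BCPAux

lemma mem_of_comm {M : VonNeumannAlgebra H} {x : H →L[ℂ] H}
    (h : ∀ y ∈ M.commutant, y * x = x * y) : x ∈ M := by
  rw [← M.commutant_commutant, VonNeumannAlgebra.mem_commutant_iff]
  exact h

lemma comm_of_mem {M : VonNeumannAlgebra H} {x y : H →L[ℂ] H}
    (hx : x ∈ M) (hy : y ∈ M.commutant) : y * x = x * y := by
  rw [VonNeumannAlgebra.mem_commutant_iff] at hy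
  exact (hy x hx).symm

lemma smul_mem {M : VonNeumannAlgebra H} (s : ℂ) {x : H →L[ℂ] H} (hx : x ∈ M) : s • x ∈ M :=
  M.toStarSubalgebra.smul_mem hx s

lemma inner_symm {f : H →L[ℂ] H} (hf : star f = f) (x y : H) : ⟪f x, y⟫_ℂ = ⟪x, f y⟫_ℂ := by
  conv_rhs => rw [← hf]
  rw [ContinuousLinearMap.star_eq_adjoint, ContinuousLinearMap.adjoint_inner_right]

lemma proj_apply {f : H →L[ℂ] H} (hf : f * f = f) (x : H) : f (f x) = f x := by
  conv_rhs => rw [← hf]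
  rfl

lemma proj_normsq {f : H →L[ℂ] H} (hs : star f = f) (hf : f * f = f) (x : H) :
    ((‖f x‖ ^ 2 : ℝ) : ℂ) = ⟪f x, x⟫_ℂ := by
  have : ⟪f x, x⟫_ℂ = ⟪f x, f x⟫_ℂ := by
    rw [← inner_symm hs, proj_apply hf]
  rw [this, inner_self_eq_norm_sq_to_K]
  norm_cast

lemma proj_norm_le {f : H →L[ℂ] H} (hs : star f = f) (hf : f * f = f) (x : H) :
    ‖f x‖ ≤ ‖x‖ := by
  have h1 := proj_normsq hs hf x
  have h2 : ‖f x‖ ^ 2 ≤ ‖f x‖ * ‖x‖ := by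
    have := norm_inner_le_norm (𝕜 := ℂ) (f x) x
    rw [← h1] at this
    simpa using this
  rcases eq_or_lt_of_le (norm_nonneg (f x)) with h | h
  · rw [← h]; exact norm_nonneg _
  · nlinarith

lemma star_proj_mem {M : VonNeumannAlgebra H} (K : Submodule ℂ H) [K.HasOrthogonalProjection]
    (h : ∀ y ∈ M.commutant, ∀ x ∈ K, y x ∈ K) : IsProjectionIn M K.starProjection := by
  have hs : IsStarProjection K.starProjection := isStarProjection_starProjection
  refine ⟨?_, hs.isSelfAdjoint.star_eq, hs.isIdempotentElem⟩
  rw [VonNeumannAlgebra.IsStarProjection.mem_iff hs]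
  intro y hy
  rw [Submodule.range_starProjection]
  exact fun x hx => h y hy x hx

/-- The range projection of an element of `M`. -/
lemma exists_range_proj {M : VonNeumannAlgebra H} {a : H →L[ℂ] H} (ha : a ∈ M) :
    ∃ e, IsProjectionIn M e ∧ e * a = a ∧ ∀ x, e x ∈ closure (Set.range a) := by
  let K : Submodule ℂ H := (a.range).topologicalClosure
  have hK : IsClosed (K : Set H) := Submodule.isClosed_topologicalClosure _
  have : CompleteSpace K := hK.completeSpace_coe
  have hKc : (K : Set H) = closure (Set.range a) := by
    simp only [K, Submodule.topologicalClosure_coe]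
    rfl
  refine ⟨K.starProjection, star_proj_mem K ?_, ?_, ?_⟩
  · intro y hy x hx
    rw [← SetLike.mem_coe, hKc] at hx ⊢
    refine map_mem_closure y.continuous hx ?_
    rintro _ ⟨z, rfl⟩
    refine ⟨y z, ?_⟩
    have := comm_of_mem ha hy
    exact (congrArg (fun T : H →L[ℂ] H => T z) this).symm
  · ext x
    change K.starProjection (a x) = a x
    rw [Submodule.starProjection_eq_self_iff, ← SetLike.mem_coe, hKc]
    exact subset_closure ⟨x, rfl⟩
  · intro x
    rw [← hKc]
    exact Submodule.starProjection_apply_mem K x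

lemma posPart_mem {M : VonNeumannAlgebra H} {y : H →L[ℂ] H} (hy : y ∈ M) : y⁺ ∈ M := by
  apply mem_of_comm
  intro z hz
  by_cases hs : IsSelfAdjoint y
  · have : Commute y z := (comm_of_mem hy hz).symm
    rw [CFC.posPart_def]
    exact (this.cfcₙ_real _).symm.eq
  · rw [CFC.posPart_eq_zero_of_not_isSelfAdjoint hs]; simp

lemma posPart_sq {y : H →L[ℂ] H} (hs : IsSelfAdjoint y) : y * y⁺ = y⁺ * y⁺ := by
  conv_lhs => lhs; rw [← CFC.posPart_sub_negPart y hs]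
  rw [sub_mul, CFC.negPart_mul_posPart, sub_zero]

lemma posPart_star (y : H →L[ℂ] H) : star y⁺ = y⁺ :=
  (CFC.posPart_nonneg y).isSelfAdjoint.star_eq

/-- On a nonzero projection, `y` is nonnegative. -/
lemma exists_spectral [Nontrivial H] {M : VonNeumannAlgebra H} {c : H →L[ℂ] H} (hc : c ∈ M) {t : ℝ}
    (ht : t < ‖c‖) : ∃ e, IsProjectionIn M e ∧ e ≠ 0 ∧ ∀ x, e x = x → t * ‖x‖ ≤ ‖c x‖ := by
  rcases lt_or_ge t 0 with h0 | h0
  · refine ⟨1, ⟨one_mem _, star_one _, one_mul _⟩, ?_, ?_⟩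
    · exact one_ne_zero
    · intro x _
      nlinarith [norm_nonneg x, norm_nonneg (c x)]
  set y : H →L[ℂ] H := star c * c - ((t ^ 2 : ℝ) : ℂ) • 1 with hy
  have hyM : y ∈ M := sub_mem (mul_mem (star_mem hc) hc) (smul_mem _ (one_mem _))
  have hys : IsSelfAdjoint y := by
    rw [IsSelfAdjoint, hy]
    simp
  have hyi : ∀ x, ⟪y x, x⟫_ℂ = ((‖c x‖ ^ 2 - t ^ 2 * ‖x‖ ^ 2 : ℝ) : ℂ) := by
    intro x
    have : y x = ContinuousLinearMap.adjoint c (c x) - ((t ^ 2 : ℝ) : ℂ) • x := rfl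
    rw [this, inner_sub_left, ContinuousLinearMap.adjoint_inner_left, inner_smul_left,
      inner_self_eq_norm_sq_to_K, inner_self_eq_norm_sq_to_K, Complex.conj_ofReal]
    push_cast
    rfl
  obtain ⟨e, he, hea, her⟩ := exists_range_proj (posPart_mem hyM)
  refine ⟨e, he, ?_, ?_⟩
  · rintro rfl
    have h1 : y⁺ = 0 := by rw [← hea, zero_mul]
    rw [CFC.posPart_eq_zero_iff y hys] at h1
    have h2 : ‖c‖ ≤ t := by
      refine ContinuousLinearMap.opNorm_le_bound _ h0 fun x => ?_
      have h3 : (0 - y).IsPositive := (ContinuousLinearMap.le_def _ _).1 h1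
      have h4 := h3.inner_nonneg_left x
      rw [zero_sub, _root_.neg_apply, inner_neg_left, hyi, ← Complex.ofReal_neg] at h4
      have h5 : 0 ≤ -(‖c x‖ ^ 2 - t ^ 2 * ‖x‖ ^ 2) := by exact_mod_cast h4
      refine abs_le_of_sq_le_sq' ?_ (by positivity) |>.2
      nlinarith
    linarith
  · intro x hx
    have hcl : IsClosed {x : H | t * ‖x‖ ≤ ‖c x‖} :=
      isClosed_le (by fun_prop) (by fun_prop)
    have : closure (Set.range (y⁺ : H →L[ℂ] H)) ⊆ {x : H | t * ‖x‖ ≤ ‖c x‖} := by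
      refine hcl.closure_subset_iff.2 ?_
      rintro _ ⟨z, rfl⟩
      have h1 := hyi (y⁺ z)
      have h2 : y (y⁺ z) = y⁺ (y⁺ z) := congrArg (fun T : H →L[ℂ] H => T z) (posPart_sq hys)
      have h3 := ((ContinuousLinearMap.nonneg_iff_isPositive _).1
        (CFC.posPart_nonneg y)).inner_nonneg_left (y⁺ z)
      rw [← h2, h1] at h3
      have h5 : 0 ≤ (‖c (y⁺ z)‖ ^ 2 - t ^ 2 * ‖y⁺ z‖ ^ 2) := by exact_mod_cast h3
      change t * ‖y⁺ z‖ ≤ ‖c (y⁺ z)‖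
      refine abs_le_of_sq_le_sq' ?_ (by positivity) |>.2
      nlinarith
    rw [← hx]
    exact this (her x)

/-- Weak operator compactness of the unit ball, sequence version. -/
lemma exists_weak_limit (A : ℕ → H →L[ℂ] H) (hA : ∀ n, ‖A n‖ ≤ 1) :
    ∃ x : H →L[ℂ] H, ∀ u v, Filter.Tendsto (fun n => ⟪A n u, v⟫_ℂ)
      (Filter.hyperfilter ℕ : Filter ℕ) (nhds ⟪x u, v⟫_ℂ) := by
  have hb : ∀ n u v, ‖⟪A n u, v⟫_ℂ‖ ≤ 1 * ‖u‖ * ‖v‖ := by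
    intro n u v
    refine (norm_inner_le_norm _ _).trans ?_
    gcongr
    exact (A n).le_of_opNorm_le (hA n) u
  have hex : ∀ u v, ∃ l : ℂ, Filter.Tendsto (fun n => ⟪A n u, v⟫_ℂ)
      (Filter.hyperfilter ℕ : Filter ℕ) (nhds l) ∧ ‖l‖ ≤ 1 * ‖u‖ * ‖v‖ := by
    intro u v
    have hc : IsCompact (Metric.closedBall (0 : ℂ) (1 * ‖u‖ * ‖v‖)) := isCompact_closedBall _ _
    obtain ⟨l, hl, hl'⟩ := hc.ultrafilter_le_nhds
      ((Filter.hyperfilter ℕ).map (fun n => ⟪A n u, v⟫_ℂ)) (by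
        rw [Filter.le_principal_iff]
        change _ ∈ Filter.map _ _
        rw [Filter.mem_map]
        refine Filter.univ_mem' fun n => ?_
        simpa using hb n u v)
    exact ⟨l, hl', by simpa using hl⟩
  choose b hb1 hb2 using hex
  let B : H →ₗ⋆[ℂ] H →ₗ[ℂ] ℂ := LinearMap.mk₂'ₛₗ _ _ b
    (fun u u' v => tendsto_nhds_unique (hb1 _ _) (by
      simpa [inner_add_left] using (hb1 u v).add (hb1 u' v)))
    (fun s u v => tendsto_nhds_unique (hb1 _ _) (by
      simpa [inner_smul_left, mul_comm] using (hb1 u v).const_mul (starRingEnd ℂ s)))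
    (fun u v v' => tendsto_nhds_unique (hb1 _ _) (by
      simpa [inner_add_right] using (hb1 u v).add (hb1 u v')))
    (fun s u v => tendsto_nhds_unique (hb1 _ _) (by
      simpa [inner_smul_right] using (hb1 u v).const_mul s))
  refine ⟨InnerProductSpace.continuousLinearMapOfBilin (B.mkContinuous₂ 1 hb2), fun u v => ?_⟩
  rw [InnerProductSpace.continuousLinearMapOfBilin_apply]
  exact hb1 u v

lemma unit_in_proj {f : H →L[ℂ] H} (hff : f * f = f) (hf0 : f ≠ 0) :
    ∃ x, f x = x ∧ ‖x‖ = 1 := by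
  have : ∃ x, f x ≠ 0 := by
    by_contra! h
    exact hf0 (ContinuousLinearMap.ext h)
  obtain ⟨x, hx⟩ := this
  refine ⟨((‖f x‖⁻¹ : ℝ) : ℂ) • f x, ?_, ?_⟩
  · rw [map_smul, proj_apply hff]
  · rw [norm_smul, Complex.norm_real, norm_inv, norm_norm]
    exact inv_mul_cancel₀ (norm_ne_zero_iff.2 hx)

lemma dichotomy {M : VonNeumannAlgebra H} {f y : H →L[ℂ] H} (hf : IsMinimalProjectionIn M f)
    (hy : y ∈ M) (hys : IsSelfAdjoint y) (hfy : f * y = y) : y ≤ 0 ∨ 0 ≤ y := by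
  obtain ⟨⟨hfM, hfs, hff⟩, hf0, hmin⟩ := hf
  obtain ⟨q, hq, hqa, hqr⟩ := exists_range_proj (posPart_mem hy)
  have h1 : f * y⁺ = y⁺ := by
    have h2 : ((1 - f) * y⁺) * star ((1 - f) * y⁺) = 0 := by
      rw [star_mul, posPart_star, mul_assoc, ← mul_assoc y⁺ y⁺, ← posPart_sq hys,
        ← mul_assoc, ← mul_assoc, sub_mul 1 f y, one_mul, hfy, sub_self]
      simp
    rw [CStarRing.mul_star_self_eq_zero_iff, sub_mul, one_mul, sub_eq_zero] at h2
    exact h2.symm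
  have hfq : f * q = q := by
    ext x
    have hcl : IsClosed {z : H | f z = z} := isClosed_eq (by fun_prop) (by fun_prop)
    have : closure (Set.range (y⁺ : H →L[ℂ] H)) ⊆ {z : H | f z = z} := by
      refine hcl.closure_subset_iff.2 ?_
      rintro _ ⟨z, rfl⟩
      exact congrArg (fun T : H →L[ℂ] H => T z) h1
    exact this (hqr x)
  rcases hmin q hq hfq with h | h
  · left
    rw [← CFC.posPart_eq_zero_iff y hys, ← hqa, h, zero_mul]
  · right
    have hnq : y⁻ * q = 0 := by
      ext x
      have hcl : IsClosed {z : H | y⁻ z = 0} := isClosed_eq (by fun_prop) (by fun_prop)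
      have : closure (Set.range (y⁺ : H →L[ℂ] H)) ⊆ {z : H | y⁻ z = 0} := by
        refine hcl.closure_subset_iff.2 ?_
        rintro _ ⟨z, rfl⟩
        exact congrArg (fun T : H →L[ℂ] H => T z) (CFC.negPart_mul_posPart y)
      exact this (hqr x)
    have hyf : y * f = y := by
      have := congrArg star hfy
      rwa [star_mul, hfs, hys.star_eq] at this
    have hpf : y⁺ * f = y⁺ := by
      have := congrArg star h1
      rwa [star_mul, hfs, posPart_star] at this
    have : y⁻ = 0 := by
      have e : y⁻ = y⁺ - y := by
        conv_rhs => rhs; rw [← CFC.posPart_sub_negPart y hys]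
        abel
      rw [h] at hnq
      rw [← hnq, e, sub_mul, hpf, hyf]
    rwa [CFC.negPart_eq_zero_iff y hys] at this

lemma min_scalar {M : VonNeumannAlgebra H} {f h : H →L[ℂ] H} (hf : IsMinimalProjectionIn M f)
    (hh : h ∈ M) (hhs : star h = h) (hfh : f * h = h) : ∃ s : ℝ, h = (s : ℂ) • f := by
  obtain ⟨⟨hfM, hfs, hff⟩, hf0, hmin⟩ := id hf
  have hhf : h * f = h := by
    have := congrArg star hfh
    rwa [star_mul, hfs, hhs] at this
  let a : H → ℝ := fun x => (⟪h x, x⟫_ℂ).re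
  have ha : ∀ x, ⟪h x, x⟫_ℂ = (a x : ℂ) := by
    intro x
    apply (Complex.conj_eq_iff_re.1 _).symm
    rw [inner_conj_symm, inner_symm hhs]
  have dich : ∀ r : ℝ, (∀ x, f x = x → a x ≤ r * ‖x‖ ^ 2) ∨
      (∀ x, f x = x → r * ‖x‖ ^ 2 ≤ a x) := by
    intro r
    have hi : ∀ x, f x = x → ⟪(h - (r : ℂ) • f) x, x⟫_ℂ = ((a x - r * ‖x‖ ^ 2 : ℝ) : ℂ) := by
      intro x hx
      have : (h - (r : ℂ) • f) x = h x - (r : ℂ) • f x := rfl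
      rw [this, hx, inner_sub_left, inner_smul_left, ha, inner_self_eq_norm_sq_to_K,
        Complex.conj_ofReal]
      push_cast
      rfl
    have hsa : IsSelfAdjoint (h - (r : ℂ) • f) := by
      rw [IsSelfAdjoint, star_sub, star_smul, hhs, hfs]
      simp
    rcases dichotomy hf (sub_mem hh (smul_mem (r : ℂ) hfM)) hsa
      (by rw [mul_sub, hfh, mul_smul_comm, hff]) with h1 | h1
    · left
      intro x hx
      have h3 : (0 - (h - (r : ℂ) • f)).IsPositive := (ContinuousLinearMap.le_def _ _).1 h1
      have h4 := h3.inner_nonneg_left x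
      rw [zero_sub, _root_.neg_apply, inner_neg_left, hi x hx, ← Complex.ofReal_neg] at h4
      have h5 : 0 ≤ -(a x - r * ‖x‖ ^ 2) := by exact_mod_cast h4
      linarith
    · right
      intro x hx
      have h4 := ((ContinuousLinearMap.nonneg_iff_isPositive _).1 h1).inner_nonneg_left x
      rw [hi x hx] at h4
      have h5 : 0 ≤ (a x - r * ‖x‖ ^ 2) := by exact_mod_cast h4
      linarith
  obtain ⟨x0, hx0, hn0⟩ := unit_in_proj hff hf0
  have key : ∀ x, f x = x → a x = a x0 * ‖x‖ ^ 2 := by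
    intro x hx
    rcases eq_or_ne x 0 with rfl | hx'
    · simp [a]
    have hpos : 0 < ‖x‖ ^ 2 := by have := norm_pos_iff.2 hx'; positivity
    rcases lt_trichotomy (a x / ‖x‖ ^ 2) (a x0) with hl | hl | hl
    · exfalso
      obtain ⟨r, hr1, hr2⟩ := exists_between hl
      rw [div_lt_iff₀ hpos] at hr1
      rcases dich r with h | h
      · have := h x0 hx0
        rw [hn0] at this; linarith
      · have := h x hx
        linarith
    · rw [← hl]; field_simp
    · exfalso
      obtain ⟨r, hr1, hr2⟩ := exists_between hl
      rw [lt_div_iff₀ hpos] at hr2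
      rcases dich r with h | h
      · have := h x hx
        linarith
      · have := h x0 hx0
        rw [hn0] at this; linarith
  refine ⟨a x0, ?_⟩
  rw [← sub_eq_zero]
  have : ∀ x, ⟪((h - (a x0 : ℂ) • f : H →L[ℂ] H) : H →ₗ[ℂ] H) x, x⟫_ℂ = 0 := by
    intro x
    have e : ((h - (a x0 : ℂ) • f : H →L[ℂ] H) : H →ₗ[ℂ] H) x = h x - (a x0 : ℂ) • f x := rfl
    rw [e, inner_sub_left, inner_smul_left, Complex.conj_ofReal, ← proj_normsq hfs hff]
    have e2 : ⟪h x, x⟫_ℂ = ⟪h (f x), f x⟫_ℂ := by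
      have i1 : h (f x) = h x := congrArg (fun T : H →L[ℂ] H => T x) hhf
      have i2 : f (h x) = h x := congrArg (fun T : H →L[ℂ] H => T x) hfh
      rw [i1, ← inner_symm hfs, i2]
    rw [e2, ha, key (f x) (proj_apply hff x)]
    push_cast
    ring
  have h0 := (inner_map_self_eq_zero _).1 this
  ext x
  exact congrArg (fun T : H →ₗ[ℂ] H => T x) h0

lemma min_conj {M : VonNeumannAlgebra H} {f g : H →L[ℂ] H} (hf : IsMinimalProjectionIn M f)
    (hg : g ∈ M) : f * g = 0 ∨ ∃ (v : H →L[ℂ] H) (s : ℂ), IsMinimalProjectionIn M v ∧ s ≠ 0 ∧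
      star g * f * g = s • v := by
  obtain ⟨⟨hfM, hfs, hff⟩, hf0, hmin⟩ := id hf
  by_cases hfg : f * g = 0
  · exact Or.inl hfg
  right
  have hsg : star g ∈ M := star_mem hg
  obtain ⟨s, hs⟩ := min_scalar (h := f * g * star g * f) hf
    (mul_mem (mul_mem (mul_mem hfM hg) hsg) hfM)
    (by simp only [star_mul, star_star, hfs, mul_assoc])
    (by simp only [← mul_assoc, hff])
  have hs0 : s ≠ 0 := by
    rintro rfl
    apply hfg
    rw [← CStarRing.mul_star_self_eq_zero_iff, star_mul, hfs, ← mul_assoc, hs]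
    simp
  have hsc : (s : ℂ) ≠ 0 := by exact_mod_cast hs0
  set w := star g * f * g with hw
  have hw0 : w ≠ 0 := by
    intro h
    apply hfg
    rw [← CStarRing.star_mul_self_eq_zero_iff, star_mul, hfs, ← h, hw]
    simp only [mul_assoc]
    rw [← mul_assoc f f, hff]
  have hws : star w = w := by simp only [hw, star_mul, star_star, hfs, mul_assoc]
  have hww : w * w = (s : ℂ) • w := by
    calc w * w = star g * (f * g * star g * f) * g := by simp only [hw, mul_assoc]
      _ = (s : ℂ) • w := by rw [hs, hw]; simp only [mul_smul_comm, smul_mul_assoc]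
  have hv0 : (s : ℂ)⁻¹ • w ≠ 0 := smul_ne_zero (inv_ne_zero hsc) hw0
  refine ⟨(s : ℂ)⁻¹ • w, s, ⟨⟨smul_mem _ (mul_mem (mul_mem hsg hfM) hg), ?_, ?_⟩, hv0, ?_⟩,
    hsc, ?_⟩
  · rw [star_smul, hws]; simp
  · rw [smul_mul_smul_comm, hww, smul_smul]
    congr 1
    field_simp
  · rintro q ⟨hqM, hqs, hqq⟩ hvq
    have hqv : q * ((s : ℂ)⁻¹ • w) = q := by
      have := congrArg star hvq
      rw [star_mul, hqs, star_smul, hws] at this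
      simpa using this
    obtain ⟨m, hm⟩ := min_scalar (h := f * g * q * star g * f) hf
      (mul_mem (mul_mem (mul_mem (mul_mem hfM hg) hqM) hsg) hfM)
      (by simp only [star_mul, star_star, hfs, hqs, mul_assoc])
      (by simp only [← mul_assoc, hff])
    have hwqw : w * q * w = (m : ℂ) • w := by
      calc w * q * w = star g * (f * g * q * star g * f) * g := by simp only [hw, mul_assoc]
        _ = (m : ℂ) • w := by rw [hm, hw]; simp only [mul_smul_comm, smul_mul_assoc]
    have hq : q = ((m : ℂ) / s) • ((s : ℂ)⁻¹ • w) := by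
      calc q = ((s : ℂ)⁻¹ • w) * q * ((s : ℂ)⁻¹ • w) := by rw [hvq, hqv]
        _ = ((s : ℂ)⁻¹ * (s : ℂ)⁻¹) • (w * q * w) := by
          simp only [mul_smul_comm, smul_mul_assoc, smul_smul]
        _ = _ := by
          rw [hwqw, smul_smul, smul_smul]; congr 1; field_simp
    set v := (s : ℂ)⁻¹ • w with hv
    set k := (m : ℂ) / s
    have h1 : k • v = k • (k • v) := by
      rw [← hq]
      calc q = q * q := hqq.symm
        _ = (k • v) * q := by rw [← hq]
        _ = k • q := by rw [smul_mul_assoc, hvq]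
    have h2 : (k - k * k) • v = 0 := by rw [sub_smul, ← smul_smul, ← h1, sub_self]
    rcases smul_eq_zero.1 h2 with h3 | h3
    · have : k * (1 - k) = 0 := by rw [← h3]; ring
      rcases mul_eq_zero.1 this with h4 | h4
      · left; rw [hq, h4, zero_smul]
      · right; rw [hq, ← sub_eq_zero.1 h4, one_smul]
    · exact absurd h3 hv0
  · rw [smul_smul, mul_inv_cancel₀ hsc, one_smul]

lemma exists_central {M : VonNeumannAlgebra H} {p0 : H →L[ℂ] H} (hp0 : IsProjectionIn M p0)
    (hne : p0 ≠ 0) (hno : ∀ q, IsMinimalProjectionIn M q → p0 * q ≠ q) :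
    ∃ p, IsProjectionIn M p ∧ p ≠ 0 ∧ (∀ a ∈ M, a * p = p * a) ∧
      ∀ q, IsMinimalProjectionIn M q → p * q ≠ q := by
  let K : Submodule ℂ H :=
    { carrier := {x | ∀ f, IsMinimalProjectionIn M f → f x = 0}
      add_mem' := fun {x y} hx hy f hf => by rw [map_add, hx f hf, hy f hf, add_zero]
      zero_mem' := fun f _ => map_zero f
      smul_mem' := fun s x hx f hf => by rw [map_smul, hx f hf, smul_zero] }
  have hmem : ∀ x, x ∈ K ↔ ∀ f, IsMinimalProjectionIn M f → f x = 0 := fun x => Iff.rfl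
  have hK : IsClosed (K : Set H) := by
    have : (K : Set H) = ⋂ f : {f // IsMinimalProjectionIn M f}, {x | f.1 x = 0} := by
      ext x
      simp [hmem]
    rw [this]
    exact isClosed_iInter fun f => isClosed_eq (by fun_prop) (by fun_prop)
  have : CompleteSpace K := hK.completeSpace_coe
  have hinv : ∀ g ∈ M, ∀ x ∈ K, g x ∈ K := by
    intro g hg x hx f hf
    obtain ⟨⟨hfM, hfs, hff⟩, -, -⟩ := id hf
    rcases min_conj hf hg with h | ⟨v, s, hv, hs, h⟩
    · exact congrArg (fun T : H →L[ℂ] H => T x) h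
    · have h1 : (star g) (f (g x)) = s • v x := congrArg (fun T : H →L[ℂ] H => T x) h
      rw [hx v hv, smul_zero] at h1
      have h2 := proj_normsq hfs hff (g x)
      rw [← ContinuousLinearMap.adjoint_inner_left, ← ContinuousLinearMap.star_eq_adjoint,
        h1, inner_zero_left] at h2
      have h3 : ‖f (g x)‖ ^ 2 = 0 := by exact_mod_cast h2
      simpa using h3
  have hp : IsProjectionIn M K.starProjection := by
    refine star_proj_mem K ?_
    intro y hy x hx f hf
    have : y (f x) = f (y x) := congrArg (fun T : H →L[ℂ] H => T x) (comm_of_mem hf.1.1 hy)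
    rw [← this, hx f hf, map_zero]
  set p := K.starProjection with hpdef
  have hpK : ∀ x, p x ∈ K := fun x => Submodule.starProjection_apply_mem K x
  have hKp : ∀ x ∈ K, p x = x := fun x hx => Submodule.starProjection_eq_self_iff.2 hx
  have hpap : ∀ a ∈ M, p * a * p = a * p := by
    intro a ha
    ext x
    exact hKp _ (hinv a ha _ (hpK x))
  refine ⟨p, hp, ?_, ?_, ?_⟩
  · intro h0
    obtain ⟨x, hx, hx1⟩ := unit_in_proj hp0.2.2 hne
    have hxK : x ∈ K := by
      intro f hf
      rcases min_conj hf hp0.1 with h | ⟨v, s, hv, hs, h⟩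
      · rw [← hx]
        exact congrArg (fun T : H →L[ℂ] H => T x) h
      · exfalso
        apply hno v hv
        have h2 : v = s⁻¹ • (star p0 * f * p0) := by
          rw [h, smul_smul, inv_mul_cancel₀ hs, one_smul]
        rw [h2, hp0.2.1, mul_smul_comm, ← mul_assoc, ← mul_assoc, hp0.2.2]
    have := hKp x hxK
    rw [h0] at this
    rw [← this] at hx1
    simp at hx1
  · intro a ha
    have h1 := hpap (star a) (star_mem ha)
    have h2 := congrArg star h1
    simp only [star_mul, star_star, hp.2.1, ← mul_assoc] at h2
    rw [← hpap a ha, h2]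
  · intro q hq h
    apply hq.2.1
    have hqp : q * p = 0 := by
      ext x
      exact hpK x q hq
    have := congrArg star hqp
    rw [star_mul, hp.2.1, hq.1.2.1, h] at this
    simpa using this

lemma spread {M : VonNeumannAlgebra H} {p e : H →L[ℂ] H}
    (hno : ∀ q, IsMinimalProjectionIn M q → p * q ≠ q)
    (he : IsProjectionIn M e) (he0 : e ≠ 0) (hpe : p * e = e) (F : Finset H) (n : ℕ) :
    ∃ f, IsProjectionIn M f ∧ f ≠ 0 ∧ e * f = f ∧
      ∑ x ∈ F, ‖f x‖ ^ 2 ≤ (∑ x ∈ F, ‖e x‖ ^ 2) / 2 ^ n := by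
  induction n with
  | zero => exact ⟨e, he, he0, he.2.2, by simp⟩
  | succ n ih =>
    obtain ⟨f, hf, hf0, hef, hs⟩ := ih
    have hpf : p * f = f := by rw [← hef, ← mul_assoc, hpe]
    have : ∃ q, IsProjectionIn M q ∧ f * q = q ∧ q ≠ 0 ∧ q ≠ f := by
      by_contra! h
      refine hno f ⟨hf, hf0, fun q hq hfq => ?_⟩ hpf
      by_cases hq0 : q = 0
      · exact Or.inl hq0
      · exact Or.inr (h q hq hfq hq0)
    obtain ⟨q, hq, hfq, hq0, hqf⟩ := this
    have hqf' : q * f = q := by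
      have := congrArg star hfq
      rwa [star_mul, hq.2.1, hf.2.1] at this
    have hr : IsProjectionIn M (f - q) := by
      refine ⟨sub_mem hf.1 hq.1, by rw [star_sub, hf.2.1, hq.2.1], ?_⟩
      rw [sub_mul, mul_sub, mul_sub, hf.2.2, hfq, hqf', hq.2.2]
      abel
    have hsum : ∑ x ∈ F, ‖f x‖ ^ 2 = ∑ x ∈ F, ‖q x‖ ^ 2 + ∑ x ∈ F, ‖(f - q) x‖ ^ 2 := by
      rw [← Finset.sum_add_distrib]
      refine Finset.sum_congr rfl fun x _ => ?_
      have h1 := proj_normsq hf.2.1 hf.2.2 x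
      have h2 := proj_normsq hq.2.1 hq.2.2 x
      have h3 := proj_normsq hr.2.1 hr.2.2 x
      have h4 : ⟪(f - q) x, x⟫_ℂ = ⟪f x, x⟫_ℂ - ⟪q x, x⟫_ℂ := inner_sub_left _ _ _
      rw [h4, ← h1, ← h2] at h3
      have h5 : ‖(f - q) x‖ ^ 2 = ‖f x‖ ^ 2 - ‖q x‖ ^ 2 := by exact_mod_cast h3
      linarith
    have hdiv : (∑ x ∈ F, ‖e x‖ ^ 2) / 2 ^ (n + 1) = (∑ x ∈ F, ‖e x‖ ^ 2) / 2 ^ n / 2 := by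
      rw [pow_succ, div_div]
    rw [hdiv]
    rcases le_total (∑ x ∈ F, ‖q x‖ ^ 2) (∑ x ∈ F, ‖(f - q) x‖ ^ 2) with hle | hle
    · exact ⟨q, hq, hq0, by rw [← hfq, ← mul_assoc, hef], by linarith⟩
    · refine ⟨f - q, hr, sub_ne_zero.2 hqf.symm, ?_, by linarith⟩
      rw [mul_sub, hef]
      congr 1
      rw [← hfq, ← mul_assoc, hef]

lemma step {M : VonNeumannAlgebra H} {p e : H →L[ℂ] H} (hp : IsProjectionIn M p)
    (hpc : ∀ a ∈ M, a * p = p * a)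
    (hno : ∀ q, IsMinimalProjectionIn M q → p * q ≠ q)
    (he : IsProjectionIn M e) (he0 : e ≠ 0) (F : Finset H) (ε : ℝ) (hε : 0 < ε) :
    ∃ (f : H →L[ℂ] H) (η : H), IsProjectionIn M f ∧ ‖η‖ = 1 ∧ e η = η ∧ f (p η) = p η ∧
      ∀ x ∈ F, ‖f x‖ ≤ ε := by
  have hcomm := hpc e he.1
  by_cases h : e * p = 0
  · obtain ⟨η, h1, h2⟩ := unit_in_proj he.2.2 he0
    refine ⟨0, η, ⟨zero_mem _, star_zero _, zero_mul _⟩, h2, h1, ?_, ?_⟩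
    · have : p η = 0 := by
        rw [← h1]
        rw [hcomm] at h
        exact congrArg (fun T : H →L[ℂ] H => T η) h
      rw [this, map_zero]
    · intro x _
      simpa using hε.le
  · have hep : IsProjectionIn M (e * p) := by
      refine ⟨mul_mem he.1 hp.1, by rw [star_mul, he.2.1, hp.2.1, hcomm], ?_⟩
      rw [mul_assoc, ← mul_assoc p, ← hcomm, mul_assoc, hp.2.2, ← mul_assoc, he.2.2]
    have hpep : p * (e * p) = e * p := by rw [hcomm, ← mul_assoc, hp.2.2]
    set S := ∑ x ∈ F, ‖(e * p) x‖ ^ 2 with hS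
    have hS0 : 0 ≤ S := by positivity
    obtain ⟨n, hn⟩ := pow_unbounded_of_one_lt (S / ε ^ 2) (one_lt_two)
    obtain ⟨f, hf, hf0, hef, hs⟩ := spread hno hep h hpep F n
    obtain ⟨η, h1, h2⟩ := unit_in_proj hf.2.2 hf0
    have hpf : p * f = f := by rw [← hef, ← mul_assoc, hpep]
    have heef : e * f = f := by rw [← hef, ← mul_assoc, ← mul_assoc, he.2.2]
    have hpη : p η = η := by
      rw [← h1]; exact congrArg (fun T : H →L[ℂ] H => T η) hpf
    refine ⟨f, η, hf, h2, ?_, by rw [hpη, h1], ?_⟩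
    · rw [← h1]; exact congrArg (fun T : H →L[ℂ] H => T η) heef
    · intro x hx
      have h3 : ‖f x‖ ^ 2 ≤ ∑ x ∈ F, ‖f x‖ ^ 2 :=
        Finset.single_le_sum (f := fun x => ‖f x‖ ^ 2) (fun _ _ => by positivity) hx
      have h4 : S / 2 ^ n ≤ ε ^ 2 := by
        rw [div_lt_iff₀ (by positivity)] at hn
        rw [div_le_iff₀ (by positivity)]
        linarith
      exact (abs_le_of_sq_le_sq' (h3.trans (hs.trans h4)) hε.le).2

lemma criterion {M : VonNeumannAlgebra H} {c : ℕ → H →L[ℂ] H} {r : ℕ → ℝ}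
    (hr : ∀ n, r n ≤ ‖c n‖) (hcov : ∀ x ∈ (M : Set (H →L[ℂ] H)), ‖x‖ = 1 → ∃ n, ‖x - c n‖ < r n)
    {x : H →L[ℂ] H} (hx : x ∈ M) (hx0 : x ≠ 0)
    (h : ∀ n, ∀ ε > (0 : ℝ), ∃ η : H, ‖η‖ = 1 ∧ ‖c n‖ - ε ≤ ‖c n η‖ ∧ ‖x η‖ ≤ ε) : False := by
  have hpos : 0 < ‖x‖ := norm_pos_iff.2 hx0
  obtain ⟨n, hn⟩ := hcov (((‖x‖⁻¹ : ℝ) : ℂ) • x) (smul_mem _ hx) (by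
    rw [norm_smul, Complex.norm_real, norm_inv, norm_norm]
    exact inv_mul_cancel₀ hpos.ne')
  set y := ((‖x‖⁻¹ : ℝ) : ℂ) • x with hy
  have hlt := hn.trans_le (hr n)
  set d := ‖c n‖ - ‖y - c n‖ with hd
  have hdpos : 0 < d := by rw [hd]; linarith
  set ε := d / (2 * (1 + ‖x‖⁻¹)) with hε
  have hinv : 0 < ‖x‖⁻¹ := by positivity
  obtain ⟨η, h1, h2, h3⟩ := h n ε (by positivity)
  have h4 : ‖y η‖ ≤ ‖x‖⁻¹ * ε := by
    have : y η = ((‖x‖⁻¹ : ℝ) : ℂ) • x η := rfl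
    rw [this, norm_smul, Complex.norm_real, norm_inv, norm_norm]
    gcongr
  have h5 : ‖c n η‖ - ‖y η‖ ≤ ‖y - c n‖ := by
    have a1 := (y - c n).le_opNorm η
    rw [h1, mul_one] at a1
    have a2 : (y - c n) η = y η - c n η := rfl
    rw [a2] at a1
    have a3 := norm_sub_norm_le (c n η) (y η)
    rw [norm_sub_rev] at a3
    linarith
  have h6 : ε * (1 + ‖x‖⁻¹) = d / 2 := by rw [hε]; field_simp
  nlinarith

lemma bessel (s : Finset (H →L[ℂ] H)) (hs : ∀ p ∈ s, star p = p ∧ p * p = p)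
    (ho : ∀ p ∈ s, ∀ q ∈ s, p ≠ q → p * q = 0) (x : H) : ∑ p ∈ s, ‖p x‖ ^ 2 ≤ ‖x‖ ^ 2 := by
  have hP1 : star (∑ p ∈ s, p) = ∑ p ∈ s, p := by
    rw [star_sum]
    exact Finset.sum_congr rfl fun p hp => (hs p hp).1
  have hP2 : (∑ p ∈ s, p) * (∑ p ∈ s, p) = ∑ p ∈ s, p := by
    rw [Finset.sum_mul]
    refine Finset.sum_congr rfl fun p hp => ?_
    rw [Finset.mul_sum, Finset.sum_eq_single p, (hs p hp).2]
    · intro q hq hqp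
      exact ho p hp q hq hqp.symm
    · intro h; exact absurd hp h
  have h1 := proj_normsq hP1 hP2 x
  have h2 : ⟪(∑ p ∈ s, p) x, x⟫_ℂ = ((∑ p ∈ s, ‖p x‖ ^ 2 : ℝ) : ℂ) := by
    rw [_root_.sum_apply, sum_inner, Complex.ofReal_sum]
    exact Finset.sum_congr rfl fun p hp => (proj_normsq (hs p hp).1 (hs p hp).2 x).symm
  rw [h2] at h1
  have h3 : ‖(∑ p ∈ s, p) x‖ ^ 2 = ∑ p ∈ s, ‖p x‖ ^ 2 := by exact_mod_cast h1
  rw [← h3]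
  have := proj_norm_le hP1 hP2 x
  gcongr

lemma sigmaFinite (M : VonNeumannAlgebra H) (hBCP : HasBCPOn (M : Set (H →L[ℂ] H))) :
    M.SigmaFinite := by
  obtain ⟨c, r, hcM, hr, hcov⟩ := hBCP
  intro S hS ho
  by_contra hunc
  have hne : S.Nonempty := by
    by_contra h
    rw [Set.not_nonempty_iff_eq_empty] at h
    exact hunc (h ▸ Set.countable_empty)
  obtain ⟨p0, hp0⟩ := hne
  have : Nontrivial H := by
    obtain ⟨x, -, hx⟩ := unit_in_proj (hS p0 hp0).1.2.2 (hS p0 hp0).2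
    exact ⟨x, 0, by rintro rfl; simp at hx⟩
  have hex : ∀ n k : ℕ, ∃ η : H, ‖η‖ = 1 ∧ ‖c n‖ - 1 / ((k : ℝ) + 1) ≤ ‖c n η‖ := by
    intro n k
    have hk : (0 : ℝ) < 1 / ((k : ℝ) + 1) := by positivity
    obtain ⟨e, he, he0, heη⟩ := exists_spectral (hcM n) (t := ‖c n‖ - 1 / ((k : ℝ) + 1))
      (by linarith)
    obtain ⟨η, h1, h2⟩ := unit_in_proj he.2.2 he0
    refine ⟨η, h2, ?_⟩
    have := heη η h1
    rwa [h2, mul_one] at this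
  choose η hη1 hη2 using hex
  have hcount : ∀ x : H, {p ∈ S | p x ≠ 0}.Countable := by
    intro x
    have hsum : Summable fun p : S => ‖p.1 x‖ ^ 2 := by
      refine summable_of_sum_le (c := ‖x‖ ^ 2) (fun _ => by positivity) fun u => ?_
      have := bessel (u.map (Function.Embedding.subtype _)) (by
        intro p hp
        obtain ⟨q, -, rfl⟩ := Finset.mem_map.1 hp
        exact (hS _ q.2).1.2) (by
        intro p hp p' hp' hne
        obtain ⟨q, -, rfl⟩ := Finset.mem_map.1 hp
        obtain ⟨q', -, rfl⟩ := Finset.mem_map.1 hp'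
        exact ho q.2 q'.2 hne) x
      rwa [Finset.sum_map] at this
    have h1 := hsum.countable_support
    refine (h1.image Subtype.val).mono ?_
    rintro p ⟨hp, hpx⟩
    refine ⟨⟨p, hp⟩, ?_, rfl⟩
    simpa using hpx
  have hU : (⋃ i : ℕ × ℕ, {p ∈ S | p (η i.1 i.2) ≠ 0}).Countable :=
    Set.countable_iUnion fun i => hcount _
  have : ∃ p ∈ S, p ∉ (⋃ i : ℕ × ℕ, {p ∈ S | p (η i.1 i.2) ≠ 0}) := by
    by_contra! h
    exact hunc (hU.mono h)
  obtain ⟨p, hp, hpU⟩ := this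
  refine criterion hr hcov (hS p hp).1.1 (hS p hp).2 fun n ε hε => ?_
  obtain ⟨k, hk⟩ := exists_nat_one_div_lt hε
  refine ⟨η n k, hη1 n k, by linarith [hη2 n k], ?_⟩
  have : p (η n k) = 0 := by
    by_contra h
    exact hpU (Set.mem_iUnion.2 ⟨(n, k), hp, h⟩)
  rw [this, norm_zero]
  exact hε.le

lemma weak_norm_le {A : ℕ → H →L[ℂ] H} {x : H →L[ℂ] H} {u : H} {w : H} {C : ℝ} (N : ℕ)
    (hx : ∀ v, Filter.Tendsto (fun n => ⟪A n u, v⟫_ℂ)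
      (Filter.hyperfilter ℕ : Filter ℕ) (nhds ⟪x u, v⟫_ℂ))
    (h : ∀ n ≥ N, ‖A n u - w‖ ≤ C) : ‖x u - w‖ ≤ C := by
  have h1 : Filter.Tendsto (fun n => ‖⟪A n u - w, x u - w⟫_ℂ‖)
      (Filter.hyperfilter ℕ : Filter ℕ) (nhds ‖⟪x u - w, x u - w⟫_ℂ‖) := by
    refine Filter.Tendsto.norm ?_
    simp only [inner_sub_left _ _ (x u - w)]
    exact (hx _).sub tendsto_const_nhds
  have h2 : ‖⟪x u - w, x u - w⟫_ℂ‖ ≤ C * ‖x u - w‖ := by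
    refine le_of_tendsto h1 ?_
    have hle : (Filter.hyperfilter ℕ : Filter ℕ) ≤ Filter.atTop := by
      rw [← Nat.cofinite_eq_atTop]
      exact Filter.hyperfilter_le_cofinite
    refine hle (Filter.eventually_atTop.2 ⟨N, fun n hn => ?_⟩)
    refine (norm_inner_le_norm _ _).trans ?_
    gcongr
    exact h n hn
  rw [inner_self_eq_norm_sq_to_K] at h2
  have h3 : ‖x u - w‖ ^ 2 ≤ C * ‖x u - w‖ := by simpa using h2
  have hC : 0 ≤ C := (norm_nonneg _).trans (h N le_rfl)
  rcases eq_or_lt_of_le (norm_nonneg (x u - w)) with h0 | h0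
  · rw [← h0]; exact hC
  · nlinarith

lemma atomic (M : VonNeumannAlgebra H) (hBCP : HasBCPOn (M : Set (H →L[ℂ] H))) :
    M.Atomic := by
  classical
  obtain ⟨c, r, hcM, hr, hcov⟩ := hBCP
  intro p0 hp0 hne
  by_contra! hno0
  obtain ⟨p, hp, hpne, hpc, hno⟩ := exists_central hp0 hne hno0
  obtain ⟨ζ, hζ, hζ1⟩ := unit_in_proj hp.2.2 hpne
  have : Nontrivial H := ⟨ζ, 0, by rintro rfl; simp at hζ1⟩
  have hstep : ∀ (i : ℕ) (F : Finset H), ∃ (f : H →L[ℂ] H) (η : H), IsProjectionIn M f ∧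
      ‖η‖ = 1 ∧ ‖c i.unpair.1‖ - 1 / ((i.unpair.2 : ℝ) + 1) ≤ ‖c i.unpair.1 η‖ ∧
      f (p η) = p η ∧ ∀ x ∈ F, ‖f x‖ ≤ (1 / 4) * (1 / 2) ^ i := by
    intro i F
    have hk : (0 : ℝ) < 1 / ((i.unpair.2 : ℝ) + 1) := by positivity
    obtain ⟨e, he, he0, heη⟩ := exists_spectral (hcM i.unpair.1)
      (t := ‖c i.unpair.1‖ - 1 / ((i.unpair.2 : ℝ) + 1)) (by linarith)
    obtain ⟨f, η, h1, h2, h3, h4, h5⟩ := step hp hpc hno he he0 F ((1 / 4) * (1 / 2) ^ i)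
      (by positivity)
    refine ⟨f, η, h1, h2, ?_, h4, h5⟩
    have := heη η h3
    rwa [h2, mul_one] at this
  choose f' η' hf' hη1' hη2' hfη' hsm' using hstep
  let F : ℕ → Finset H := fun i => Nat.rec {ζ} (fun i G => insert (p (η' i G)) G) i
  have hF0 : F 0 = {ζ} := rfl
  have hFs : ∀ i, F (i + 1) = insert (p (η' i (F i))) (F i) := fun i => rfl
  let f : ℕ → H →L[ℂ] H := fun i => f' i (F i)
  let η : ℕ → H := fun i => η' i (F i)
  have hf : ∀ i, IsProjectionIn M (f i) := fun i => hf' i (F i)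
  have hη1 : ∀ i, ‖η i‖ = 1 := fun i => hη1' i (F i)
  have hfη : ∀ i, f i (p (η i)) = p (η i) := fun i => hfη' i (F i)
  have hsm : ∀ i, ∀ x ∈ F i, ‖f i x‖ ≤ (1 / 4) * (1 / 2) ^ i := fun i => hsm' i (F i)
  have hFmono : ∀ j m, F j ⊆ F (j + m) := by
    intro j m
    induction m with
    | zero => exact subset_rfl
    | succ m ih =>
      rw [← add_assoc, hFs]
      exact ih.trans (Finset.subset_insert _ _)
  let Q : ℕ → H →L[ℂ] H := fun i => Nat.rec 1 (fun i T => T * (1 - f i)) i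
  have hQ0 : Q 0 = 1 := rfl
  have hQs : ∀ i, Q (i + 1) = Q i * (1 - f i) := fun i => rfl
  have hQM : ∀ i, Q i ∈ M := by
    intro i
    induction i with
    | zero => exact one_mem _
    | succ i ih => exact mul_mem ih (sub_mem (one_mem _) (hf i).1)
  have hQn : ∀ i x, ‖Q i x‖ ≤ ‖x‖ := by
    intro i
    induction i with
    | zero => intro x; exact le_rfl
    | succ i ih =>
      intro x
      refine (ih ((1 - f i) x)).trans (proj_norm_le ?_ ?_ x)
      · rw [star_sub, star_one, (hf i).2.1]
      · rw [sub_mul, mul_sub, mul_sub, (hf i).2.2]; simp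
  have hdiff : ∀ j, ∀ u ∈ F j, ∀ m,
      ‖Q (j + m) u - Q j u‖ ≤ (1 / 2) * (1 / 2) ^ j - (1 / 2) * (1 / 2) ^ (j + m) := by
    intro j u hu m
    induction m with
    | zero => simp
    | succ m ih =>
      have e1 : Q (j + (m + 1)) u = Q (j + m) u - Q (j + m) (f (j + m) u) := by
        rw [← add_assoc, hQs, ← map_sub]
        rfl
      have e2 : ‖Q (j + m) (f (j + m) u)‖ ≤ (1 / 4) * (1 / 2) ^ (j + m) :=
        (hQn _ _).trans (hsm _ u (hFmono j m hu))
      have e3 : Q (j + (m + 1)) u - Q j u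
          = (Q (j + m) u - Q j u) - Q (j + m) (f (j + m) u) := by rw [e1]; abel
      rw [e3]
      refine (norm_sub_le _ _).trans ?_
      rw [← add_assoc, pow_succ _ (j + m)]
      linarith
  obtain ⟨x, hx⟩ := exists_weak_limit (fun m => Q m * p) (by
    intro m
    refine ContinuousLinearMap.opNorm_le_bound _ zero_le_one fun u => ?_
    rw [one_mul]
    exact (hQn m (p u)).trans (proj_norm_le hp.2.1 hp.2.2 u))
  have hxM : x ∈ M := by
    apply mem_of_comm
    intro y hy
    ext u
    refine ext_inner_right ℂ fun v => ?_
    change ⟪y (x u), v⟫_ℂ = ⟪x (y u), v⟫_ℂ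
    rw [← ContinuousLinearMap.adjoint_inner_right]
    refine tendsto_nhds_unique (hx u _) ?_
    refine (hx (y u) v).congr fun m => ?_
    rw [ContinuousLinearMap.adjoint_inner_right]
    have : y * (Q m * p) = (Q m * p) * y := comm_of_mem (mul_mem (hQM m) hp.1) hy
    have h2 : y ((Q m * p) u) = (Q m * p) (y u) := congrArg (fun T : H →L[ℂ] H => T u) this
    rw [h2]
  have hx0 : x ≠ 0 := by
    rintro rfl
    have h1 : ‖(0 : H →L[ℂ] H) ζ - ζ‖ ≤ 1 / 2 := by
      refine weak_norm_le 0 (hx ζ) fun m _ => ?_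
      have := hdiff 0 ζ (by rw [hF0]; simp) m
      have e : (Q m * p) ζ = Q m ζ := by
        change Q m (p ζ) = _
        rw [hζ]
      rw [e]
      rw [zero_add, hQ0] at this
      refine this.trans ?_
      have : (0 : ℝ) ≤ (1 / 2) * (1 / 2) ^ m := by positivity
      simpa using this
    have h2 : ‖(0 : H →L[ℂ] H) ζ - ζ‖ = 1 := by simp [hζ1]
    linarith
  have hxη : ∀ i, ‖x (η i)‖ ≤ (1 / 2) ^ i := by
    intro i
    have : ‖x (η i) - 0‖ ≤ (1 / 2) ^ i := by
      refine weak_norm_le (i + 1) (hx (η i)) fun m hm => ?_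
      obtain ⟨m, rfl⟩ := Nat.exists_eq_add_of_le hm
      have h1 := hdiff (i + 1) (p (η i)) (by rw [hFs]; exact Finset.mem_insert_self _ _) m
      have h2 : Q (i + 1) (p (η i)) = 0 := by
        rw [hQs]
        change Q i (p (η i) - f i (p (η i))) = 0
        rw [hfη, sub_self, map_zero]
      rw [h2] at h1
      refine h1.trans ?_
      rw [pow_succ _ i]
      have a1 : (0 : ℝ) ≤ (1 / 2) * (1 / 2) ^ (i + 1 + m) := by positivity
      have a2 : (0 : ℝ) ≤ (1 / 2) ^ i := by positivity
      linarith
    simpa using this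
  refine criterion hr hcov hxM hx0 fun n ε hε => ?_
  obtain ⟨k1, hk1⟩ := exists_nat_one_div_lt hε
  obtain ⟨k2, hk2⟩ := exists_pow_lt_of_lt_one hε (show (1 / 2 : ℝ) < 1 by norm_num)
  set k := max k1 k2
  set i := Nat.pair n k with hi
  have hi1 : i.unpair.1 = n := by simp [hi]
  have hi2 : i.unpair.2 = k := by simp [hi]
  have hki : k ≤ i := Nat.right_le_pair n k
  refine ⟨η i, hη1 i, ?_, ?_⟩
  · have h1 : ‖c i.unpair.1‖ - 1 / ((i.unpair.2 : ℝ) + 1) ≤ ‖c i.unpair.1 (η i)‖ :=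
      hη2' i (F i)
    rw [hi1, hi2] at h1
    have h2 : 1 / ((k : ℝ) + 1) ≤ 1 / ((k1 : ℝ) + 1) := by
      have : (k1 : ℝ) ≤ k := by exact_mod_cast le_max_left k1 k2
      gcongr
    linarith
  · refine (hxη i).trans (le_trans ?_ hk2.le)
    exact pow_le_pow_of_le_one (by norm_num) (by norm_num) ((le_max_right k1 k2).trans hki)

end BCPAux

/-- **Theorem 3.8, necessity.** If a von Neumann algebra `M` has the
ball-covering property, then `M` is atomic and σ-finite. -/
theorem atomic_sigmaFinite_of_BCP
    (M : VonNeumannAlgebra H) (hBCP : HasBCPOn (M : Set (H →L[ℂ] H))) :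
    M.Atomic ∧ M.SigmaFinite := by
  exact ⟨BCPAux.atomic M hBCP, BCPAux.sigmaFinite M hBCP⟩
end
end

section
/- Every atomic, σ-finite von Neumann algebra M on a complex Hilbert space H has the uniform ball-covering property. (For atomic von Neumann algebras, σ-finiteness is equivalent to separability of the predual, so this is the 'if' direction of the paper's characterization.) -/
noncomputable section

variable {H : Type*} [NormedAddCommGroup H] [InnerProductSpace ℂ H] [CompleteSpace H]

/-- A subset `S` of a normed space has the uniform ball-covering property: a countable
family of open balls with centers in `S` covering `{x ∈ S : ‖x‖ = 1}`, with uniformly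
bounded radii and uniformly (by `δ > 0`) omitting the origin. -/
def HasUBCPOn {E : Type*} [NormedAddCommGroup E] (S : Set E) : Prop :=
  ∃ (c : ℕ → E) (r : ℕ → ℝ),
    (∀ n, c n ∈ S) ∧
    (∃ R : ℝ, ∀ n, r n ≤ R) ∧
    (∃ δ : ℝ, 0 < δ ∧ ∀ n, r n + δ ≤ ‖c n‖) ∧
    ∀ x ∈ S, ‖x‖ = 1 → ∃ n, ‖x - c n‖ < r n

lemma proj_mem (M : VonNeumannAlgebra H) (K : Submodule ℂ H) [K.HasOrthogonalProjection]
    (h : ∀ y ∈ M.commutant, ∀ x ∈ K, y x ∈ K) : IsProjectionIn M K.starProjection := by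
  refine ⟨?_, ?_, ?_⟩
  · rw [VonNeumannAlgebra.IsStarProjection.mem_iff (isStarProjection_starProjection)]
    intro y hy
    rw [Module.End.mem_invtSubmodule_iff_forall_mem_of_mem]
    simpa using h y hy
  · exact isStarProjection_starProjection.isSelfAdjoint
  · exact isStarProjection_starProjection.isIdempotentElem

lemma inj_of_minimal (M : VonNeumannAlgebra H) {e b : H →L[ℂ] H}
    (he : IsMinimalProjectionIn M e) (hb : b ∈ M) {x : H} (hx : x ≠ 0) (hex : e x = x)
    (hbx : b x = 0) : b * e = 0 := by
  obtain ⟨⟨heM, hes, hei⟩, he0, hmin⟩ := he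
  have hcl : IsClosed {x : H | b x = 0 ∧ e x = x} :=
    (isClosed_eq b.continuous continuous_const).inter (isClosed_eq e.continuous continuous_id)
  let K : Submodule ℂ H :=
    { carrier := {x : H | b x = 0 ∧ e x = x}
      add_mem' := by
        rintro x y ⟨h1, h2⟩ ⟨h3, h4⟩
        exact ⟨by simp [h1, h3], by simp [h2, h4]⟩
      zero_mem' := by simp
      smul_mem' := by
        rintro c x ⟨h1, h2⟩
        exact ⟨by simp [h1], by simp [h2]⟩ }
  have : CompleteSpace K := hcl.isComplete.completeSpace_coe
  have hP : IsProjectionIn M K.starProjection := by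
    apply proj_mem
    rintro y hy x ⟨h1, h2⟩
    rw [VonNeumannAlgebra.mem_commutant_iff] at hy
    refine ⟨?_, ?_⟩
    · have := congr($(hy b hb) x)
      simpa [h1] using this
    · have := congr($(hy e heM) x)
      simpa [h2] using this
  have key : ∀ z, b (K.starProjection z) = 0 ∧ e (K.starProjection z) = K.starProjection z :=
    fun z => K.starProjection_apply_mem z
  rcases hmin _ hP (by ext z; exact (key z).2) with h | h
  · exfalso
    apply hx
    have h1 : K.starProjection x = x := Submodule.starProjection_eq_self_iff.2 ⟨hbx, hex⟩
    rw [← h1, h]; simp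
  · ext z
    have := (key z).1
    rw [h] at this
    simpa using this

lemma cfcn_memM (M : VonNeumannAlgebra H) {a : H →L[ℂ] H} (ha : a ∈ M) (f : ℝ → ℝ) :
    cfcₙ f a ∈ M := by
  rw [← VonNeumannAlgebra.commutant_commutant M, VonNeumannAlgebra.mem_commutant_iff]
  intro g hg
  rw [VonNeumannAlgebra.mem_commutant_iff] at hg
  exact ((show Commute a g from hg a ha).cfcₙ_real f).symm

lemma nonneg_apply_eq_zero {a : H →L[ℂ] H} (ha : 0 ≤ a) {x : H} (h : inner ℂ (a x) x = 0) :
    a x = 0 := by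
  obtain ⟨s, rfl⟩ := CStarAlgebra.nonneg_iff_eq_star_mul_self.1 ha
  have : s x = 0 := by
    rw [mul_apply_eq_comp, ContinuousLinearMap.star_eq_adjoint,
      ContinuousLinearMap.adjoint_inner_left] at h
    exact inner_self_eq_zero.1 h
  simp [this]

lemma sa_zero (M : VonNeumannAlgebra H) {e c : H →L[ℂ] H}
    (he : IsMinimalProjectionIn M e) (hc : c ∈ M) (hsa : IsSelfAdjoint c)
    (h1 : e * c = c) (h2 : c * e = c) {x : H} (hx : x ≠ 0) (hex : e x = x)
    (hcx : inner ℂ (c x) x = 0) : c = 0 := by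
  have hes : star e = e := he.1.2.1
  have hei : e * e = e := he.1.2.2
  have hcomm : Commute c e := h2.trans h1.symm
  have hp : c⁺ ∈ M := cfcn_memM M hc _
  have hn : c⁻ ∈ M := cfcn_memM M hc _
  have hpc : Commute c⁺ e := hcomm.cfcₙ_real _
  have hnc : Commute c⁻ e := hcomm.cfcₙ_real _
  have hpe : 0 ≤ c⁺ * e := by
    have := star_left_conjugate_nonneg (CFC.posPart_nonneg c) e
    rwa [hes, ← hpc.eq, mul_assoc, hei] at this
  have hne : 0 ≤ c⁻ * e := by
    have := star_left_conjugate_nonneg (CFC.negPart_nonneg c) e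
    rwa [hes, ← hnc.eq, mul_assoc, hei] at this
  have hdec : c⁺ * e - c⁻ * e = c := by
    rw [← sub_mul, CFC.posPart_sub_negPart c hsa, h2]
  have fin : c x = 0 → c = 0 := fun h => by
    rw [← h2]; exact inj_of_minimal M he hc hx hex h
  by_cases h : c⁻ * e = 0
  · apply fin
    rw [h, sub_zero] at hdec
    rw [← hdec] at hcx ⊢
    exact nonneg_apply_eq_zero hpe hcx
  · obtain ⟨y, hy⟩ : ∃ y, (c⁻ * e) y ≠ 0 := by
      by_contra! hh
      exact h (by ext z; simpa using hh z)
    have h3 : c⁺ * e = 0 := by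
      apply inj_of_minimal M he hp hy
      · rw [← mul_apply_eq_comp, ← mul_assoc, ← hnc.eq, mul_assoc, hei]
      · rw [← mul_apply_eq_comp, ← mul_assoc, CFC.posPart_mul_negPart]; simp
    apply fin
    rw [h3, zero_sub] at hdec
    rw [← hdec] at hcx ⊢
    have := nonneg_apply_eq_zero hne (x := x) (by simpa using hcx)
    simpa using this

lemma smul_memM (M : VonNeumannAlgebra H) {a : H →L[ℂ] H} (ha : a ∈ M) (z : ℂ) : z • a ∈ M :=
  M.toStarSubalgebra.smul_mem ha z

lemma sa_scalar (M : VonNeumannAlgebra H) {e c : H →L[ℂ] H}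
    (he : IsMinimalProjectionIn M e) (hc : c ∈ M) (hsa : IsSelfAdjoint c)
    (h1 : e * c = c) (h2 : c * e = c) : ∃ z : ℂ, c = z • e := by
  have hes : star e = e := he.1.2.1
  have hei : e * e = e := he.1.2.2
  obtain ⟨y, hy⟩ : ∃ y, e y ≠ 0 := by
    by_contra! hh
    exact he.2.1 (by ext z; simpa using hh z)
  set x := e y with hxdef
  have hex : e x = x := by rw [hxdef, ← mul_apply_eq_comp, hei]
  have hxx : inner ℂ x x ≠ 0 := by simpa using hy
  set l : ℝ := (inner ℂ (c x) x).re / ‖x‖ ^ 2 with hl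
  have him : (inner ℂ (c x) x).im = 0 := by
    have := ContinuousLinearMap.isSelfAdjoint_iff_isSymmetric.1 hsa
    exact this.im_inner_apply_self x
  refine ⟨(l : ℂ), sub_eq_zero.1 ?_⟩
  have hnx : ‖x‖ ≠ 0 := by simpa using hy
  apply sa_zero M he (sub_mem hc (smul_memM M he.1.1 _)) _ _ _ hy hex
  · have : inner ℂ (c x) x = ((inner ℂ (c x) x).re : ℂ) := by
      apply Complex.ext <;> simp [him]
    simp only [sub_apply, smul_apply, inner_sub_left,
      inner_smul_left, hex, Complex.conj_ofReal]
    rw [inner_self_eq_norm_sq_to_K, this, hl]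
    have : ((‖x‖ : ℝ) : ℂ) ≠ 0 := by exact_mod_cast hnx
    push_cast
    simp
    field_simp
    simp
  · rw [IsSelfAdjoint, star_sub, star_smul, hes, hsa.star_eq]; simp
  · rw [mul_sub, h1, mul_smul_comm, hei]
  · rw [sub_mul, h2, smul_mul_assoc, hei]

lemma scalar (M : VonNeumannAlgebra H) {e c : H →L[ℂ] H}
    (he : IsMinimalProjectionIn M e) (hc : c ∈ M)
    (h1 : e * c = c) (h2 : c * e = c) : ∃ z : ℂ, c = z • e := by
  have hes : star e = e := he.1.2.1
  have h1' : star c * e = star c := by rw [← h1, star_mul, hes, mul_assoc, he.1.2.2]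
  have h2' : e * star c = star c := by rw [← h2, star_mul, hes, ← mul_assoc, he.1.2.2]
  have hcs : star c ∈ M := star_mem hc
  obtain ⟨z, hz⟩ := sa_scalar M he (c := c + star c) (add_mem hc hcs) (IsSelfAdjoint.add_star_self c)
    (by rw [mul_add, h1, h2']) (by rw [add_mul, h2, h1'])
  obtain ⟨w, hw⟩ := sa_scalar M he (c := Complex.I • (c - star c))
    (smul_memM M (sub_mem hc hcs) _)
    (by rw [IsSelfAdjoint, star_smul, star_sub, star_star]; simp [smul_sub]; abel)
    (by rw [mul_smul_comm, mul_sub, h1, h2']) (by rw [smul_mul_assoc, sub_mul, h2, h1'])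
  refine ⟨(z - Complex.I * w) / 2, ?_⟩
  have hw' : c - star c = (-Complex.I * w) • e := by
    rw [mul_smul, ← hw, smul_smul]; simp
  have : (2 : ℂ) • c = (z - Complex.I * w) • e := by
    rw [sub_smul, ← hz, two_smul]
    have : -((Complex.I * w) • e) = c - star c := by rw [hw']; simp
    rw [sub_eq_add_neg, this]; abel
  rw [div_eq_inv_mul, mul_smul, ← this, smul_smul]; simp

lemma one_dim (M : VonNeumannAlgebra H) {e f : H →L[ℂ] H}
    (he : IsMinimalProjectionIn M e) (hf : IsMinimalProjectionIn M f) :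
    ∃ u ∈ M, ∀ x ∈ M, ∃ z : ℂ, e * x * f = z • u := by
  have hei : e * e = e := he.1.2.2
  have hfi : f * f = f := hf.1.2.2
  by_cases h : ∃ x ∈ M, e * x * f ≠ 0
  · obtain ⟨x, hx, hu0⟩ := h
    set u := e * x * f with hu
    have huM : u ∈ M := mul_mem (mul_mem he.1.1 hx) hf.1.1
    have huf : u * f = u := by rw [hu, mul_assoc, hfi]
    have heu : e * u = u := by rw [hu, ← mul_assoc, ← mul_assoc, hei]
    have hfus : f * star u = star u := by
      conv_rhs => rw [← huf, star_mul, hf.1.2.1]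
    have huse : star u * e = star u := by
      conv_rhs => rw [← heu, star_mul, he.1.2.1]
    obtain ⟨l, hl⟩ := scalar M hf (c := star u * u) (mul_mem (star_mem huM) huM)
      (by rw [← mul_assoc, hfus]) (by rw [mul_assoc, huf])
    have hl0 : l ≠ 0 := by
      rintro rfl
      rw [zero_smul] at hl
      exact hu0 (CStarRing.star_mul_self_eq_zero_iff u |>.1 hl)
    refine ⟨u, huM, fun y hy => ?_⟩
    obtain ⟨m, hm⟩ := scalar M he (c := e * y * f * star u)
      (mul_mem (mul_mem (mul_mem he.1.1 hy) hf.1.1) (star_mem huM))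
      (by simp only [← mul_assoc, hei]) (by rw [mul_assoc, huse])
    refine ⟨m / l, ?_⟩
    have : l • (e * y * f) = m • u := by
      calc l • (e * y * f) = e * y * (f * (l • f)) := by simp [mul_assoc, hfi]
        _ = (e * y * f * star u) * u := by rw [← hl]; simp only [mul_assoc]
        _ = m • u := by rw [hm, smul_mul_assoc, heu]
    rw [div_eq_inv_mul, mul_smul, ← this, smul_smul, inv_mul_cancel₀ hl0, one_smul]
  · push Not at h
    exact ⟨0, zero_mem M, fun x hx => ⟨0, by simp [h x hx]⟩⟩

lemma exists_family (M : VonNeumannAlgebra H) (hM : M.Atomic) :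
    ∃ S : Set (H →L[ℂ] H), (∀ e ∈ S, IsMinimalProjectionIn M e) ∧
      (S.Pairwise fun p q => p * q = 0) ∧
      Dense (Submodule.span ℂ {x : H | ∃ e ∈ S, e x = x} : Set H) := by
  obtain ⟨S, hS⟩ := zorn_subset {S : Set (H →L[ℂ] H) | (∀ e ∈ S, IsMinimalProjectionIn M e) ∧
      (S.Pairwise fun p q => p * q = 0)} (by
    intro c hc hchain
    refine ⟨⋃₀ c, ⟨?_, ?_⟩, fun s hs => Set.subset_sUnion_of_mem hs⟩
    · rintro e ⟨s, hs, hes⟩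
      exact (hc hs).1 e hes
    · exact (Set.pairwise_sUnion hchain.directedOn).2 fun s hs => (hc hs).2)
  refine ⟨S, hS.prop.1, hS.prop.2, ?_⟩
  rw [Submodule.dense_iff_topologicalClosure_eq_top, Submodule.topologicalClosure_eq_top_iff]
  set K := Submodule.span ℂ {x : H | ∃ e ∈ S, e x = x} with hK
  by_contra hne
  have hq : IsProjectionIn M Kᗮ.starProjection := by
    apply proj_mem
    intro y hy x hx
    have hys : star y ∈ M.commutant := star_mem hy
    rw [VonNeumannAlgebra.mem_commutant_iff] at hys
    rw [Submodule.mem_orthogonal] at hx ⊢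
    intro u hu
    rw [← ContinuousLinearMap.adjoint_inner_left]
    apply hx
    have hle : K ≤ K.comap (star y : H →L[ℂ] H).toLinearMap := by
      rw [hK, Submodule.span_le]
      rintro v ⟨e, he, hev⟩
      apply Submodule.subset_span
      refine ⟨e, he, ?_⟩
      have := congr($(hys e (hS.prop.1 e he).1.1) v)
      simpa [hev] using this
    exact hle hu
  have hq0 : Kᗮ.starProjection ≠ 0 := by
    intro h0
    apply hne
    rw [Submodule.eq_bot_iff]
    intro x hx
    have : Kᗮ.starProjection x = x := Submodule.starProjection_eq_self_iff.2 hx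
    rw [← this, h0]; simp
  obtain ⟨f, hf, hqf⟩ := hM _ hq hq0
  have hef : ∀ e ∈ S, e * f = 0 := by
    intro e he
    have he' := (hS.prop.1 e he).1
    ext z
    have hz : f z ∈ Kᗮ := by
      rw [← hqf]; exact Submodule.starProjection_apply_mem _ _
    have h1 : e (f z) ∈ K := Submodule.subset_span ⟨e, he, by
      rw [← mul_apply_eq_comp, he'.2.2]⟩
    have h2 := (Submodule.mem_orthogonal _ _).1 hz _ h1
    have h3 : inner ℂ (e (f z)) (e (f z)) = 0 := by
      rw [← h2]
      conv_lhs => rw [← ContinuousLinearMap.adjoint_inner_left, ← ContinuousLinearMap.star_eq_adjoint,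
        he'.2.1, ← mul_apply_eq_comp, he'.2.2]
    simpa using h3
  have hfe : ∀ e ∈ S, f * e = 0 := by
    intro e he
    have := congr(star $(hef e he))
    rwa [star_mul, star_zero, hf.1.2.1, (hS.prop.1 e he).1.2.1] at this
  have hfS : f ∈ S := by
    have hins : insert f S ⊆ S := hS.2 (y := insert f S) ⟨?_, ?_⟩ (Set.subset_insert f S)
    · exact hins (Set.mem_insert f S)
    · rintro e (rfl | he)
      · exact hf
      · exact hS.prop.1 e he
    · exact hS.prop.2.insert fun e he _ => ⟨hfe e he, hef e he⟩
  have := hef f hfS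
  rw [hf.1.2.2] at this
  exact hf.2.1 this

lemma exists_finset (M : VonNeumannAlgebra H) {S : Set (H →L[ℂ] H)}
    (hS : S.Pairwise fun p q => p * q = 0) {x : H}
    (hx : x ∈ Submodule.span ℂ {x : H | ∃ e ∈ S, e x = x}) :
    ∃ F : Finset (H →L[ℂ] H), (F : Set (H →L[ℂ] H)) ⊆ S ∧
      ∀ G : Finset (H →L[ℂ] H), (G : Set (H →L[ℂ] H)) ⊆ S → F ⊆ G → (∑ e ∈ G, e) x = x := by
  classical
  induction hx using Submodule.span_induction with
  | mem x hx =>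
    obtain ⟨e, he, hex⟩ := hx
    refine ⟨{e}, by simpa using he, fun G hG hF => ?_⟩
    have heG : e ∈ G := by simpa using hF
    have : (∑ f ∈ G, f) * e = e * e := by
      rw [Finset.sum_mul]
      exact Finset.sum_eq_single_of_mem e heG fun f hf hne => hS (hG hf) he hne
    have h2 := congr($this x)
    simpa only [mul_apply_eq_comp, hex] using h2
  | zero => exact ⟨∅, by simp, by simp⟩
  | add x y _ _ h1 h2 =>
    obtain ⟨F1, h1, h1'⟩ := h1
    obtain ⟨F2, h2, h2'⟩ := h2
    refine ⟨F1 ∪ F2, by simp [h1, h2], fun G hG hF => ?_⟩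
    rw [map_add, h1' G hG (Finset.union_subset_left hF), h2' G hG (Finset.union_subset_right hF)]
  | smul c x _ h =>
    obtain ⟨F, h, h'⟩ := h
    exact ⟨F, h, fun G hG hF => by rw [map_smul, h' G hG hF]⟩

lemma pyth {p : H →L[ℂ] H} (hs : star p = p) (hi : p * p = p) (w : H) :
    ‖p w‖ ^ 2 + ‖w - p w‖ ^ 2 = ‖w‖ ^ 2 := by
  have h : inner ℂ (p w) (w - p w) = 0 := by
    rw [← hs, ContinuousLinearMap.star_eq_adjoint, ContinuousLinearMap.adjoint_inner_left,
      ← ContinuousLinearMap.star_eq_adjoint, hs, map_sub, ← mul_apply_eq_comp, hi]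
    simp
  have := norm_add_sq_eq_norm_sq_add_norm_sq_of_inner_eq_zero _ _ h
  rw [add_sub_cancel] at this
  nlinarith

lemma norm_bound {p x : H →L[ℂ] H} (hs : star p = p) (hi : p * p = p) (hx : ‖x‖ = 1) :
    ‖x - (2 : ℂ) • (p * x * p)‖ ≤ √2 := by
  refine ContinuousLinearMap.opNorm_le_bound _ (by positivity) fun v => ?_
  have hii : ∀ w, p (p w) = p w := fun w => by rw [← mul_apply_eq_comp, hi]
  have hxle : ∀ w, ‖x w‖ ≤ ‖w‖ := fun w => by simpa [hx] using x.le_opNorm w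
  set T := x - (2 : ℂ) • (p * x * p) with hT
  have e0 : T v = x v - (2 : ℂ) • p (x (p v)) := by simp [hT]
  have e1 : p (T v) = p (x (v - (2 : ℂ) • p v)) := by
    rw [e0]; simp [hii]
  have e2 : T v - p (T v) = x v - p (x v) := by
    rw [e0]; simp [hii]
  have e3 : ‖v - (2 : ℂ) • p v‖ ^ 2 = ‖v‖ ^ 2 := by
    rw [← pyth hs hi (v - (2 : ℂ) • p v), ← pyth hs hi v]
    have a1 : p (v - (2 : ℂ) • p v) = - p v := by
      rw [map_sub, map_smul, hii, two_smul]; abel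
    rw [a1, norm_neg, two_smul]
    congr 3
    abel
  have b1 : ‖p (T v)‖ ^ 2 ≤ ‖v‖ ^ 2 := by
    rw [e1]
    have := pyth hs hi (x (v - (2 : ℂ) • p v))
    have h2 := hxle (v - (2 : ℂ) • p v)
    have h3 := pow_le_pow_left₀ (norm_nonneg _) h2 2
    nlinarith [sq_nonneg ‖x (v - (2 : ℂ) • p v) - p (x (v - (2 : ℂ) • p v))‖]
  have b2 : ‖T v - p (T v)‖ ^ 2 ≤ ‖v‖ ^ 2 := by
    rw [e2]
    have := pyth hs hi (x v)
    have h3 := pow_le_pow_left₀ (norm_nonneg _) (hxle v) 2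
    nlinarith [sq_nonneg ‖p (x v)‖]
  have := pyth hs hi (T v)
  refine (sq_le_sq₀ (norm_nonneg _) (by positivity)).1 ?_
  rw [mul_pow, Real.sq_sqrt (by norm_num)]
  linarith

lemma sum_proj (M : VonNeumannAlgebra H) {S : Set (H →L[ℂ] H)}
    (hm : ∀ e ∈ S, IsMinimalProjectionIn M e)
    (hS : S.Pairwise fun p q => p * q = 0) {F : Finset (H →L[ℂ] H)}
    (hF : (F : Set (H →L[ℂ] H)) ⊆ S) :
    star (∑ e ∈ F, e) = ∑ e ∈ F, e ∧ (∑ e ∈ F, e) * (∑ e ∈ F, e) = ∑ e ∈ F, e := by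
  constructor
  · rw [star_sum]
    exact Finset.sum_congr rfl fun e he => (hm e (hF he)).1.2.1
  · rw [Finset.sum_mul]
    refine Finset.sum_congr rfl fun e he => ?_
    rw [Finset.mul_sum, Finset.sum_eq_single_of_mem e he fun f hf hne => hS (hF he) (hF hf) hne.symm]
    exact (hm e (hF he)).1.2.2

lemma exists_compress (M : VonNeumannAlgebra H) {S : Set (H →L[ℂ] H)}
    (hm : ∀ e ∈ S, IsMinimalProjectionIn M e)
    (hS : S.Pairwise fun p q => p * q = 0)
    (hd : Dense (Submodule.span ℂ {x : H | ∃ e ∈ S, e x = x} : Set H))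
    {x : H →L[ℂ] H} (hx : ‖x‖ = 1) :
    ∃ F : Finset (H →L[ℂ] H), (F : Set (H →L[ℂ] H)) ⊆ S ∧
      15 / 16 < ‖(∑ e ∈ F, e) * x * (∑ e ∈ F, e)‖ := by
  classical
  by_contra! hcon
  have hle : ‖x‖ ≤ 15 / 16 := by
    have key : ∀ u v : H, ‖inner ℂ (x u) v‖ ≤ 15 / 16 * ‖u‖ * ‖v‖ := by
      intro u
      refine hd.induction ?_ (isClosed_le (by fun_prop) (by fun_prop))
      intro v hv
      revert u
      refine hd.induction ?_ (isClosed_le (by fun_prop) (by fun_prop))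
      intro u hu
      obtain ⟨F1, h1, h1'⟩ := exists_finset M hS hu
      obtain ⟨F2, h2, h2'⟩ := exists_finset M hS hv
      have hG : ((F1 ∪ F2 : Finset (H →L[ℂ] H)) : Set (H →L[ℂ] H)) ⊆ S := by simp [h1, h2]
      have hu' := h1' _ hG Finset.subset_union_left
      have hv' := h2' _ hG Finset.subset_union_right
      have hb := hcon _ hG
      have hs := (sum_proj M hm hS hG).1
      set p := ∑ e ∈ F1 ∪ F2, e
      have : inner ℂ (x u) v = inner ℂ ((p * x * p) u) v := by
        simp only [mul_apply_eq_comp, hu']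
        conv_rhs => rw [← hs, ContinuousLinearMap.star_eq_adjoint,
          ContinuousLinearMap.adjoint_inner_left, hv']
      rw [this]
      refine (norm_inner_le_norm _ _).trans ?_
      gcongr
      exact (p * x * p).le_of_opNorm_le hb u
    refine ContinuousLinearMap.opNorm_le_of_re_inner_le (𝕜 := ℂ) (by norm_num) fun u v hu hv => ?_
    refine (RCLike.re_le_norm _).trans ?_
    simpa [hu, hv] using key u v
  rw [hx] at hle
  norm_num at hle

/-- **Theorem 3.8, sufficiency.** Every atomic σ-finite von Neumann
algebra has the uniform ball-covering property. -/
theorem atomic_sigmaFinite_UBCP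
    (M : VonNeumannAlgebra H) (hM : M.Atomic) (hσ : M.SigmaFinite) :
    HasUBCPOn (M : Set (H →L[ℂ] H)) := by
  obtain ⟨S, hm, hS, hd⟩ := exists_family M hM
  have hc : S.Countable := hσ S (fun p hp => ⟨(hm p hp).1, (hm p hp).2.1⟩) hS
  have : Countable S := hc.to_subtype
  choose u huM hu using fun (ef : S × S) => one_dim M (hm ef.1 ef.1.2) (hm ef.2 ef.2.2)
  set V := Submodule.span ℂ (Set.range u) with hV
  have hsep : TopologicalSpace.IsSeparable (V : Set (H →L[ℂ] H)) :=
    (Set.countable_range u).isSeparable.span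
  obtain ⟨t, htV, htc, hdense⟩ := hsep.exists_countable_dense_subset
  have hVM : (V : Set (H →L[ℂ] H)) ⊆ M := by
    have : V ≤ M.toStarSubalgebra.toSubalgebra.toSubmodule := by
      rw [hV, Submodule.span_le]
      rintro _ ⟨ef, rfl⟩
      exact huM ef
    exact this
  have hne : (insert 0 t : Set (H →L[ℂ] H)).Nonempty := Set.insert_nonempty _ _
  obtain ⟨g, hg⟩ := (htc.insert 0).exists_eq_range hne
  refine ⟨g, fun n => if 7 / 4 ≤ ‖g n‖ then 3 / 2 else -1, ?_, ⟨3 / 2, ?_⟩, ⟨1 / 4, by norm_num, ?_⟩, ?_⟩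
  · intro n
    have : g n ∈ insert 0 t := hg ▸ Set.mem_range_self n
    rcases this with h | h
    · rw [h]; exact zero_mem M
    · exact hVM (htV h)
  · intro n
    dsimp only
    split_ifs <;> norm_num
  · intro n
    dsimp only
    split_ifs with h
    · linarith
    · linarith [norm_nonneg (g n)]
  · intro x hx hx1
    obtain ⟨F, hF, hlt⟩ := exists_compress M hm hS hd hx1
    obtain ⟨hs, hi⟩ := sum_proj M hm hS hF
    have hb := norm_bound hs hi hx1
    have hmem : (2 : ℂ) • ((∑ e ∈ F, e) * x * (∑ e ∈ F, e)) ∈ V := by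
      apply V.smul_mem
      rw [Finset.sum_mul, Finset.sum_mul]
      refine V.sum_mem fun e he => ?_
      rw [Finset.mul_sum]
      refine V.sum_mem fun f hf => ?_
      obtain ⟨z, hz⟩ := hu (⟨e, hF he⟩, ⟨f, hF hf⟩) x hx
      dsimp only at hz
      rw [hz]
      exact V.smul_mem _ (Submodule.subset_span ⟨_, rfl⟩)
    obtain ⟨c, hct, hdist⟩ := Metric.mem_closure_iff.1 (hdense hmem) (1 / 16) (by norm_num)
    set y := (∑ e ∈ F, e) * x * (∑ e ∈ F, e) with hy
    obtain ⟨n, rfl⟩ : c ∈ Set.range g := hg ▸ Set.mem_insert_of_mem _ hct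
    rw [dist_eq_norm] at hdist
    have h2y : ‖(2 : ℂ) • y‖ = 2 * ‖y‖ := by rw [norm_smul]; simp
    have h1 := norm_sub_norm_le ((2 : ℂ) • y) (g n)
    have h2 : ‖x - g n‖ ≤ ‖x - (2 : ℂ) • y‖ + ‖(2 : ℂ) • y - g n‖ := norm_sub_le_norm_sub_add_norm_sub _ _ _
    have h3 : √2 < 1.42 := by
      rw [Real.sqrt_lt' (by norm_num)]; norm_num
    refine ⟨n, ?_⟩
    dsimp only
    rw [if_pos (by linarith)]
    linarith
end
end

section
/- For a von Neumann algebra M on a complex Hilbert space H the following are equivalent: (i) M has the ball-covering property; (ii) M has the uniform ball-covering property; (iii) M is atomic and σ-finite. (For atomic von Neumann algebras, σ-finiteness is equivalent to separability of the predual, so this is exactly the paper's characterization: M has the BCP/UBCP iff M is atomic with separable predual.) -/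
noncomputable section

variable {H : Type*} [NormedAddCommGroup H] [InnerProductSpace ℂ H] [CompleteSpace H]

namespace BCPProof

open ContinuousLinearMap

theorem mulA (a b : H →L[ℂ] H) (v : H) : (a * b) v = a (b v) := rfl

theorem oneA (v : H) : (1 : H →L[ℂ] H) v = v := rfl

theorem smul_mem' (M : VonNeumannAlgebra H) {x : H →L[ℂ] H} (a : ℂ) (hx : x ∈ M) : a • x ∈ M :=
  M.toStarSubalgebra.smul_mem hx a

theorem mem_of_comm (M : VonNeumannAlgebra H) {x : H →L[ℂ] H}
    (h : ∀ y ∈ M.commutant, y * x = x * y) : x ∈ M := by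
  rw [← VonNeumannAlgebra.commutant_commutant M, VonNeumannAlgebra.mem_commutant_iff]
  exact h

theorem comm_of_mem (M : VonNeumannAlgebra H) {x y : H →L[ℂ] H} (hx : x ∈ M)
    (hy : y ∈ M.commutant) : y * x = x * y :=
  (VonNeumannAlgebra.mem_commutant_iff.1 hy x hx).symm

theorem proj_of_invt (M : VonNeumannAlgebra H) (K : Submodule ℂ H) [K.HasOrthogonalProjection]
    (h : ∀ y ∈ M.commutant, ∀ v ∈ K, y v ∈ K) : IsProjectionIn M K.starProjection := by
  have hs : IsStarProjection K.starProjection := isStarProjection_starProjection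
  refine ⟨?_, hs.isSelfAdjoint, hs.isIdempotentElem⟩
  rw [VonNeumannAlgebra.IsStarProjection.mem_iff hs]
  intro y hy
  rw [Submodule.range_starProjection]
  intro v hv
  exact h y hy v hv

theorem norm_sq_proj {p : H →L[ℂ] H} (h1 : star p = p) (h2 : p * p = p) (v : H) :
    inner ℂ (p v) v = ((‖p v‖ ^ 2 : ℝ) : ℂ) := by
  have h3 : p (p v) = p v := by
    rw [← mulA, h2]
  conv_lhs => rw [← h3]
  rw [← adjoint_inner_right, ← star_eq_adjoint, h1, inner_self_eq_norm_sq_to_K]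
  simp

theorem norm_proj_le {p : H →L[ℂ] H} (h1 : star p = p) (h2 : p * p = p) : ‖p‖ ≤ 1 :=
  IsStarProjection.norm_le p ⟨h2, h1⟩

/-- Spectral lemma. -/
theorem spectral (M : VonNeumannAlgebra H) {c e : H →L[ℂ] H} (hc : c ∈ M) (he1 : star e = e)
    (hce : c * e = c) {t : ℝ} (ht : 0 < t) (htc : t < ‖c‖) :
    ∃ f, IsProjectionIn M f ∧ f ≠ 0 ∧ e * f = f ∧ ∀ v, f v = v → t * ‖v‖ ≤ ‖c v‖ := by
  set b : H →L[ℂ] H := star c * c - ((t ^ 2 : ℝ) : ℂ) • 1 with hb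
  have hsa : IsSelfAdjoint b := by
    rw [IsSelfAdjoint, hb]
    simp [star_smul]
  have hcomm : ∀ y : H →L[ℂ] H, Commute (star c * c) y → Commute b⁻ y := by
    intro y hy
    rw [CFC.negPart_def]
    apply Commute.cfcₙ_real
    rw [hb]
    exact hy.sub_left ((Commute.one_left y).smul_left _)
  have hbpm := CFC.posPart_sub_negPart b hsa
  have hmul : b⁻ * b⁺ = 0 := CFC.negPart_mul_posPart b
  set K : Submodule ℂ H := (b⁻).ker with hK
  have : CompleteSpace K := (ContinuousLinearMap.isClosed_ker b⁻).completeSpace_coe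
  have hKm : ∀ v, v ∈ K ↔ b⁻ v = 0 := fun v => Iff.rfl
  have hinv : ∀ y : H →L[ℂ] H, Commute (star c * c) y → ∀ v ∈ K, y v ∈ K := by
    intro y hy v hv
    rw [hKm] at hv ⊢
    rw [← mulA, (hcomm y hy).eq, mulA, hv, map_zero]
  have hlow : ∀ v ∈ K, t * ‖v‖ ≤ ‖c v‖ := by
    intro v hv
    have h1 : b v = b⁺ v := by
      conv_lhs => rw [← hbpm]
      rw [sub_apply, (hKm v).1 hv, sub_zero]
    have h2 : 0 ≤ (inner ℂ (b⁺ v) v).re :=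
      ((ContinuousLinearMap.nonneg_iff_isPositive _).1 (CFC.posPart_nonneg b)).re_inner_nonneg_left v
    rw [← h1, hb] at h2
    have h3 : (inner ℂ ((star c * c - ((t ^ 2 : ℝ) : ℂ) • (1 : H →L[ℂ] H)) v) v).re
        = ‖c v‖ ^ 2 - t ^ 2 * ‖v‖ ^ 2 := by
      rw [sub_apply, inner_sub_left, mulA, star_eq_adjoint, adjoint_inner_left,
        inner_self_eq_norm_sq_to_K, smul_apply, oneA, inner_smul_left, inner_self_eq_norm_sq_to_K]
      simp [← Complex.ofReal_pow]
    rw [h3] at h2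
    apply le_of_sq_le_sq _ (norm_nonneg _)
    nlinarith
  refine ⟨K.starProjection, proj_of_invt M K ?_, ?_, ?_, ?_⟩
  · intro y hy
    apply hinv
    exact (comm_of_mem M (mul_mem (star_mem hc) hc) hy).symm
  · intro h0
    have hbot : ∀ v ∈ K, v = 0 := by
      intro v hv
      rw [← Submodule.starProjection_eq_self_iff.2 hv, h0, zero_apply]
    have hpos : b⁺ = 0 := by
      ext v
      apply hbot
      rw [hKm, ← mulA, hmul, zero_apply]
    have hle : b ≤ 0 := by
      rw [← hbpm, hpos, zero_sub]
      exact neg_nonpos.2 (CFC.negPart_nonneg b)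
    have hcb : ‖c‖ ≤ t := by
      apply ContinuousLinearMap.opNorm_le_bound _ ht.le
      intro v
      have h2 : 0 ≤ (inner ℂ ((-b) v) v).re :=
        ((ContinuousLinearMap.nonneg_iff_isPositive _).1 (neg_nonneg.2 hle)).re_inner_nonneg_left v
      have h3 : (inner ℂ ((-(star c * c - ((t ^ 2 : ℝ) : ℂ) • (1 : H →L[ℂ] H))) v) v).re
          = t ^ 2 * ‖v‖ ^ 2 - ‖c v‖ ^ 2 := by
        rw [neg_apply, inner_neg_left, sub_apply, inner_sub_left, mulA, star_eq_adjoint,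
          adjoint_inner_left, inner_self_eq_norm_sq_to_K, smul_apply, oneA, inner_smul_left,
          inner_self_eq_norm_sq_to_K]
        simp [← Complex.ofReal_pow]
      rw [hb, h3] at h2
      apply le_of_sq_le_sq _ (by positivity)
      nlinarith
    linarith
  · ext v
    have hv : K.starProjection v ∈ K := Submodule.starProjection_apply_mem K v
    set w := K.starProjection v with hw
    have hce' : e * star c = star c := by
      have := congrArg star hce
      rwa [star_mul, he1] at this
    have hcomm_e : Commute (star c * c) e := by
      rw [Commute, SemiconjBy, mul_assoc, hce, ← mul_assoc, hce']
    have h1 : w - e w ∈ K := K.sub_mem hv (hinv e hcomm_e w hv)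
    have h2 := hlow _ h1
    rw [map_sub, ← mulA c e, hce, sub_self, norm_zero] at h2
    have h3 : ‖w - e w‖ = 0 := by
      apply le_antisymm _ (norm_nonneg _)
      by_contra hcon
      push Not at hcon
      nlinarith [mul_pos ht hcon]
    rw [norm_eq_zero, sub_eq_zero] at h3
    rw [mulA, ← hw, ← h3]
  · intro v hv
    exact hlow v (Submodule.starProjection_eq_self_iff.1 hv)

/-- Elements are multiples of isometries on the range of a minimal projection. -/
theorem minimal_norm (M : VonNeumannAlgebra H) {e y : H →L[ℂ] H} (he : IsMinimalProjectionIn M e)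
    (hy : y ∈ M) {v : H} (hv : e v = v) : ‖y v‖ = ‖y * e‖ * ‖v‖ := by
  obtain ⟨⟨heM, he1, he2⟩, he0, hemin⟩ := he
  apply le_antisymm
  · conv_lhs => rw [← hv, ← mulA]
    exact le_opNorm _ _
  · by_contra hcon
    push Not at hcon
    have hvpos : 0 < ‖v‖ := by
      by_contra h
      have : ‖v‖ = 0 := le_antisymm (not_lt.1 h) (norm_nonneg _)
      rw [this, mul_zero] at hcon
      linarith [norm_nonneg (y v)]
    have h1 : ‖y v‖ / ‖v‖ < ‖y * e‖ := (div_lt_iff₀ hvpos).2 hcon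
    obtain ⟨t, ht1, ht2⟩ := exists_between h1
    have ht : 0 < t := lt_of_le_of_lt (by positivity) ht1
    obtain ⟨f, hf, hf0, hef, hlow⟩ := spectral M (mul_mem hy heM) he1
      (by rw [mul_assoc, he2]) ht ht2
    rcases hemin f hf hef with h | h
    · exact hf0 h
    · have := hlow v (by rw [h, hv])
      rw [mulA, hv] at this
      rw [div_lt_iff₀ hvpos] at ht1
      linarith

theorem minimal_scalar (M : VonNeumannAlgebra H) {e y : H →L[ℂ] H}
    (he : IsMinimalProjectionIn M e) (hy : y ∈ M) : ∃ k : ℂ, e * y * e = k • e := by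
  have hn := fun (z : H →L[ℂ] H) (hz : z ∈ M) (v : H) (hv : e v = v) =>
    minimal_norm M he hz hv
  obtain ⟨⟨heM, he1, he2⟩, he0, hemin⟩ := he
  have key : ∃ k : ℂ, ∀ v, e v = v → inner ℂ (y v) v = k * inner ℂ v v := by
    refine ⟨((‖(y + 1) * e‖ ^ 2 : ℂ) - ‖(y - 1) * e‖ ^ 2 +
      (‖(y - Complex.I • 1) * e‖ ^ 2 - ‖(y + Complex.I • 1) * e‖ ^ 2) * Complex.I) / 4, ?_⟩
    intro v hv
    have a1 := hn (y + 1) (add_mem hy (one_mem M)) v hv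
    have a2 := hn (y - 1) (sub_mem hy (one_mem M)) v hv
    have a3 := hn (y - Complex.I • 1) (sub_mem hy (smul_mem' M _ (one_mem M))) v hv
    have a4 := hn (y + Complex.I • 1) (add_mem hy (smul_mem' M _ (one_mem M))) v hv
    simp only [add_apply, sub_apply, smul_apply, oneA] at a1 a2 a3 a4
    rw [inner_eq_sum_norm_sq_div_four, inner_self_eq_norm_sq_to_K]
    simp only [RCLike.I_to_complex, a1, a2, a3, a4, Complex.coe_algebraMap]
    push_cast
    ring
  obtain ⟨k, hk⟩ := key
  refine ⟨starRingEnd ℂ k, ?_⟩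
  apply ContinuousLinearMap.coe_injective
  rw [← ext_inner_map]
  intro v
  have hev : e (e v) = e v := by rw [← mulA, he2]
  have h := hk (e v) hev
  have hadj : ∀ a b : H, inner ℂ (e a) b = inner ℂ a (e b) := by
    intro a b
    conv_lhs => rw [← he1, star_eq_adjoint, adjoint_inner_left]
  simp only [coe_coe, mulA, toLinearMap_smul, LinearMap.smul_apply]
  rw [hadj, inner_smul_left, Complex.conj_conj, h, hadj, hev, hadj]

theorem oneDim (M : VonNeumannAlgebra H) {p p' : H →L[ℂ] H} (hp : IsMinimalProjectionIn M p)
    (hp' : IsMinimalProjectionIn M p') :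
    ∃ u ∈ M, ∀ y ∈ M, ∃ k : ℂ, p * y * p' = k • u := by
  by_cases h : ∃ z ∈ M, p * z * p' ≠ 0
  · obtain ⟨z, hz, hu0⟩ := h
    have hpM := hp.1.1
    have hpM' := hp'.1.1
    obtain ⟨u, hu⟩ : ∃ u, u = p * z * p' := ⟨_, rfl⟩
    have huM : u ∈ M := by rw [hu]; exact mul_mem (mul_mem hpM hz) hpM'
    refine ⟨u, huM, ?_⟩
    rw [← hu] at hu0
    have hpu : p * u = u := by rw [hu, ← mul_assoc, ← mul_assoc, hp.1.2.2]
    have hup : u * p' = u := by rw [hu, mul_assoc, hp'.1.2.2]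
    have hsu : star u * p = star u := by
      have := congrArg star hpu
      rwa [star_mul, hp.1.2.1] at this
    have hsu' : p' * star u = star u := by
      have := congrArg star hup
      rwa [star_mul, hp'.1.2.1] at this
    intro y hy
    obtain ⟨k, hk⟩ := minimal_scalar M hp' (mul_mem (star_mem huM) hy)
    obtain ⟨s, hs⟩ := minimal_scalar M hp (mul_mem huM (star_mem huM))
    have hs' : u * star u = s • p := by
      rw [← hs, ← mul_assoc, hpu, mul_assoc, hsu]
    have hs0 : s ≠ 0 := by
      rintro rfl
      rw [zero_smul, CStarRing.mul_star_self_eq_zero_iff] at hs'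
      exact hu0 hs'
    refine ⟨s⁻¹ * k, ?_⟩
    have h1 : s • (p * y * p') = k • u := by
      calc s • (p * y * p') = (s • p) * y * p' := by simp only [smul_mul_assoc]
        _ = u * (p' * (star u * y) * p') := by
          rw [← hs', ← mul_assoc p', hsu']; simp only [mul_assoc]
        _ = k • u := by rw [hk, mul_smul_comm, hup]
    rw [mul_smul, ← h1, smul_smul, inv_mul_cancel₀ hs0, one_smul]
  · push Not at h
    exact ⟨0, zero_mem M, fun y hy => ⟨0, by rw [h y hy, smul_zero]⟩⟩

end BCPProof
namespace BCPProof

open ContinuousLinearMap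

theorem sum_mul_mem {S : Set (H →L[ℂ] H)} (hS : ∀ p ∈ S, p * p = p)
    (hpw : S.Pairwise fun p q => p * q = 0) (G : Finset (H →L[ℂ] H)) (hG : ↑G ⊆ S)
    {p : H →L[ℂ] H} (hp : p ∈ G) : (∑ g ∈ G, g) * p = p := by
  rw [Finset.sum_mul, Finset.sum_eq_single p]
  · exact hS p (hG hp)
  · intro b hb hbp
    exact hpw (hG hb) (hG hp) hbp
  · intro h
    exact absurd hp h

theorem one_sub_norm_le {S : Set (H →L[ℂ] H)} (hS1 : ∀ p ∈ S, star p = p)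
    (hS : ∀ p ∈ S, p * p = p)
    (hpw : S.Pairwise fun p q => p * q = 0) (G : Finset (H →L[ℂ] H)) (hG : ↑G ⊆ S) :
    ‖1 - ∑ g ∈ G, g‖ ≤ 1 := by
  have h1 : star (∑ g ∈ G, g) = ∑ g ∈ G, g := by
    rw [star_sum]
    exact Finset.sum_congr rfl fun p hp => hS1 p (hG hp)
  have h2 : (∑ g ∈ G, g) * (∑ g ∈ G, g) = ∑ g ∈ G, g := by
    conv_lhs => rw [Finset.mul_sum]
    exact Finset.sum_congr rfl fun p hp => sum_mul_mem hS hpw G hG hp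
  apply norm_proj_le
  · rw [star_sub, star_one, h1]
  · rw [mul_sub, sub_mul, sub_mul, h2]
    simp

theorem exists_family (M : VonNeumannAlgebra H) (hA : M.Atomic) :
    ∃ S : Set (H →L[ℂ] H), (∀ p ∈ S, IsMinimalProjectionIn M p) ∧
      (S.Pairwise fun p q => p * q = 0) ∧
      ∀ v : H, ∀ ε > 0, ∃ F : Finset (H →L[ℂ] H), ↑F ⊆ S ∧ ‖(1 - ∑ p ∈ F, p) v‖ < ε := by
  classical
  obtain ⟨S, hS⟩ := zorn_subset {S : Set (H →L[ℂ] H) | (∀ p ∈ S, IsMinimalProjectionIn M p) ∧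
      (S.Pairwise fun p q => p * q = 0)} (by
    intro c hc hchain
    refine ⟨⋃₀ c, ⟨?_, ?_⟩, fun s hs => Set.subset_sUnion_of_mem hs⟩
    · rintro p ⟨s, hs, hps⟩
      exact (hc hs).1 p hps
    · rw [Set.pairwise_sUnion hchain.directedOn]
      intro s hs
      exact (hc hs).2)
  obtain ⟨⟨hmin, hpw⟩, hmax⟩ := hS
  refine ⟨S, hmin, hpw, ?_⟩
  have hS1 : ∀ p ∈ S, star p = p := fun p hp => (hmin p hp).1.2.1
  have hS2 : ∀ p ∈ S, p * p = p := fun p hp => (hmin p hp).1.2.2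
  set K : Submodule ℂ H := ⨅ p ∈ S, p.ker with hK
  have hKm : ∀ v, v ∈ K ↔ ∀ p ∈ S, p v = 0 := by
    intro v
    simp [hK, Submodule.mem_iInf]
  have hKc : IsClosed (K : Set H) := by
    have : (K : Set H) = ⋂ p ∈ S, (p.ker : Set H) := by
      ext v
      simp [hKm]
    rw [this]
    exact isClosed_biInter fun p _ => ContinuousLinearMap.isClosed_ker p
  have : CompleteSpace K := hKc.completeSpace_coe
  have hKbot : ∀ v ∈ K, v = 0 := by
    have hproj : IsProjectionIn M K.starProjection := by
      apply proj_of_invt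
      intro y hy v hv
      rw [hKm] at hv ⊢
      intro p hp
      rw [← mulA, ← comm_of_mem M (hmin p hp).1.1 hy, mulA, hv p hp, map_zero]
    by_contra hcon
    push Not at hcon
    obtain ⟨v, hv, hv0⟩ := hcon
    obtain ⟨e, he, hKe⟩ := hA _ hproj (by
      intro h0
      apply hv0
      rw [← Submodule.starProjection_eq_self_iff.2 hv, h0, zero_apply])
    have hpe : ∀ p ∈ S, p * e = 0 := by
      intro p hp
      ext w
      have h1 : e w ∈ K := by
        rw [← hKe]
        exact Submodule.starProjection_apply_mem K _
      exact (hKm _).1 h1 p hp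
    have hep : ∀ p ∈ S, e * p = 0 := by
      intro p hp
      have := congrArg star (hpe p hp)
      rwa [star_mul, he.1.2.1, hS1 p hp, star_zero] at this
    have heS : e ∈ S := by
      apply hmax (y := insert e S) _ (Set.subset_insert _ _) (Set.mem_insert _ _)
      refine ⟨?_, ?_⟩
      · rintro p (rfl | hp)
        · exact he
        · exact hmin p hp
      · apply hpw.insert
        intro p hp _
        exact ⟨hep p hp, hpe p hp⟩
    apply he.2.1
    rw [← he.1.2.2]
    exact hpe e heS
  set W : Submodule ℂ H := Submodule.span ℂ (⋃ p ∈ S, Set.range p) with hW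
  have hWd : W.topologicalClosure = ⊤ := by
    rw [Submodule.topologicalClosure_eq_top_iff, Submodule.eq_bot_iff]
    intro v hv
    apply hKbot
    rw [hKm]
    intro p hp
    have h1 : p v ∈ W := Submodule.subset_span (Set.mem_biUnion hp ⟨v, rfl⟩)
    have h2 := (Submodule.mem_orthogonal W v).1 hv _ h1
    rw [norm_sq_proj (hS1 p hp) (hS2 p hp)] at h2
    simpa using h2
  have hWF : ∀ w ∈ W, ∃ F : Finset (H →L[ℂ] H), ↑F ⊆ S ∧ ∀ G : Finset (H →L[ℂ] H),
      F ⊆ G → ↑G ⊆ S → (∑ p ∈ G, p) w = w := by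
    intro w hw
    induction hw using Submodule.span_induction with
    | mem x h =>
      simp only [Set.mem_iUnion] at h
      obtain ⟨p, hp, z, rfl⟩ := h
      refine ⟨{p}, by simpa using hp, ?_⟩
      intro G hG hGS
      rw [← mulA, sum_mul_mem hS2 hpw G hGS (hG (by simp))]
    | zero => exact ⟨∅, by simp, by simp⟩
    | add x y _ _ hx hy =>
      obtain ⟨F1, hF1, h1⟩ := hx
      obtain ⟨F2, hF2, h2⟩ := hy
      refine ⟨F1 ∪ F2, by simp [hF1, hF2], ?_⟩
      intro G hG hGS
      rw [map_add, h1 G (Finset.union_subset_left hG) hGS, h2 G (Finset.union_subset_right hG) hGS]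
    | smul a x _ hx =>
      obtain ⟨F1, hF1, h1⟩ := hx
      refine ⟨F1, hF1, ?_⟩
      intro G hG hGS
      rw [map_smul, h1 G hG hGS]
  intro v ε hε
  have hv : v ∈ closure (W : Set H) := by
    rw [← Submodule.topologicalClosure_coe, hWd]
    trivial
  obtain ⟨w, hw, hvw⟩ := Metric.mem_closure_iff.1 hv ε hε
  obtain ⟨F, hF, h⟩ := hWF w hw
  refine ⟨F, hF, ?_⟩
  have h1 := h F (Finset.Subset.refl _) hF
  have h2 : (1 - ∑ p ∈ F, p) v = (1 - ∑ p ∈ F, p) (v - w) := by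
    rw [map_sub]
    simp only [sub_apply, h1, oneA, sub_self, sub_zero]
  rw [h2]
  calc _ ≤ ‖1 - ∑ p ∈ F, p‖ * ‖v - w‖ := le_opNorm _ _
    _ ≤ 1 * ‖v - w‖ := by
      gcongr
      exact one_sub_norm_le hS1 hS2 hpw F hF
    _ < ε := by rwa [one_mul, ← dist_eq_norm]

theorem exists_unit_of_proj {e : H →L[ℂ] H} (he2 : e * e = e) (he0 : e ≠ 0) :
    ∃ v, e v = v ∧ ‖v‖ = 1 := by
  obtain ⟨w, hw⟩ : ∃ w, e w ≠ 0 := by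
    by_contra h
    push Not at h
    exact he0 (ContinuousLinearMap.ext h)
  have hn : ‖e w‖ ≠ 0 := norm_ne_zero_iff.2 hw
  refine ⟨((‖e w‖⁻¹ : ℝ) : ℂ) • e w, ?_, ?_⟩
  · rw [map_smul, ← mulA, he2]
  · rw [norm_smul]
    simp [hn]

theorem approx_left (M : VonNeumannAlgebra H) {S : Set (H →L[ℂ] H)}
    (hmin : ∀ p ∈ S, IsMinimalProjectionIn M p)
    (hS : ∀ v : H, ∀ ε > 0, ∃ F : Finset (H →L[ℂ] H), ↑F ⊆ S ∧ ‖(1 - ∑ p ∈ F, p) v‖ < ε)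
    {e y : H →L[ℂ] H} (he : IsMinimalProjectionIn M e) (hy : y ∈ M) {ε : ℝ} (hε : 0 < ε) :
    ∃ F : Finset (H →L[ℂ] H), ↑F ⊆ S ∧ ‖(1 - ∑ p ∈ F, p) * y * e‖ < ε := by
  obtain ⟨v, hv, hv1⟩ := exists_unit_of_proj he.1.2.2 he.2.1
  obtain ⟨F, hF, h⟩ := hS (y v) ε hε
  refine ⟨F, hF, ?_⟩
  have hM : (1 - ∑ p ∈ F, p) * y ∈ M :=
    mul_mem (sub_mem (one_mem M) (sum_mem fun p hp => (hmin p (hF hp)).1.1)) hy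
  have := minimal_norm M he hM hv
  rw [hv1, mul_one] at this
  rw [← this]
  exact h

theorem iii_imp_ubcp (M : VonNeumannAlgebra H) (hA : M.Atomic) (hs : M.SigmaFinite) :
    HasUBCPOn (M : Set (H →L[ℂ] H)) := by
  obtain ⟨S, hmin, hpw, hS⟩ := exists_family M hA
  have hSc : S.Countable := hs S (fun p hp => ⟨(hmin p hp).1, (hmin p hp).2.1⟩) hpw
  have hu : ∀ pp : S × S, ∃ u ∈ M, ∀ y ∈ M, ∃ k : ℂ, pp.1.1 * y * pp.2.1 = k • u :=
    fun pp => oneDim M (hmin _ pp.1.2) (hmin _ pp.2.2)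
  choose u huM huk using hu
  have : Countable S := hSc.to_subtype
  set V : Submodule ℂ (H →L[ℂ] H) := Submodule.span ℂ (Set.range u) with hV
  have hVM : ∀ x ∈ V, x ∈ M := by
    intro x hx
    have : V ≤ Subalgebra.toSubmodule M.toStarSubalgebra.toSubalgebra := by
      rw [hV, Submodule.span_le]
      rintro _ ⟨pp, rfl⟩
      exact huM pp
    exact this hx
  have hVmem : ∀ p ∈ S, ∀ p' ∈ S, ∀ y ∈ M, p * y * p' ∈ V := by
    intro p hp p' hp' y hy
    obtain ⟨k, hk⟩ := huk (⟨p, hp⟩, ⟨p', hp'⟩) y hy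
    simp only at hk
    rw [hk]
    exact V.smul_mem _ (Submodule.subset_span ⟨_, rfl⟩)
  have hVcl : ∀ q, IsMinimalProjectionIn M q → ∀ x ∈ M, x * q ∈ V.topologicalClosure := by
    intro q hq x hx
    have hxq : x * q ∈ M := mul_mem hx hq.1.1
    have step1 : ∀ p' ∈ S, x * q * p' ∈ V.topologicalClosure := by
      intro p' hp'
      rw [← SetLike.mem_coe, Submodule.topologicalClosure_coe, Metric.mem_closure_iff]
      intro ε hε
      obtain ⟨F, hF, h⟩ := approx_left M hmin hS (hmin p' hp') hxq hε
      refine ⟨(∑ p ∈ F, p) * (x * q) * p', ?_, ?_⟩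
      · rw [Finset.sum_mul, Finset.sum_mul]
        exact V.sum_mem fun p hp => hVmem p (hF hp) p' hp' _ hxq
      · rw [dist_eq_norm]
        rwa [sub_mul, sub_mul, one_mul] at h
    have hcl : IsClosed (V.topologicalClosure : Set (H →L[ℂ] H)) :=
      V.isClosed_topologicalClosure
    rw [← SetLike.mem_coe, ← hcl.closure_eq, Metric.mem_closure_iff]
    intro ε hε
    obtain ⟨F, hF, h⟩ := approx_left M hmin hS hq (one_mem M)
      (show 0 < ε / (‖x‖ + 1) by positivity)
    refine ⟨x * q * (∑ p ∈ F, p), ?_, ?_⟩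
    · rw [Finset.mul_sum]
      exact Submodule.sum_mem _ fun p hp => step1 p (hF hp)
    · rw [dist_eq_norm]
      have h1 : x * q - x * q * (∑ p ∈ F, p) = x * star ((1 - ∑ p ∈ F, p) * 1 * q) := by
        have : star (∑ p ∈ F, p) = ∑ p ∈ F, p := by
          rw [star_sum]
          exact Finset.sum_congr rfl fun p hp => (hmin p (hF hp)).1.2.1
        rw [mul_one, star_mul, hq.1.2.1, star_sub, star_one, this, mul_sub, mul_one, mul_sub,
          mul_assoc]
      rw [h1]
      rw [lt_div_iff₀ (by positivity)] at h
      calc _ ≤ ‖x‖ * ‖star ((1 - ∑ p ∈ F, p) * 1 * q)‖ := norm_mul_le _ _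
        _ ≤ ‖(1 - ∑ p ∈ F, p) * 1 * q‖ * (‖x‖ + 1) := by
          rw [norm_star]
          nlinarith [norm_nonneg ((1 - ∑ p ∈ F, p) * 1 * q)]
        _ < ε := h
  have hVsep : TopologicalSpace.IsSeparable (V : Set (H →L[ℂ] H)) :=
    (Set.countable_range u).isSeparable.span
  obtain ⟨C, hCV, hCc, hCd⟩ := hVsep.exists_countable_dense_subset
  have hCne : C.Nonempty := by
    by_contra hcon
    rw [Set.not_nonempty_iff_eq_empty] at hcon
    rw [hcon] at hCd
    simpa using hCd V.zero_mem
  obtain ⟨d, hd⟩ := hCc.exists_eq_range hCne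
  classical
  have hdM : ∀ n, d n ∈ M := fun n => hVM _ (hCV (by rw [hd]; exact ⟨n, rfl⟩))
  refine ⟨fun n => if 3 / 2 ≤ ‖(2 : ℂ) • d n‖ then (2 : ℂ) • d n else 0,
    fun n => if 3 / 2 ≤ ‖(2 : ℂ) • d n‖ then 5 / 4 else -1, ?_, ⟨5 / 4, ?_⟩, ⟨1 / 4, by norm_num, ?_⟩,
    ?_⟩
  · intro n
    dsimp only
    split_ifs
    · exact smul_mem' M _ (hdM n)
    · exact zero_mem M
  · intro n
    dsimp only
    split_ifs <;> norm_num
  · intro n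
    dsimp only
    split_ifs with h
    · linarith
    · norm_num
  · intro x hx hx1
    obtain ⟨f, hf, hf0, -, hlow⟩ := spectral M hx (star_one _) (mul_one x)
      (show (0 : ℝ) < 9 / 10 by norm_num) (by rw [hx1]; norm_num)
    obtain ⟨q, hq, hfq⟩ := hA f hf hf0
    obtain ⟨v, hv, hv1⟩ := exists_unit_of_proj hq.1.2.2 hq.2.1
    have hxq : 9 / 10 ≤ ‖x * q‖ := by
      have h1 := hlow v (by rw [← hv, ← mulA, hfq])
      have h2 := minimal_norm M hq hx hv
      rw [hv1] at h1 h2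
      linarith
    have hcl : x * q ∈ closure C := by
      have h1 := hVcl q hq x hx
      rw [← SetLike.mem_coe, Submodule.topologicalClosure_coe] at h1
      exact closure_minimal hCd isClosed_closure h1
    obtain ⟨c, hc, hdist⟩ := Metric.mem_closure_iff.1 hcl (1 / 20) (by norm_num)
    rw [hd] at hc
    obtain ⟨n, rfl⟩ := hc
    refine ⟨n, ?_⟩
    rw [dist_eq_norm] at hdist
    have hn : ‖(2 : ℂ) • d n‖ = 2 * ‖d n‖ := by rw [norm_smul]; simp
    have hlow2 : 17 / 20 ≤ ‖d n‖ := by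
      have := norm_sub_norm_le (x * q) (d n)
      linarith
    have hif : 3 / 2 ≤ ‖(2 : ℂ) • d n‖ := by rw [hn]; linarith
    simp only [hif, if_true]
    have hU : ‖x - (2 : ℂ) • (x * q)‖ ≤ 1 := by
      have hfac : x - (2 : ℂ) • (x * q) = x * (1 - (2 : ℂ) • q) := by
        rw [mul_sub, mul_one, mul_smul_comm]
      have hsq : ‖1 - (2 : ℂ) • q‖ * ‖1 - (2 : ℂ) • q‖ ≤ 1 := by
        rw [← CStarRing.norm_star_mul_self]
        have : star (1 - (2 : ℂ) • q) * (1 - (2 : ℂ) • q) = 1 := by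
          rw [star_sub, star_one, star_smul, hq.1.2.1]
          simp only [sub_mul, mul_sub, one_mul, mul_one, smul_mul_assoc, mul_smul_comm, hq.1.2.2]
          simp only [RCLike.star_def, map_ofNat]
          module
        rw [this]
        exact ContinuousLinearMap.norm_id_le
      have h1 : ‖1 - (2 : ℂ) • q‖ ≤ 1 := by nlinarith [norm_nonneg (1 - (2 : ℂ) • q)]
      rw [hfac]
      calc _ ≤ ‖x‖ * ‖1 - (2 : ℂ) • q‖ := norm_mul_le _ _
        _ ≤ 1 := by rw [hx1, one_mul]; exact h1
    have hsplit : x - (2 : ℂ) • d n = (x - (2 : ℂ) • (x * q)) + (2 : ℂ) • (x * q - d n) := by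
      module
    rw [hsplit]
    calc _ ≤ ‖x - (2 : ℂ) • (x * q)‖ + ‖(2 : ℂ) • (x * q - d n)‖ := norm_add_le _ _
      _ = ‖x - (2 : ℂ) • (x * q)‖ + 2 * ‖x * q - d n‖ := by rw [norm_smul]; simp
      _ < 5 / 4 := by linarith

theorem ubcp_imp_bcp (M : VonNeumannAlgebra H) (h : HasUBCPOn (M : Set (H →L[ℂ] H))) :
    HasBCPOn (M : Set (H →L[ℂ] H)) := by
  obtain ⟨c, r, hc, -, ⟨δ, hδ, hr⟩, hcov⟩ := h
  exact ⟨c, r, hc, fun n => by linarith [hr n], hcov⟩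

end BCPProof
namespace BCPProof

open ContinuousLinearMap Filter Topology

theorem almost_norming (c : H →L[ℂ] H) (k : ℕ) :
    ∃ v : H, ‖v‖ ≤ 1 ∧ ‖c‖ - 1 / ((k : ℝ) + 1) ≤ ‖c v‖ := by
  have h : ‖c‖ - 1 / ((k : ℝ) + 1) < ‖c‖ := by
    have : (0 : ℝ) < 1 / ((k : ℝ) + 1) := by positivity
    linarith
  by_cases h0 : ‖c‖ - 1 / ((k : ℝ) + 1) ≤ 0
  · exact ⟨0, by simp, by simpa using h0⟩
  · obtain ⟨v, hv, hv2⟩ := ContinuousLinearMap.exists_lt_apply_of_lt_opNorm c h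
    exact ⟨v, hv.le, hv2.le⟩

theorem countable_support {S : Set (H →L[ℂ] H)} (hS1 : ∀ p ∈ S, star p = p)
    (hS2 : ∀ p ∈ S, p * p = p) (hpw : S.Pairwise fun p q => p * q = 0) (v : H) :
    {p ∈ S | p v ≠ 0}.Countable := by
  classical
  have hsum : Summable (fun p : S => ‖p.1 v‖ ^ 2) := by
    apply summable_of_sum_le (c := ‖v‖ ^ 2) (fun p => by positivity)
    intro F
    set G : Finset (H →L[ℂ] H) := F.image Subtype.val with hG
    have hGS : ↑G ⊆ S := by
      intro p hp
      simp only [hG, Finset.coe_image, Set.mem_image] at hp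
      obtain ⟨q, _, rfl⟩ := hp
      exact q.2
    have e1 : ∑ p ∈ F, ‖p.1 v‖ ^ 2 = ∑ p ∈ G, ‖p v‖ ^ 2 := by
      rw [hG, Finset.sum_image]
      intro a _ b _ h
      exact Subtype.ext h
    have h1 : star (∑ g ∈ G, g) = ∑ g ∈ G, g := by
      rw [star_sum]
      exact Finset.sum_congr rfl fun p hp => hS1 p (hGS hp)
    have h2 : (∑ g ∈ G, g) * (∑ g ∈ G, g) = ∑ g ∈ G, g := by
      conv_lhs => rw [Finset.mul_sum]
      exact Finset.sum_congr rfl fun p hp => sum_mul_mem hS2 hpw G hGS hp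
    have e2 : ((∑ p ∈ G, ‖p v‖ ^ 2 : ℝ) : ℂ) = ((‖(∑ p ∈ G, p) v‖ ^ 2 : ℝ) : ℂ) := by
      rw [← norm_sq_proj h1 h2, sum_apply, sum_inner, Complex.ofReal_sum]
      exact Finset.sum_congr rfl fun p hp => (norm_sq_proj (hS1 p (hGS hp)) (hS2 p (hGS hp)) v).symm
    rw [e1, Complex.ofReal_injective e2]
    have := le_of_opNorm_le _ (norm_proj_le h1 h2) v
    rw [one_mul] at this
    gcongr
  have hc := hsum.countable_support
  refine (hc.image Subtype.val).mono ?_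
  rintro p ⟨hp, hpv⟩
  refine ⟨⟨p, hp⟩, ?_, rfl⟩
  simpa [Function.mem_support] using hpv

theorem norm_proj_eq_one {p : H →L[ℂ] H} (h1 : star p = p) (h2 : p * p = p) (h0 : p ≠ 0) :
    ‖p‖ = 1 := by
  apply le_antisymm (norm_proj_le h1 h2)
  obtain ⟨v, hv, hv1⟩ := exists_unit_of_proj h2 h0
  have := le_opNorm p v
  rwa [hv, hv1, mul_one] at this

theorem bcp_imp_sigmaFinite (M : VonNeumannAlgebra H) (h : HasBCPOn (M : Set (H →L[ℂ] H))) :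
    M.SigmaFinite := by
  obtain ⟨c, r, hc, hr, hcov⟩ := h
  intro S hS hpw
  have hS1 : ∀ p ∈ S, star p = p := fun p hp => (hS p hp).1.2.1
  have hS2 : ∀ p ∈ S, p * p = p := fun p hp => (hS p hp).1.2.2
  by_contra hunc
  choose ξ hξ1 hξ2 using fun n k => almost_norming (c n) k
  have hT : (⋃ n, ⋃ k, {p ∈ S | p (ξ n k) ≠ 0}).Countable :=
    Set.countable_iUnion fun n => Set.countable_iUnion fun k => countable_support hS1 hS2 hpw _
  obtain ⟨p, hp, hpT⟩ : ∃ p ∈ S, p ∉ ⋃ n, ⋃ k, {p ∈ S | p (ξ n k) ≠ 0} := by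
    by_contra hcon
    push Not at hcon
    exact hunc (hT.mono hcon)
  simp only [Set.mem_iUnion, Set.mem_setOf_eq, not_exists, not_and, not_not] at hpT
  obtain ⟨n, hn⟩ := hcov p (hS p hp).1.1 (norm_proj_eq_one (hS1 p hp) (hS2 p hp) (hS p hp).2)
  have hlt : ‖p - c n‖ < ‖c n‖ := lt_of_lt_of_le hn (hr n)
  obtain ⟨k, hk⟩ := exists_nat_one_div_lt (sub_pos.2 hlt)
  have h1 : ‖(p - c n) (ξ n k)‖ ≤ ‖p - c n‖ := by
    have := le_opNorm (p - c n) (ξ n k)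
    nlinarith [hξ1 n k, norm_nonneg (p - c n)]
  rw [sub_apply, hpT n k hp, zero_sub, norm_neg] at h1
  linarith [hξ2 n k]

theorem minimal_kills (M : VonNeumannAlgebra H) {p : H →L[ℂ] H} (hp : IsProjectionIn M p)
    (hno : ¬ ∃ q, IsMinimalProjectionIn M q ∧ p * q = q) {η : H} (hη : p η = η)
    {e : H →L[ℂ] H} (he : IsMinimalProjectionIn M e) : e η = 0 := by
  by_contra hne
  apply hno
  obtain ⟨l, hl⟩ := minimal_scalar M he hp.1
  have hpM := hp.1
  obtain ⟨heM, he1, he2⟩ := he.1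
  obtain ⟨-, hp1, hp2⟩ := hp
  have hl0 : l ≠ 0 := by
    rintro rfl
    rw [zero_smul] at hl
    have h1 : star (p * e) * (p * e) = 0 := by
      rw [star_mul, hp1, he1, ← hl]
      simp only [mul_assoc]
      rw [← mul_assoc p p e, hp2]
    rw [CStarRing.star_mul_self_eq_zero_iff] at h1
    have h2 := congrArg star h1
    rw [star_mul, hp1, he1, star_zero] at h2
    apply hne
    rw [← hη, ← mulA, h2, zero_apply]
  have hlr : star l = l := by
    have h1 := congrArg star hl
    rw [star_mul, star_mul, he1, hp1, star_smul, he1, ← mul_assoc, hl] at h1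
    have h2 : (star l - l) • e = 0 := by rw [sub_smul, h1, sub_self]
    rcases smul_eq_zero.1 h2 with h | h
    · exact sub_eq_zero.1 h
    · exact absurd h he.2.1
  set q : H →L[ℂ] H := l⁻¹ • (p * e * p) with hq
  have hpep : (p * e * p) * (p * e * p) = l • (p * e * p) := by
    calc (p * e * p) * (p * e * p) = p * (e * (p * p) * e) * p := by simp only [mul_assoc]
      _ = l • (p * e * p) := by rw [hp2, hl, mul_smul_comm, smul_mul_assoc]
  have hqM : q ∈ M := smul_mem' M _ (mul_mem (mul_mem hpM heM) hpM)
  have hq1 : star q = q := by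
    rw [hq, star_smul, star_mul, star_mul, hp1, he1, star_inv₀, hlr, mul_assoc]
  have hq2 : q * q = q := by
    rw [hq, smul_mul_assoc, mul_smul_comm, hpep, smul_smul l⁻¹ l, inv_mul_cancel₀ hl0, one_smul]
  have hpq : p * q = q := by
    rw [hq, mul_smul_comm, ← mul_assoc, ← mul_assoc, hp2]
  have hpepq : p * e * p = l • q := by
    rw [hq, smul_smul, mul_inv_cancel₀ hl0, one_smul]
  refine ⟨q, ⟨⟨hqM, hq1, hq2⟩, ?_, ?_⟩, hpq⟩
  · intro h0
    rw [h0, smul_zero] at hpepq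
    have h3 : (e * p * e) * (e * p * e) = 0 := by
      calc (e * p * e) * (e * p * e) = e * (p * (e * e) * p) * e := by simp only [mul_assoc]
        _ = 0 := by rw [he2, hpepq, mul_zero, zero_mul]
    rw [hl, smul_mul_assoc, mul_smul_comm, he2, smul_smul] at h3
    rcases smul_eq_zero.1 h3 with h | h
    · exact hl0 (by simpa using h)
    · exact he.2.1 h
  · intro r hr hqr
    have hrq : r * q = r := by
      have := congrArg star hqr
      rwa [star_mul, hq1, hr.2.1] at this
    obtain ⟨k, hk⟩ := minimal_scalar M he (mul_mem (mul_mem hpM hr.1) hpM)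
    have hr' : r = (l⁻¹ * l⁻¹ * k * l) • q := by
      calc r = q * r * q := by rw [hqr, hrq]
        _ = (l⁻¹ * l⁻¹) • (p * (e * (p * r * p) * e) * p) := by
          rw [hq]
          simp only [smul_mul_assoc, mul_smul_comm, smul_smul, mul_assoc]
        _ = (l⁻¹ * l⁻¹ * k * l) • q := by
          rw [hk, mul_smul_comm, smul_mul_assoc, hpepq, smul_smul, smul_smul, mul_assoc]
    set m := l⁻¹ * l⁻¹ * k * l with hm
    have hq0 : q ≠ 0 ∨ q = 0 := (em _).symm
    rcases hq0 with hq0 | hq0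
    · have h4 := hr.2.2
      rw [hr', smul_mul_assoc, mul_smul_comm, hq2, smul_smul, ← sub_eq_zero, ← sub_smul] at h4
      rcases smul_eq_zero.1 h4 with h | h
      · have h5 : m * (m - 1) = 0 := by linear_combination h
        rcases mul_eq_zero.1 h5 with h6 | h6
        · left
          rw [hr', h6, zero_smul]
        · right
          rw [hr', sub_eq_zero.1 h6, one_smul]
      · exact absurd h hq0
    · left
      rw [hr', hq0, smul_zero]

theorem small_proj (M : VonNeumannAlgebra H) {p : H →L[ℂ] H} (hp : IsProjectionIn M p)
    (hno : ¬ ∃ q, IsMinimalProjectionIn M q ∧ p * q = q) {η : H} (hη : p η = η)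
    {f : H →L[ℂ] H} (hf : IsProjectionIn M f) (hf0 : f ≠ 0) (k : ℕ) :
    ∃ e, IsProjectionIn M e ∧ e ≠ 0 ∧ f * e = e ∧ ‖e η‖ ^ 2 ≤ ‖f η‖ ^ 2 / 2 ^ k := by
  induction k with
  | zero => exact ⟨f, hf, hf0, hf.2.2, by simp⟩
  | succ k ih =>
    obtain ⟨e, he, he0, hfe, hle⟩ := ih
    by_cases hmin : IsMinimalProjectionIn M e
    · refine ⟨e, he, he0, hfe, ?_⟩
      rw [minimal_kills M hp hno hη hmin]
      simp
      positivity
    · have hex : ∃ q, IsProjectionIn M q ∧ e * q = q ∧ q ≠ 0 ∧ q ≠ e := by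
        by_contra hcon
        push Not at hcon
        refine hmin ⟨he, he0, ?_⟩
        intro q hq heq
        by_cases h : q = 0
        · exact Or.inl h
        · exact Or.inr (hcon q hq heq h)
      obtain ⟨q, hq, heq, hq0, hqe⟩ := hex
      have hqe' : q * e = q := by
        have := congrArg star heq
        rwa [star_mul, hq.2.1, he.2.1] at this
      have hd : IsProjectionIn M (e - q) := by
        refine ⟨sub_mem he.1 hq.1, by rw [star_sub, he.2.1, hq.2.1], ?_⟩
        rw [mul_sub, sub_mul, sub_mul, he.2.2, heq, hqe', hq.2.2]
        simp
      have hsum : ‖e η‖ ^ 2 = ‖q η‖ ^ 2 + ‖(e - q) η‖ ^ 2 := by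
        apply Complex.ofReal_injective
        rw [Complex.ofReal_add, ← norm_sq_proj he.2.1 he.2.2, ← norm_sq_proj hq.2.1 hq.2.2,
          ← norm_sq_proj hd.2.1 hd.2.2, ← inner_add_left]
        simp
      have hpow : ‖f η‖ ^ 2 / 2 ^ (k + 1) = ‖f η‖ ^ 2 / 2 ^ k / 2 := by
        rw [pow_succ (2 : ℝ) k, div_div]
      rw [hpow]
      by_cases hc : ‖q η‖ ^ 2 ≤ ‖(e - q) η‖ ^ 2
      · refine ⟨q, hq, hq0, ?_, by linarith⟩
        rw [← heq, ← mul_assoc, hfe]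
      · refine ⟨e - q, hd, sub_ne_zero.2 (Ne.symm hqe), ?_, by linarith⟩
        rw [mul_sub, hfe, ← heq, ← mul_assoc, hfe]

/-- Weak operator limits. -/
theorem wot_limit (M : VonNeumannAlgebra H) (x : ℕ → H →L[ℂ] H) (hx : ∀ n, x n ∈ M)
    (hn : ∀ n, ‖x n‖ ≤ 1) (U : Ultrafilter ℕ) :
    ∃ y ∈ M, ∀ v w : H, Tendsto (fun n => inner ℂ (x n v) w) U (𝓝 (inner ℂ (y v) w)) := by
  have hbd : ∀ n v w, ‖inner ℂ (x n v) w‖ ≤ ‖v‖ * ‖w‖ := by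
    intro n v w
    calc _ ≤ ‖x n v‖ * ‖w‖ := norm_inner_le_norm _ _
      _ ≤ ‖v‖ * ‖w‖ := by
        gcongr
        have := le_of_opNorm_le _ (hn n) v
        rwa [one_mul] at this
  have hlim : ∀ v w : H, ∃ b : ℂ, Tendsto (fun n => inner ℂ (x n v) w) U (𝓝 b) := by
    intro v w
    obtain ⟨b, -, hb⟩ := (isCompact_closedBall (0 : ℂ) (‖v‖ * ‖w‖)).ultrafilter_le_nhds
      (U.map fun n => inner ℂ (x n v) w) (by
        rw [Ultrafilter.coe_map, le_principal_iff, mem_map]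
        refine Filter.univ_mem' ?_
        intro n
        simpa using hbd n v w)
    exact ⟨b, hb⟩
  choose B hB using hlim
  have hBb : ∀ v w, ‖B v w‖ ≤ 1 * ‖v‖ * ‖w‖ := by
    intro v w
    rw [one_mul]
    exact le_of_tendsto (hB v w).norm (Eventually.of_forall fun n => hbd n v w)
  let L : H →ₗ⋆[ℂ] H →ₗ[ℂ] ℂ := LinearMap.mk₂'ₛₗ (starRingEnd ℂ) (RingHom.id ℂ) B
    (fun v v' w => tendsto_nhds_unique (hB (v + v') w) (by
      simpa [inner_add_left] using (hB v w).add (hB v' w)))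
    (fun a v w => tendsto_nhds_unique (hB (a • v) w) (by
      simpa [inner_smul_left, mul_comm] using (hB v w).const_mul (starRingEnd ℂ a)))
    (fun v w w' => tendsto_nhds_unique (hB v (w + w')) (by
      simpa [inner_add_right] using (hB v w).add (hB v w')))
    (fun a v w => tendsto_nhds_unique (hB v (a • w)) (by
      simpa [inner_smul_right] using (hB v w).const_mul a))
  let L' : H →L⋆[ℂ] H →L[ℂ] ℂ := L.mkContinuous₂ 1 hBb
  set y := InnerProductSpace.continuousLinearMapOfBilin L' with hy
  have hyB : ∀ v w, inner ℂ (y v) w = B v w := by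
    intro v w
    rw [hy, InnerProductSpace.continuousLinearMapOfBilin_apply]
    rfl
  have hyt : ∀ v w : H, Tendsto (fun n => inner ℂ (x n v) w) U (𝓝 (inner ℂ (y v) w)) := by
    intro v w
    rw [hyB]
    exact hB v w
  refine ⟨y, ?_, hyt⟩
  apply mem_of_comm
  intro z hz
  ext v
  apply ext_inner_right ℂ
  intro w
  have h1 := hyt v (adjoint z w)
  have h2 := hyt (z v) w
  rw [adjoint_inner_right] at h1
  refine tendsto_nhds_unique h1 (h2.congr ?_)
  intro n
  rw [adjoint_inner_right, ← mulA (x n), ← comm_of_mem M (hx n) hz, mulA]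

end BCPProof
namespace BCPProof

open ContinuousLinearMap Filter Topology

theorem resolvent_fin (M : VonNeumannAlgebra H) (e : ℕ → H →L[ℂ] H)
    (he : ∀ i, IsProjectionIn M (e i)) (m : ℕ → ℝ) (hm : ∀ i, 0 < m i) {η : H} (hη : ‖η‖ = 1)
    (N : ℕ) (hN : ∑ i ∈ Finset.range N, m i * ‖e i η‖ ^ 2 ≤ 2) :
    ∃ x ∈ M, ‖x‖ ≤ 1 ∧ 1 / 3 ≤ (inner ℂ (x η) η).re ∧
      ∀ i < N, ∀ v, e i v = v → ‖x v‖ ^ 2 ≤ ‖v‖ ^ 2 / m i := by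
  set h : H →L[ℂ] H := ∑ i ∈ Finset.range N, ((m i : ℝ) : ℂ) • e i with hh
  have hform : ∀ v, inner ℂ (h v) v = ((∑ i ∈ Finset.range N, m i * ‖e i v‖ ^ 2 : ℝ) : ℂ) := by
    intro v
    rw [hh, sum_apply, sum_inner, Complex.ofReal_sum]
    refine Finset.sum_congr rfl fun i _ => ?_
    rw [smul_apply, inner_smul_left, norm_sq_proj (he i).2.1 (he i).2.2]
    simp
  have hsa : star h = h := by
    rw [hh, star_sum]
    refine Finset.sum_congr rfl fun i _ => ?_
    rw [star_smul, (he i).2.1]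
    simp
  have hnn : ∀ v, 0 ≤ ∑ i ∈ Finset.range N, m i * ‖e i v‖ ^ 2 := fun v =>
    Finset.sum_nonneg fun i _ => mul_nonneg (hm i).le (by positivity)
  have hpos : 0 ≤ h := by
    rw [ContinuousLinearMap.nonneg_iff_isPositive, ContinuousLinearMap.isPositive_def']
    refine ⟨hsa, fun v => ?_⟩
    rw [reApplyInnerSelf_apply, hform, RCLike.re_to_complex, Complex.ofReal_re]
    exact hnn v
  have hunit : IsUnit (1 + h) := by
    apply CStarAlgebra.isUnit_of_le (1 : H →L[ℂ] H)
    exact le_add_of_nonneg_right hpos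
  obtain ⟨⟨A, B, hAB, hBA⟩, hA⟩ := hunit
  simp only at hA
  have hhM : h ∈ M := by
    rw [hh]
    exact sum_mem fun i _ => smul_mem' M _ (he i).1
  have hAM : A ∈ M := by rw [hA]; exact add_mem (one_mem M) hhM
  have hBM : B ∈ M := by
    apply mem_of_comm
    intro y hy
    have h1 := comm_of_mem M hAM hy
    calc y * B = (B * A) * (y * B) := by rw [hBA, one_mul]
      _ = B * (A * y) * B := by simp only [mul_assoc]
      _ = B * y * (A * B) := by rw [← h1]; simp only [mul_assoc]
      _ = B * y := by rw [hAB, mul_one]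
  have hAform : ∀ v, inner ℂ (A v) v
      = ((‖v‖ ^ 2 + ∑ i ∈ Finset.range N, m i * ‖e i v‖ ^ 2 : ℝ) : ℂ) := by
    intro v
    rw [hA, add_apply, inner_add_left, hform, oneA, inner_self_eq_norm_sq_to_K]
    simp
  have hABv : ∀ v, A (B v) = v := by
    intro v
    rw [← mulA, hAB, oneA]
  have hBform : ∀ v, (inner ℂ v (B v)).re
      = ‖B v‖ ^ 2 + ∑ i ∈ Finset.range N, m i * ‖e i (B v)‖ ^ 2 := by
    intro v
    have := hAform (B v)
    rw [hABv] at this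
    rw [this, Complex.ofReal_re]
  refine ⟨B, hBM, ?_, ?_, ?_⟩
  · apply opNorm_le_bound _ zero_le_one
    intro v
    have h1 := hBform v
    have h2 := hnn (B v)
    have h3 : (inner ℂ v (B v)).re ≤ ‖v‖ * ‖B v‖ := re_inner_le_norm (𝕜 := ℂ) v (B v)
    rw [one_mul]
    by_contra hcon
    push Not at hcon
    nlinarith [norm_nonneg v]
  · have hAsa : star A = A := by rw [hA, star_add, star_one, hsa]
    have h0 := hAform (η - (3 : ℂ) • B η)
    have h1 := congrArg Complex.re h0
    rw [Complex.ofReal_re, map_sub, map_smul, hABv, inner_sub_left, inner_sub_right,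
      inner_sub_right, hAform, inner_smul_right, inner_smul_left, inner_smul_left,
      inner_smul_right] at h1
    have h2 : inner ℂ (A η) (B η) = inner ℂ η η := by
      conv_rhs => rw [← hABv η]
      conv_lhs => rw [← hAsa, star_eq_adjoint, adjoint_inner_left, hABv]
      rw [hABv]
    have h3 : inner ℂ η η = (1 : ℂ) := by rw [inner_self_eq_norm_sq_to_K, hη]; simp
    rw [h2, h3, hη] at h1
    have h4 : (inner ℂ (B η) η).re = (inner ℂ η (B η)).re := by
      rw [← inner_conj_symm, Complex.conj_re]
    rw [h4]
    have h5 := hnn (η - (3 : ℂ) • B η)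
    have h6 : 0 ≤ ‖η - (3 : ℂ) • B η‖ ^ 2 := by positivity
    obtain ⟨s, hs⟩ : ∃ s, s = ∑ i ∈ Finset.range N, m i * ‖e i η‖ ^ 2 := ⟨_, rfl⟩
    obtain ⟨t, ht⟩ : ∃ t, t = ∑ i ∈ Finset.range N, m i * ‖e i (η - (3 : ℂ) • B η)‖ ^ 2 := ⟨_, rfl⟩
    rw [← ht] at h1 h5
    rw [← hs] at h1 hN
    simp at h1
    linarith
  · intro i hi v hv
    have h1 := hBform v
    have h2 : m i * ‖e i (B v)‖ ^ 2 ≤ ∑ i ∈ Finset.range N, m i * ‖e i (B v)‖ ^ 2 :=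
      Finset.single_le_sum (f := fun i => m i * ‖e i (B v)‖ ^ 2)
        (fun i _ => mul_nonneg (hm i).le (by positivity)) (Finset.mem_range.2 hi)
    have h3 : inner ℂ v (B v) = inner ℂ v (e i (B v)) := by
      have h31 : inner ℂ (adjoint (e i) v) (B v) = inner ℂ v (e i (B v)) := adjoint_inner_left _ _ _
      rwa [← star_eq_adjoint, (he i).2.1, hv] at h31
    have h4 : (inner ℂ v (B v)).re ≤ ‖v‖ * ‖e i (B v)‖ := by
      rw [h3]
      exact re_inner_le_norm (𝕜 := ℂ) v _
    have hmi := hm i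
    rw [le_div_iff₀ hmi]
    have h5 : ‖B v‖ ^ 2 + m i * ‖e i (B v)‖ ^ 2 ≤ ‖v‖ * ‖e i (B v)‖ := by linarith
    have h6 := norm_nonneg v
    have h7 := mul_le_mul_of_nonneg_right h5 hmi.le
    nlinarith [sq_nonneg (m i * ‖e i (B v)‖ - ‖v‖ / 2), sq_nonneg ‖v‖]

theorem resolvent (M : VonNeumannAlgebra H) (e : ℕ → H →L[ℂ] H)
    (he : ∀ i, IsProjectionIn M (e i)) (m : ℕ → ℝ) (hm : ∀ i, 0 < m i) {η : H} (hη : ‖η‖ = 1)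
    (hN : ∀ N, ∑ i ∈ Finset.range N, m i * ‖e i η‖ ^ 2 ≤ 2) :
    ∃ x ∈ M, 1 / 3 ≤ ‖x‖ ∧ ∀ i, ∀ v, e i v = v → ‖x v‖ ≤ ‖v‖ / √(m i) := by
  choose x hxM hx1 hxη hxv using fun N => resolvent_fin M e he m hm hη N (hN N)
  obtain ⟨y, hyM, hy⟩ := wot_limit M x hxM hx1 (Ultrafilter.of atTop)
  have hU : ((Ultrafilter.of atTop : Ultrafilter ℕ) : Filter ℕ) ≤ atTop := Ultrafilter.of_le _
  refine ⟨y, hyM, ?_, ?_⟩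
  · have h1 := (Complex.continuous_re.tendsto _).comp (hy η η)
    have h2 : 1 / 3 ≤ (inner ℂ (y η) η).re :=
      ge_of_tendsto h1 (Eventually.of_forall fun n => hxη n)
    have h3 : (inner ℂ (y η) η).re ≤ ‖y η‖ * ‖η‖ := re_inner_le_norm (𝕜 := ℂ) _ _
    have h4 := le_opNorm y η
    rw [hη] at h3 h4
    linarith
  · intro i v hv
    have h1 := (hy v (y v)).norm
    have h2 : ∀ᶠ n in ((Ultrafilter.of atTop : Ultrafilter ℕ) : Filter ℕ),
        ‖inner ℂ (x n v) (y v)‖ ≤ ‖v‖ / √(m i) * ‖y v‖ := by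
      apply hU
      filter_upwards [eventually_gt_atTop i] with n hn
      have h3 := hxv n i hn v hv
      have h4 : ‖x n v‖ ≤ ‖v‖ / √(m i) := by
        apply le_of_sq_le_sq _ (by positivity)
        rwa [div_pow, Real.sq_sqrt (hm i).le]
      calc _ ≤ ‖x n v‖ * ‖y v‖ := norm_inner_le_norm _ _
        _ ≤ _ := by gcongr
    have h5 := le_of_tendsto h1 h2
    rw [inner_self_eq_norm_sq_to_K] at h5
    simp only [Complex.coe_algebraMap, norm_pow, Complex.norm_real, norm_norm] at h5
    by_contra hcon
    push Not at hcon
    have h6 : 0 < ‖y v‖ := lt_of_le_of_lt (by positivity) hcon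
    nlinarith

theorem bcp_imp_atomic (M : VonNeumannAlgebra H) (h : HasBCPOn (M : Set (H →L[ℂ] H))) :
    M.Atomic := by
  obtain ⟨c, r, hc, hr, hcov⟩ := h
  intro p hp hp0
  by_contra hno
  obtain ⟨η, hη, hη1⟩ := exists_unit_of_proj hp.2.2 hp0
  have key : ∀ n k K : ℕ, ∃ e, ∃ ξ : H, IsProjectionIn M e ∧ e ξ = ξ ∧ ‖ξ‖ = 1 ∧
      ‖c n‖ * (1 - 1 / ((k : ℝ) + 2)) ≤ ‖c n ξ‖ ∧ ‖e η‖ ^ 2 ≤ 1 / 2 ^ K := by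
    intro n k K
    have hf : ∃ f, IsProjectionIn M f ∧ f ≠ 0 ∧
        ∀ v, f v = v → ‖c n‖ * (1 - 1 / ((k : ℝ) + 2)) * ‖v‖ ≤ ‖c n v‖ := by
      by_cases h0 : c n = 0
      · exact ⟨p, hp, hp0, fun v _ => by simp [h0]⟩
      · have hpos : 0 < ‖c n‖ := norm_pos_iff.2 h0
        have hk : (1 : ℝ) / ((k : ℝ) + 2) < 1 := by
          rw [div_lt_one (by positivity)]
          have : (0 : ℝ) ≤ k := by positivity
          linarith
        have hk0 : (0 : ℝ) < 1 / ((k : ℝ) + 2) := by positivity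
        obtain ⟨f, hf, hf0, -, hlow⟩ := spectral M (hc n) (star_one _) (mul_one (c n))
          (t := ‖c n‖ * (1 - 1 / ((k : ℝ) + 2))) (mul_pos hpos (by linarith)) (by nlinarith)
        exact ⟨f, hf, hf0, hlow⟩
    obtain ⟨f, hf, hf0, hlow⟩ := hf
    obtain ⟨e, he, he0, hfe, hsm⟩ := small_proj M hp hno hη hf hf0 K
    obtain ⟨ξ, hξ, hξ1⟩ := exists_unit_of_proj he.2.2 he0
    refine ⟨e, ξ, he, hξ, hξ1, ?_, hsm.trans ?_⟩
    · have := hlow ξ (by rw [← hξ, ← mulA, hfe])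
      rwa [hξ1, mul_one] at this
    · have h1 := le_of_opNorm_le _ (norm_proj_le hf.2.1 hf.2.2) η
      rw [hη1, mul_one] at h1
      have : ‖f η‖ ^ 2 ≤ 1 := by nlinarith [norm_nonneg (f η)]
      gcongr
  choose e ξ he hξ hξ1 hlow hsm using
    fun i : ℕ => key (Nat.unpair i).1 (Nat.unpair i).2 (2 * i)
  obtain ⟨x, hxM, hx3, hxv⟩ := resolvent M e he (fun i => (i : ℝ) + 1) (fun i => by positivity) hη1
    (by
      intro N
      refine le_trans (Finset.sum_le_sum fun i _ => ?_) (sum_geometric_two_le N)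
      have h1 : ((i : ℝ) + 1) ≤ 2 ^ i := by
        have := Nat.lt_two_pow_self (n := i)
        exact_mod_cast this
      calc ((i : ℝ) + 1) * ‖e i η‖ ^ 2 ≤ 2 ^ i * (1 / 2 ^ (2 * i)) := by
            gcongr
            exact hsm i
        _ = (1 / 2) ^ i := by
          rw [two_mul, pow_add, one_div, one_div, inv_pow]
          field_simp)
  have hx0 : 0 < ‖x‖ := by linarith
  set y : H →L[ℂ] H := ((‖x‖⁻¹ : ℝ) : ℂ) • x with hy
  have hyM : y ∈ M := smul_mem' M _ hxM
  have hy1 : ‖y‖ = 1 := by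
    rw [hy, norm_smul]
    simp [hx0.ne']
  obtain ⟨n, hn⟩ := hcov y hyM hy1
  have hlt : ‖y - c n‖ < ‖c n‖ := lt_of_lt_of_le hn (hr n)
  have hall : ∀ k : ℕ, ‖c n‖ * (1 - 1 / ((k : ℝ) + 2)) ≤ ‖y - c n‖ + 3 / √((k : ℝ) + 1) := by
    intro k
    set i := Nat.pair n k with hi
    have h1 := hlow i
    rw [hi, Nat.unpair_pair] at h1
    simp only [← hi] at h1
    have h2 : ‖y (ξ i)‖ ≤ 3 / √((k : ℝ) + 1) := by
      have h3 := hxv i (ξ i) (hξ i)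
      rw [hξ1] at h3
      have h4 : ‖y (ξ i)‖ = ‖x‖⁻¹ * ‖x (ξ i)‖ := by
        rw [hy, smul_apply, norm_smul]
        simp
      have h5 : ‖x‖⁻¹ ≤ 3 := by
        rw [inv_le_comm₀ hx0 (by norm_num)]
        linarith
      have h6 : (k : ℝ) ≤ i := by exact_mod_cast Nat.right_le_pair n k
      rw [h4]
      calc _ ≤ 3 * (1 / √((i : ℝ) + 1)) := by gcongr
        _ = 3 / √((i : ℝ) + 1) := by ring
        _ ≤ _ := by gcongr
    have h7 : ‖(y - c n) (ξ i)‖ ≤ ‖y - c n‖ := by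
      have := le_opNorm (y - c n) (ξ i)
      rwa [hξ1, mul_one] at this
    have h8 : ‖c n (ξ i)‖ ≤ ‖(y - c n) (ξ i)‖ + ‖y (ξ i)‖ := by
      have : c n (ξ i) = y (ξ i) - (y - c n) (ξ i) := by simp
      rw [this, add_comm]
      exact norm_sub_le _ _
    linarith
  have t1 : Tendsto (fun k : ℕ => ‖c n‖ * (1 - 1 / ((k : ℝ) + 2))) atTop (𝓝 (‖c n‖ * (1 - 0))) := by
    apply Tendsto.const_mul
    apply Tendsto.const_sub
    exact tendsto_const_nhds.div_atTop
      (tendsto_atTop_add_const_right _ _ tendsto_natCast_atTop_atTop)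
  have t2 : Tendsto (fun k : ℕ => ‖y - c n‖ + 3 / √((k : ℝ) + 1)) atTop (𝓝 (‖y - c n‖ + 0)) := by
    apply Tendsto.const_add
    exact tendsto_const_nhds.div_atTop (Real.tendsto_sqrt_atTop.comp
      (tendsto_atTop_add_const_right _ _ tendsto_natCast_atTop_atTop))
  have := le_of_tendsto_of_tendsto' t1 t2 hall
  linarith

end BCPProof


/-- **Theorem 3.8.** For a von Neumann algebra `M` the following are
equivalent: `M` has the BCP; `M` has the UBCP; `M` is atomic and σ-finite. -/
theorem vonNeumann_BCP_iff_UBCP_iff_atomic_sigmaFinite (M : VonNeumannAlgebra H) :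
    (HasBCPOn (M : Set (H →L[ℂ] H)) ↔ (M.Atomic ∧ M.SigmaFinite)) ∧
    (HasUBCPOn (M : Set (H →L[ℂ] H)) ↔ (M.Atomic ∧ M.SigmaFinite)) := by
  open BCPProof in
  exact ⟨⟨fun h => ⟨bcp_imp_atomic M h, bcp_imp_sigmaFinite M h⟩,
      fun h => ubcp_imp_bcp M (iii_imp_ubcp M h.1 h.2)⟩,
    ⟨fun h => ⟨bcp_imp_atomic M (ubcp_imp_bcp M h), bcp_imp_sigmaFinite M (ubcp_imp_bcp M h)⟩,
      fun h => iii_imp_ubcp M h.1 h.2⟩⟩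
end
end

section
/- Let A be a commutative unital C*-algebra. The following are equivalent: (i) A has the ball-covering property; (ii) the character space of A (the set of nonzero algebra homomorphisms A → ℂ, equipped with the weak-* topology; via Gelfand duality this is the pure state space of A) has a countable π-basis; (iii) A has the uniform ball-covering property. -/
noncomputable section

/-- A normed space has the ball-covering property if there is a countable family of open
balls, none of which contains the origin, whose union covers the unit sphere. -/
def HasBCP (X : Type*) [NormedAddCommGroup X] : Prop :=
  ∃ (c : ℕ → X) (r : ℕ → ℝ), (∀ n, r n ≤ ‖c n‖) ∧
    ∀ x : X, ‖x‖ = 1 → ∃ n, ‖x - c n‖ < r n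

/-- A normed space has the uniform ball-covering property: additionally the radii are
uniformly bounded and the balls uniformly omit the origin. -/
def HasUBCP (X : Type*) [NormedAddCommGroup X] : Prop :=
  ∃ (c : ℕ → X) (r : ℕ → ℝ),
    (∃ R : ℝ, ∀ n, r n ≤ R) ∧
    (∃ δ : ℝ, 0 < δ ∧ ∀ n, r n + δ ≤ ‖c n‖) ∧
    ∀ x : X, ‖x‖ = 1 → ∃ n, ‖x - c n‖ < r n

/-- A topological space has a countable π-basis: a countable collection of nonempty open
sets such that every nonempty open set contains a member of the collection. -/
def HasCountablePiBasis (K : Type*) [TopologicalSpace K] : Prop :=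
  ∃ B : Set (Set K), B.Countable ∧ (∀ U ∈ B, IsOpen U ∧ U.Nonempty) ∧
    ∀ V : Set K, IsOpen V → V.Nonempty → ∃ U ∈ B, U ⊆ V

theorem bcpAux_bump {K : Type*} [TopologicalSpace K] [CompactSpace K] [T2Space K]
    {V : Set K} (hV : IsOpen V) {p : K} (hp : p ∈ V) :
    ∃ g : K → ℝ, Continuous g ∧ (∀ t, 0 ≤ g t ∧ g t ≤ 1) ∧ (∀ t, t ∉ V → g t = 0) ∧ g p = 1 := by
  obtain ⟨f, h0, h1, h01⟩ := exists_continuous_zero_one_of_isClosed (s := Vᶜ) (t := {p})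
    hV.isClosed_compl isClosed_singleton (by simpa using hp)
  exact ⟨f, f.continuous, fun t => h01 t, fun t ht => h0 ht, h1 rfl⟩

theorem bcpAux_bcp_pi {K : Type*} [TopologicalSpace K] [CompactSpace K] [T2Space K]
    (h : HasBCP C(K, ℂ)) : HasCountablePiBasis K := by
  obtain ⟨c, r, hr, hcov⟩ := h
  refine ⟨{U | (∃ i : ℕ × ℚ, U = {t | (i.2 : ℝ) < ‖c i.1 t‖}) ∧ U.Nonempty}, ?_, ?_, ?_⟩
  · refine (Set.countable_range
      (fun i : ℕ × ℚ => {t | (i.2 : ℝ) < ‖c i.1 t‖})).mono ?_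
    rintro U ⟨⟨i, rfl⟩, -⟩
    exact ⟨i, rfl⟩
  · rintro U ⟨⟨i, rfl⟩, hne⟩
    exact ⟨isOpen_lt continuous_const (c i.1).continuous.norm, hne⟩
  · rintro V hV ⟨p, hp⟩
    obtain ⟨g, hg, h01, h0, h1⟩ := bcpAux_bump hV hp
    let x : C(K, ℂ) := ⟨fun t => (g t : ℂ), by fun_prop⟩
    have hxt : ∀ t, ‖x t‖ = g t := fun t => by
      simp [x, abs_of_nonneg (h01 t).1]
    have hx : ‖x‖ = 1 := by
      apply le_antisymm
      · exact (ContinuousMap.norm_le _ zero_le_one).2 fun t => (hxt t).trans_le (h01 t).2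
      · calc (1 : ℝ) = ‖x p‖ := by rw [hxt, h1]
          _ ≤ ‖x‖ := x.norm_coe_le_norm p
    obtain ⟨n, hn⟩ := hcov x hx
    obtain ⟨q, hq1, hq2⟩ := exists_rat_btwn hn
    refine ⟨{t | (q : ℝ) < ‖c n t‖}, ⟨⟨(n, q), rfl⟩, ?_⟩, ?_⟩
    · by_contra hne
      rw [Set.not_nonempty_iff_eq_empty, Set.eq_empty_iff_forall_notMem] at hne
      have : ‖c n‖ ≤ q := (ContinuousMap.norm_le _ ((norm_nonneg _).trans hq1.le)).2
        fun t => not_lt.1 (hne t)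
      linarith [hr n]
    · intro t ht
      by_contra htV
      have h2 := (x - c n).norm_coe_le_norm t
      have h3 : x t = 0 := by simp [x, h0 t htV]
      rw [ContinuousMap.sub_apply, h3, zero_sub, norm_neg] at h2
      have ht' : (q : ℝ) < ‖c n t‖ := ht
      linarith

theorem bcpAux_ubcp_of_countable {X ι : Type*} [NormedAddCommGroup X] [Countable ι]
    (c : ι → X) (r R δ : ℝ) (hR : r ≤ R) (hδ : 0 < δ) (h : ∀ i, r + δ ≤ ‖c i‖)
    (hcov : ∀ x : X, ‖x‖ = 1 → ∃ i, ‖x - c i‖ < r) : HasUBCP X := by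
  rcases isEmpty_or_nonempty ι with hι | hι
  · refine ⟨fun _ => 0, fun _ => -1, ⟨0, by simp⟩, ⟨1, one_pos, by simp⟩, fun x hx => ?_⟩
    obtain ⟨i, _⟩ := hcov x hx
    exact hι.elim i
  · obtain ⟨f, hf⟩ := exists_surjective_nat ι
    refine ⟨fun n => c (f n), fun _ => r, ⟨R, fun _ => hR⟩, ⟨δ, hδ, fun n => h _⟩, fun x hx => ?_⟩
    obtain ⟨i, hi⟩ := hcov x hx
    obtain ⟨n, rfl⟩ := hf i
    exact ⟨n, hi⟩

theorem bcpAux_pi_ubcp {K : Type*} [TopologicalSpace K] [CompactSpace K] [T2Space K]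
    (h : HasCountablePiBasis K) : HasUBCP C(K, ℂ) := by
  obtain ⟨B, hB, hBo, hBV⟩ := h
  have : Countable B := hB.to_subtype
  obtain ⟨S, hSc, hSd⟩ := TopologicalSpace.exists_countable_dense (Metric.sphere (0 : ℂ) 1)
  have : Countable S := hSc.to_subtype
  have key : ∀ U : B, ∃ g : K → ℝ, Continuous g ∧ (∀ t, 0 ≤ g t ∧ g t ≤ 1) ∧
      (∀ t, t ∉ U.1 → g t = 0) ∧ ∃ p, g p = 1 := fun U => by
    obtain ⟨hU, p, hp⟩ := hBo U.1 U.2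
    obtain ⟨g, h1, h2, h3, h4⟩ := bcpAux_bump hU hp
    exact ⟨g, h1, h2, h3, p, h4⟩
  choose g hg h01 h0 p hp using key
  let c : B × S → C(K, ℂ) := fun i =>
    ⟨fun t => 2 * (i.2.1.1 * (g i.1 t : ℂ)), by have := hg i.1; fun_prop⟩
  have hS : ∀ ω : S, ‖ω.1.1‖ = 1 := fun ω => by simpa using ω.1.2
  refine bcpAux_ubcp_of_countable c (3/2) (3/2) (1/2) le_rfl (by norm_num) ?_ ?_
  · intro i
    have h1 := (c i).norm_coe_le_norm (p i.1)
    have h2 : ‖c i (p i.1)‖ = 2 := by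
      simp only [c, ContinuousMap.coe_mk, norm_mul, hS, hp]
      simp
    linarith
  · intro x hx
    have hne : ∃ t, ‖x t‖ = 1 := by
      have hK : Nonempty K := by
        by_contra hK
        rw [not_nonempty_iff] at hK
        have : x = 0 := by ext t; exact hK.elim t
        simp [this] at hx
      obtain ⟨t, -, ht⟩ := isCompact_univ.exists_isMaxOn (Set.univ_nonempty (α := K))
        (x.continuous.norm.continuousOn)
      refine ⟨t, le_antisymm (hx ▸ x.norm_coe_le_norm t) ?_⟩
      rw [← hx]
      exact (ContinuousMap.norm_le _ (norm_nonneg _)).2 fun s => ht (Set.mem_univ s)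
    obtain ⟨t₀, ht₀⟩ := hne
    obtain ⟨ω, hωS, hω⟩ := Metric.dense_iff.1 hSd ⟨x t₀, by simpa using ht₀⟩ (1/4) (by norm_num)
    rename_i _ _
    have hω' : ‖x t₀ - ω.1‖ < 1/4 := by
      first
        | (have h5 : dist ω.1 (x t₀) < 1/4 := hωS
           rwa [dist_comm, dist_eq_norm] at h5)
        | (have h5 : dist ω.1 (x t₀) < 1/4 := hω
           rwa [dist_comm, dist_eq_norm] at h5)
    obtain ⟨U, hUB, hUV⟩ := hBV {t | ‖x t - ω.1‖ < 1/4}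
      (isOpen_lt (by fun_prop) continuous_const) ⟨t₀, hω'⟩
    refine ⟨(⟨U, hUB⟩, ⟨ω, by assumption⟩), ?_⟩
    refine lt_of_le_of_lt ((ContinuousMap.norm_le _ (by norm_num : (0 : ℝ) ≤ 5/4)).2 ?_)
      (by norm_num)
    intro t
    simp only [ContinuousMap.sub_apply, c, ContinuousMap.coe_mk]
    by_cases ht : t ∈ U
    · have h1 : ‖x t - ω.1‖ < 1/4 := hUV ht
      have h2 := h01 ⟨U, hUB⟩ t
      set a := g ⟨U, hUB⟩ t
      have hω1 : ‖ω.1‖ = 1 := by simpa using ω.2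
      have h3 : x t - 2 * (ω.1 * (a : ℂ)) = (x t - ω.1) + ω.1 * ((1 - 2 * a : ℝ) : ℂ) := by
        push_cast; ring
      rw [h3]
      have h4 : ‖ω.1 * ((1 - 2 * a : ℝ) : ℂ)‖ ≤ 1 := by
        rw [norm_mul, hω1, one_mul, Complex.norm_real, Real.norm_eq_abs, abs_le]
        constructor <;> linarith
      linarith [norm_add_le (x t - ω.1) (ω.1 * ((1 - 2 * a : ℝ) : ℂ))]
    · rw [h0 ⟨U, hUB⟩ t ht]
      have := x.norm_coe_le_norm t
      simp
      linarith

theorem bcpAux_bcp_transfer {X Y : Type*} [NormedAddCommGroup X] [NormedAddCommGroup Y]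
    (e : X ≃+ Y) (he : ∀ x, ‖e x‖ = ‖x‖) (h : HasBCP X) : HasBCP Y := by
  obtain ⟨c, r, h1, h2⟩ := h
  refine ⟨fun n => e (c n), r, fun n => by simpa [he] using h1 n, fun y hy => ?_⟩
  obtain ⟨x, rfl⟩ := e.surjective y
  obtain ⟨n, hn⟩ := h2 x (by rwa [he] at hy)
  exact ⟨n, by rwa [← map_sub, he]⟩

theorem bcpAux_ubcp_transfer {X Y : Type*} [NormedAddCommGroup X] [NormedAddCommGroup Y]
    (e : X ≃+ Y) (he : ∀ x, ‖e x‖ = ‖x‖) (h : HasUBCP X) : HasUBCP Y := by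
  obtain ⟨c, r, hR, ⟨δ, hδ, h1⟩, h2⟩ := h
  refine ⟨fun n => e (c n), r, hR, ⟨δ, hδ, fun n => by simpa [he] using h1 n⟩, fun y hy => ?_⟩
  obtain ⟨x, rfl⟩ := e.surjective y
  obtain ⟨n, hn⟩ := h2 x (by rwa [he] at hy)
  exact ⟨n, by rwa [← map_sub, he]⟩

theorem bcpAux_ubcp_bcp {X : Type*} [NormedAddCommGroup X] (h : HasUBCP X) : HasBCP X := by
  obtain ⟨c, r, hR, ⟨δ, hδ, h1⟩, h2⟩ := h
  exact ⟨c, r, fun n => by linarith [h1 n], h2⟩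

/-- Gelfand duality, as an additive norm-preserving equivalence. -/
theorem bcpAux_gelfand {A : Type*} [CommCStarAlgebra A] :
    ∃ e : A ≃+ C(WeakDual.characterSpace ℂ A, ℂ), ∀ x, ‖e x‖ = ‖x‖ :=
  ⟨(gelfandStarTransform A : A ≃+ C(WeakDual.characterSpace ℂ A, ℂ)), fun x =>
    AddMonoidHomClass.isometry_iff_norm (WeakDual.gelfandTransform ℂ A) |>.1 (gelfandTransform_isometry A) x⟩

/-- **Corollary 3.9.** For a commutative unital C*-algebra `A` the
following are equivalent: (i) `A` has the BCP; (ii) the character space of `A` (its pure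
state space) has a countable π-basis; (iii) `A` has the UBCP. -/
theorem commCStar_BCP_iff_piBasis_iff_UBCP
    {A : Type*} [NormedCommRing A] [StarRing A] [CStarRing A]
    [NormedAlgebra ℂ A] [StarModule ℂ A] [CompleteSpace A] :
    (HasBCP A ↔ HasCountablePiBasis (WeakDual.characterSpace ℂ A)) ∧
    (HasUBCP A ↔ HasCountablePiBasis (WeakDual.characterSpace ℂ A)) := by
  obtain ⟨e, he⟩ : ∃ e : A ≃+ C(WeakDual.characterSpace ℂ A, ℂ), ∀ x, ‖e x‖ = ‖x‖ :=
    letI : CommCStarAlgebra A := { }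
    bcpAux_gelfand
  have h1 : HasBCP A → HasCountablePiBasis (WeakDual.characterSpace ℂ A) := fun h =>
    bcpAux_bcp_pi (bcpAux_bcp_transfer e he h)
  have h2 : HasCountablePiBasis (WeakDual.characterSpace ℂ A) → HasUBCP A := fun h =>
    bcpAux_ubcp_transfer e.symm (fun y => by rw [← he, e.apply_symm_apply]) (bcpAux_pi_ubcp h)
  exact ⟨⟨h1, fun h => bcpAux_ubcp_bcp (h2 h)⟩, ⟨fun h => h1 (bcpAux_ubcp_bcp h), h2⟩⟩
end
end

section
/- Let μ be a nonzero σ-finite measure on a measurable space that is atomless in the measure-algebra sense. Then for every sequence (y_n)_{n∈ℕ} in L∞(μ; ℂ) and every ε > 0 there exists g ∈ L∞(μ; ℂ) such that ‖g − y_n‖_∞ > ‖y_n‖_∞ + 1 − ε for all n ∈ ℕ; in particular, L∞(μ; ℂ) does not have the ball-covering property. (This is the commutative instance of the paper's theorem that every non-trivial atomless von Neumann algebra fails the BCP.) -/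
open MeasureTheory

noncomputable section

/-- In an atomless sigma-finite measure, positive sets have arbitrarily small positive subsets. -/
theorem exists_small_subset {α : Type*} [MeasurableSpace α]
    (μ : Measure α) [SigmaFinite μ]
    (h_atomless : ∀ s : Set α, MeasurableSet s → 0 < μ s →
      ∃ t : Set α, MeasurableSet t ∧ t ⊆ s ∧ 0 < μ t ∧ μ t < μ s)
    (A : Set α) (hA : MeasurableSet A) (hpos : 0 < μ A) (δ : ENNReal) (hδ : 0 < δ) :
    ∃ C : Set α, MeasurableSet C ∧ C ⊆ A ∧ 0 < μ C ∧ μ C < ⊤ ∧ μ C ≤ δ := by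
  obtain ⟨s, hs, hsA, hs0, hsT⟩ := Measure.exists_subset_measure_lt_top hA hpos
  have key : ∀ k : ℕ, ∃ C : Set α, MeasurableSet C ∧ C ⊆ s ∧ 0 < μ C ∧
      μ C ≤ μ s * (2⁻¹) ^ k := by
    intro k
    induction k with
    | zero => exact ⟨s, hs, subset_rfl, hs0, by simp⟩
    | succ k ih =>
      obtain ⟨C, hC, hCs, hC0, hCk⟩ := ih
      have hCT : μ C < ⊤ := (measure_mono hCs).trans_lt hsT
      obtain ⟨t, ht, htC, ht0, htlt⟩ := h_atomless C hC hC0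
      have hadd : μ (C \ t) + μ t = μ C := by
        rw [add_comm, measure_add_sdiff ht.nullMeasurableSet, Set.union_eq_self_of_subset_left htC]
      have hstep : ∀ D : Set α, μ D ≤ μ C * 2⁻¹ → μ D ≤ μ s * (2⁻¹) ^ (k+1) := by
        intro D hD
        rw [pow_succ, ← mul_assoc]
        exact hD.trans (by gcongr)
      rcases le_or_gt (μ t) (μ C * 2⁻¹) with h | h
      · exact ⟨t, ht, htC.trans hCs, ht0, hstep _ h⟩
      · refine ⟨C \ t, hC.diff ht, Set.diff_subset.trans hCs, ?_, hstep _ ?_⟩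
        · by_contra h0
          have : μ (C \ t) = 0 := by simpa using h0
          rw [this, zero_add] at hadd
          exact htlt.ne hadd
        · by_contra! h2
          have h3 := ENNReal.add_lt_add h2 h
          rw [hadd, ← mul_add, ENNReal.inv_two_add_inv_two, mul_one] at h3
          exact lt_irrefl _ h3
  have hlim : Filter.Tendsto (fun k : ℕ => μ s * (2⁻¹ : ENNReal) ^ k) Filter.atTop (nhds 0) := by
    have h := ENNReal.Tendsto.const_mul (a := μ s)
      (ENNReal.tendsto_pow_atTop_nhds_zero_of_lt_one (r := 2⁻¹) (by simp)) (Or.inr hsT.ne)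
    simpa using h
  obtain ⟨k, hk⟩ := (hlim.eventually (gt_mem_nhds hδ)).exists
  obtain ⟨C, hC, hCs, hC0, hCk⟩ := key k
  exact ⟨C, hC, hCs.trans hsA, hC0, (measure_mono hCs).trans_lt hsT, hCk.trans hk.le⟩

theorem exists_disjoint_subsets {α : Type*} [MeasurableSpace α]
    (μ : Measure α) [SigmaFinite μ]
    (h_atomless : ∀ s : Set α, MeasurableSet s → 0 < μ s →
      ∃ t : Set α, MeasurableSet t ∧ t ⊆ s ∧ 0 < μ t ∧ μ t < μ s)
    (A : ℕ → Set α) (hA : ∀ n, MeasurableSet (A n)) (hpos : ∀ n, 0 < μ (A n)) :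
    ∃ B : ℕ → Set α, (∀ n, MeasurableSet (B n)) ∧ (∀ n, B n ⊆ A n) ∧ (∀ n, 0 < μ (B n)) ∧
      Pairwise (fun i j => Disjoint (B i) (B j)) := by
  have h := fun n δ hδ => exists_small_subset μ h_atomless (A n) (hA n) (hpos n) δ hδ
  choose! pick hm hsub h0 hT hle using h
  let seq : ℕ → ENNReal := fun n => Nat.rec 1 (fun n d => μ (pick n d) * 4⁻¹) n
  have hseq : ∀ n, 0 < seq n := by
    intro n
    induction n with
    | zero => exact one_pos
    | succ n ih => exact ENNReal.mul_pos (h0 n _ ih).ne' (by simp)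
  let C : ℕ → Set α := fun n => pick n (seq n)
  have hstep : ∀ n, μ (C (n+1)) ≤ μ (C n) * 4⁻¹ := fun n => hle (n+1) _ (hseq (n+1))
  have hdec : ∀ n k, μ (C (n+1+k)) ≤ μ (C n) * 2⁻¹ * (2⁻¹)^(k+1) := by
    have h4 : (4⁻¹ : ENNReal) = 2⁻¹ * 2⁻¹ := by
      rw [← ENNReal.mul_inv (by simp) (by simp)]; norm_num
    intro n k
    induction k with
    | zero => simpa [h4, mul_assoc] using hstep n
    | succ k ih =>
      calc μ (C (n+1+(k+1))) ≤ μ (C (n+1+k)) * 4⁻¹ := hstep _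
        _ ≤ μ (C (n+1+k)) * 2⁻¹ := by gcongr; norm_num
        _ ≤ (μ (C n) * 2⁻¹ * (2⁻¹)^(k+1)) * 2⁻¹ := by gcongr
        _ = _ := by ring
  have hCm : ∀ n, MeasurableSet (C n) := fun n => hm n _ (hseq n)
  have hC0 : ∀ n, 0 < μ (C n) := fun n => h0 n _ (hseq n)
  have hCT : ∀ n, μ (C n) < ⊤ := fun n => hT n _ (hseq n)
  refine ⟨fun n => C n \ ⋃ k, C (n+1+k), fun n => (hCm n).diff (.iUnion fun k => hCm _),
    fun n => Set.diff_subset.trans (hsub n _ (hseq n)), fun n => ?_, ?_⟩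
  · have hU : μ (⋃ k, C (n+1+k)) < μ (C n) := by
      calc μ (⋃ k, C (n+1+k)) ≤ ∑' k, μ (C (n+1+k)) := measure_iUnion_le _
        _ ≤ ∑' k, μ (C n) * 2⁻¹ * (2⁻¹)^(k+1) := ENNReal.tsum_le_tsum (hdec n)
        _ = μ (C n) * 2⁻¹ := by
          rw [ENNReal.tsum_mul_left, ENNReal.tsum_geometric_add_one, ENNReal.one_sub_inv_two,
            inv_inv, ENNReal.inv_mul_cancel (by simp) (by simp), mul_one]
        _ < μ (C n) := by
          rw [← div_eq_mul_inv]; exact ENNReal.half_lt_self (hC0 n).ne' (hCT n).ne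
    exact (tsub_pos_of_lt hU).trans_le le_measure_diff
  · have hlt : ∀ i j, i < j → Disjoint (C i \ ⋃ k, C (i+1+k)) (C j \ ⋃ k, C (j+1+k)) := by
      intro i j hij
      rw [Set.disjoint_left]
      rintro x ⟨_, hx⟩ ⟨hx2, _⟩
      apply hx
      obtain ⟨k, rfl⟩ := Nat.exists_eq_add_of_lt hij
      rw [Set.mem_iUnion]
      exact ⟨k, by rwa [show i + 1 + k = i + k + 1 by ring]⟩
    intro i j hij
    rcases lt_or_gt_of_ne hij with h | h
    · exact hlt i j h
    · exact (hlt j i h).symm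

theorem ae_norm_le_Linfty {α : Type*} [MeasurableSpace α] (μ : Measure α) (f : Lp ℂ ⊤ μ) :
    ∀ᵐ x ∂μ, ‖f x‖ ≤ ‖f‖ := by
  have h := ae_le_eLpNormEssSup (f := (f : α → ℂ)) (μ := μ)
  filter_upwards [h] with x hx
  rw [← eLpNorm_exponent_top, ← Lp.enorm_def] at hx
  exact enorm_le_iff_norm_le.mp hx

theorem Linfty_norm_le {α : Type*} [MeasurableSpace α] (μ : Measure α) (f : Lp ℂ ⊤ μ)
    (c : ℝ) (hc : 0 ≤ c) (h : ∀ᵐ x ∂μ, ‖f x‖ ≤ c) : ‖f‖ ≤ c := by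
  rw [Lp.norm_def, eLpNorm_exponent_top]
  exact ENNReal.toReal_le_of_le_ofReal hc (eLpNormEssSup_le_of_ae_bound h)

/-- A unimodular number opposite to `z`. -/
def oppPhase (z : ℂ) : ℂ := if z = 0 then 1 else -(z / (‖z‖ : ℂ))

theorem measurable_oppPhase : Measurable oppPhase := by
  unfold oppPhase
  refine Measurable.ite (measurableSet_singleton 0) measurable_const ?_
  fun_prop

theorem norm_oppPhase (z : ℂ) : ‖oppPhase z‖ = 1 := by
  unfold oppPhase
  split_ifs with h
  · simp
  · simp [h]

theorem norm_oppPhase_sub (z : ℂ) : ‖oppPhase z - z‖ = 1 + ‖z‖ := by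
  unfold oppPhase
  split_ifs with h
  · simp [h]
  · have hz : (‖z‖ : ℂ) ≠ 0 := by simpa using h
    have : -(z / (‖z‖ : ℂ)) - z = -((z / (‖z‖ : ℂ)) * ((1 + ‖z‖ : ℝ) : ℂ)) := by
      push_cast; field_simp; ring
    rw [this, norm_neg, norm_mul, Complex.norm_real, norm_div, Complex.norm_real]
    have h' : ‖z‖ ≠ 0 := by simpa using h
    rw [norm_norm, div_self h', one_mul, Real.norm_of_nonneg (by positivity)]

theorem exists_far {α : Type*} [MeasurableSpace α]
    (μ : Measure α) (hμ_ne : μ ≠ 0) [SigmaFinite μ]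
    (h_atomless : ∀ s : Set α, MeasurableSet s → 0 < μ s →
      ∃ t : Set α, MeasurableSet t ∧ t ⊆ s ∧ 0 < μ t ∧ μ t < μ s)
    (y : ℕ → Lp ℂ ⊤ μ) (ε : ℝ) (hε : 0 < ε) :
    ∃ g : Lp ℂ ⊤ μ, ‖g‖ = 1 ∧ ∀ n, ‖g - y n‖ > ‖y n‖ + 1 - ε := by
  have hym : ∀ n, Measurable (y n) := fun n => (Lp.stronglyMeasurable (y n)).measurable
  obtain ⟨B, hB, hBA, hB0, hBd⟩ := exists_disjoint_subsets μ h_atomless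
    (fun n => {x | ‖y n‖ - ε < ‖y n x‖})
    (fun n => measurableSet_lt measurable_const (hym n).norm) (fun n => by
      rcases lt_or_ge (‖y n‖ - ε) 0 with h | h
      · have : {x | ‖y n‖ - ε < ‖y n x‖} = Set.univ :=
          Set.eq_univ_of_forall fun x => h.trans_le (norm_nonneg _)
        rw [this]
        exact Measure.measure_univ_pos.mpr hμ_ne
      · by_contra h0
        have h0 : μ {x | ‖y n‖ - ε < ‖y n x‖} = 0 := by simpa using h0
        have h1 : ∀ᵐ x ∂μ, ‖y n x‖ ≤ ‖y n‖ - ε := by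
          rw [ae_iff]; simpa using h0
        have := Linfty_norm_le μ (y n) _ h h1
        linarith)
  obtain ⟨f, hf, hfB⟩ := exists_measurable_piecewise B hB (fun n x => oppPhase (y n x))
    (fun n => measurable_oppPhase.comp (hym n))
    (fun i j hij => by
      have : B i ∩ B j = ∅ := (hBd hij).inter_eq
      simp [this])
  classical
  let G : α → ℂ := (⋃ n, B n).piecewise f (fun _ => 1)
  have hG : Measurable G := hf.piecewise (.iUnion hB) measurable_const
  have hG1 : ∀ x, ‖G x‖ = 1 := by
    intro x
    by_cases hx : x ∈ ⋃ n, B n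
    · simp only [G, Set.piecewise_eq_of_mem _ _ _ hx]
      obtain ⟨n, hn⟩ := Set.mem_iUnion.mp hx
      rw [hfB n hn]
      exact norm_oppPhase _
    · simp [G, Set.piecewise_eq_of_notMem _ _ _ hx]
  have hGB : ∀ n, ∀ x ∈ B n, G x = oppPhase (y n x) := by
    intro n x hx
    simp only [G, Set.piecewise_eq_of_mem _ _ _ (Set.mem_iUnion.mpr ⟨n, hx⟩)]
    exact hfB n hx
  have hGL : MemLp G ⊤ μ := memLp_top_of_bound hG.aestronglyMeasurable 1
    (.of_forall fun x => (hG1 x).le)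
  have hco := hGL.coeFn_toLp
  refine ⟨hGL.toLp G, le_antisymm ?_ ?_, fun n => ?_⟩
  · refine Linfty_norm_le μ _ _ zero_le_one ?_
    filter_upwards [hco] with x hx
    rw [hx, hG1]
  · haveI : (ae μ).NeBot := ae_neBot.mpr hμ_ne
    obtain ⟨x, hx, hx2⟩ := (hco.and (ae_norm_le_Linfty μ (hGL.toLp G))).exists
    rwa [hx, hG1] at hx2
  · have hae := (hco.and (Lp.coeFn_sub (hGL.toLp G) (y n))).and
      (ae_norm_le_Linfty μ (hGL.toLp G - y n))
    have hfreq : ∃ᵐ x ∂μ, x ∈ B n := frequently_ae_mem_iff.mpr (hB0 n).ne'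
    obtain ⟨x, hxB, ⟨hx1, hx2⟩, hx3⟩ := (hfreq.and_eventually hae).exists
    rw [hx2, Pi.sub_apply, hx1, hGB n x hxB, norm_oppPhase_sub] at hx3
    have h4 : ‖y n‖ - ε < ‖y n x‖ := hBA n hxB
    linarith

/-- Let `μ` be a nonzero σ-finite measure which is atomless in the
measure-algebra sense (every set of positive measure has a subset of strictly smaller
positive measure).  Then for every sequence `(y_n)` in `L∞(μ; ℂ)` and every `ε > 0` there
is `g ∈ L∞(μ; ℂ)` with `‖g - y_n‖ > ‖y_n‖ + 1 - ε` for all `n`; in particular `L∞(μ; ℂ)`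
fails the ball-covering property. -/
theorem Linfty_atomless_not_BCP {α : Type*} [MeasurableSpace α]
    (μ : Measure α) (hμ_ne : μ ≠ 0) [SigmaFinite μ]
    (h_atomless : ∀ s : Set α, MeasurableSet s → 0 < μ s →
      ∃ t : Set α, MeasurableSet t ∧ t ⊆ s ∧ 0 < μ t ∧ μ t < μ s) :
    (∀ (y : ℕ → Lp ℂ ⊤ μ) (ε : ℝ), 0 < ε →
      ∃ g : Lp ℂ ⊤ μ, ∀ n, ‖g - y n‖ > ‖y n‖ + 1 - ε) ∧
    ¬ HasBCP (Lp ℂ ⊤ μ) := by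
  refine ⟨fun y ε hε => ?_, ?_⟩
  · obtain ⟨g, _, hg⟩ := exists_far μ hμ_ne h_atomless y ε hε
    exact ⟨g, hg⟩
  · rintro ⟨c, r, hr, hcov⟩
    obtain ⟨g, hg1, hg⟩ := exists_far μ hμ_ne h_atomless c 1 one_pos
    obtain ⟨n, hn⟩ := hcov g hg1
    have h1 := hg n
    have h2 := hr n
    linarith
end
end

section
/- Let μ be a semifinite measure on a measurable space admitting an uncountable family of pairwise disjoint measurable sets each of positive measure. Then L¹(μ; ℂ) does not have the ball-covering property. (This is the commutative instance of the paper's result that over a non-σ-finite semifinite von Neumann algebra every non-trivial symmetric space with full carrier projection fails the BCP.) -/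
open MeasureTheory

noncomputable section

/-- Let `μ` be a semifinite measure (every set of infinite measure has
a subset of positive finite measure) admitting an uncountable family of pairwise disjoint
measurable sets of positive measure.  Then `L¹(μ; ℂ)` fails the ball-covering property. -/
theorem L1_not_BCP_of_uncountable_disjoint_family {α : Type*} [MeasurableSpace α]
    (μ : Measure α)
    (h_semifinite : ∀ s : Set α, MeasurableSet s → μ s = ⊤ →
      ∃ t : Set α, MeasurableSet t ∧ t ⊆ s ∧ 0 < μ t ∧ μ t < ⊤)
    (h_uncount : ∃ S : Set (Set α), ¬ S.Countable ∧
      (∀ s ∈ S, MeasurableSet s ∧ 0 < μ s) ∧ S.Pairwise Disjoint) :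
    ¬ HasBCP (Lp ℂ 1 μ) := by
  rintro ⟨c, r, hr, hc⟩
  obtain ⟨S, hS, hSm, hSd⟩ := h_uncount
  have key : ∃ s ∈ S, ∀ n, (μ.withDensity (fun a => ‖c n a‖ₑ)) s = 0 := by
    by_contra hcon
    push Not at hcon
    apply hS
    have hcount : ∀ n, {i : S | 0 < (μ.withDensity (fun a => ‖c n a‖ₑ)) i.1}.Countable := by
      intro n
      have hint : Integrable (c n) μ := L1.integrable_coeFn (c n)
      haveI : IsFiniteMeasure (μ.withDensity (fun a => ‖c n a‖ₑ)) :=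
        isFiniteMeasure_withDensity hint.2.ne
      refine Measure.countable_meas_pos_of_disjoint_iUnion (fun i => (hSm i.1 i.2).1) ?_
      intro i j hij
      exact hSd i.2 j.2 (fun h => hij (Subtype.ext h))
    have hU := Set.countable_iUnion hcount
    refine (hU.image Subtype.val).mono ?_
    intro s hs
    obtain ⟨n, hn⟩ := hcon s hs
    exact ⟨⟨s, hs⟩, Set.mem_iUnion.2 ⟨n, pos_iff_ne_zero.2 hn⟩, rfl⟩
  obtain ⟨s, hsS, hs0⟩ := key
  obtain ⟨hsm, hspos⟩ := hSm s hsS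
  obtain ⟨t, htm, hts, htpos, htfin⟩ :
      ∃ t : Set α, MeasurableSet t ∧ t ⊆ s ∧ 0 < μ t ∧ μ t < ⊤ := by
    by_cases h : μ s = ⊤
    · exact h_semifinite s hsm h
    · exact ⟨s, hsm, subset_rfl, hspos, lt_top_iff_ne_top.2 h⟩
  have hreal : 0 < μ.real t := ENNReal.toReal_pos htpos.ne' htfin.ne
  set x : Lp ℂ 1 μ := indicatorConstLp 1 htm htfin.ne (((μ.real t)⁻¹ : ℝ) : ℂ) with hx
  have hx1 : ‖x‖ = 1 := by
    rw [hx, norm_indicatorConstLp one_ne_zero ENNReal.one_ne_top, Complex.norm_real,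
      Real.norm_of_nonneg (inv_nonneg.2 hreal.le)]
    simp [hreal.ne']
  obtain ⟨n, hn⟩ := hc x hx1
  refine absurd (hn.trans_le (hr n)) (not_lt.2 ?_)
  apply Lp.norm_le_norm_of_ae_le
  have hz : ∀ᵐ a ∂μ, a ∈ s → c n a = 0 := by
    have h := hs0 n
    rw [withDensity_apply _ hsm,
      lintegral_eq_zero_iff' (Lp.aestronglyMeasurable (c n)).enorm.restrict] at h
    have h2 := (ae_restrict_iff' hsm).1 h
    filter_upwards [h2] with a ha has
    simpa using ha has
  filter_upwards [hz, Lp.coeFn_sub x (c n), indicatorConstLp_coeFn_notMem (p := 1) (hs := htm)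
    (hμs := htfin.ne) (c := (((μ.real t)⁻¹ : ℝ) : ℂ))] with a h1 h2 h3
  rw [h2, Pi.sub_apply]
  by_cases hat : a ∈ t
  · rw [h1 (hts hat)]; simp
  · rw [hx, h3 hat]; simp
end
end

section
/- Let μ be a σ-finite measure on a measurable space such that the Banach space L¹(μ; ℂ) is not separable. Then L¹(μ; ℂ) does not have the ball-covering property. (This is the commutative instance of the paper's result that over a σ-finite von Neumann algebra with non-separable predual every non-trivial fully symmetric space fails the BCP.) -/
open MeasureTheory

noncomputable section

/-- The conditional expectation is a contraction on `L¹`. -/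
theorem norm_condExpL1CLM_apply_le {α : Type*} {m m0 : MeasurableSpace α}
    (μ : Measure α) (hm : m ≤ m0) [SigmaFinite (μ.trim hm)] (f : Lp ℂ 1 μ) :
    ‖condExpL1CLM ℂ hm μ f‖ ≤ ‖f‖ := by
  have h1 := condExp_ae_eq_condExpL1CLM hm (L1.integrable_coeFn f)
  rw [Integrable.toL1_coeFn] at h1
  rw [L1.norm_eq_integral_norm, L1.norm_eq_integral_norm]
  refine le_trans (le_of_eq ?_) (integral_norm_condExp_le (m := m) (μ := μ) f)
  refine integral_congr_ae ?_
  filter_upwards [h1] with x hx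
  rw [hx]

/-- A countably generated sub-σ-algebra which keeps `μ` σ-finite and makes all the `c n`
measurable. -/
theorem exists_good_subalgebra {α : Type*} [m0 : MeasurableSpace α]
    (μ : Measure α) [SigmaFinite μ] (c : ℕ → Lp ℂ 1 μ) :
    ∃ (m : MeasurableSpace α) (hm : m ≤ m0), @MeasurableSpace.CountablyGenerated α m ∧
      SigmaFinite (μ.trim hm) ∧ ∀ n, AEStronglyMeasurable[m] (c n) μ := by
  let F : α → ℕ → ℂ × ℂ := fun x n =>
    (c n x, (spanningSets μ n).indicator (fun _ => (1 : ℂ)) x)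
  have hF : Measurable F := by
    refine measurable_pi_lambda _ fun n => Measurable.prodMk ?_ ?_
    · exact (Lp.stronglyMeasurable (c n)).measurable
    · exact measurable_const.indicator (measurableSet_spanningSets μ n)
  let m : MeasurableSpace α := MeasurableSpace.comap F inferInstance
  have hFm : Measurable[m] F := comap_measurable F
  have hm : m ≤ m0 := hF.comap_le
  have hs : ∀ n, MeasurableSet[m] (spanningSets μ n) := by
    intro n
    have h2 : Measurable[m] fun x => (F x n).2 :=
      measurable_snd.comp ((measurable_pi_apply n).comp hFm)
    have h3 := h2 (measurableSet_singleton (1 : ℂ))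
    convert h3 using 1
    ext x
    by_cases hx : x ∈ spanningSets μ n <;> simp [F, hx]
  refine ⟨m, hm, MeasurableSpace.CountablyGenerated.comap F, ?_, ?_⟩
  · refine ⟨⟨⟨spanningSets μ, fun _ => trivial, fun n => ?_, iUnion_spanningSets μ⟩⟩⟩
    rw [trim_measurableSet_eq hm (hs n)]
    exact measure_spanningSets_lt_top μ n
  · intro n
    have h2 : Measurable[m] fun x => (F x n).1 :=
      measurable_fst.comp ((measurable_pi_apply n).comp hFm)
    exact (h2.stronglyMeasurable).aestronglyMeasurable

/-- `L¹` over a countably generated σ-algebra is separable. -/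
theorem separable_of_countablyGenerated {α : Type*} {m : MeasurableSpace α}
    (ν : Measure α) (hcg : MeasurableSpace.CountablyGenerated α) [SigmaFinite ν] :
    TopologicalSpace.SeparableSpace (Lp ℂ 1 ν) := by
  have : Fact ((1 : ENNReal) ≠ ⊤) := ⟨ENNReal.one_ne_top⟩
  have : SecondCountableTopology (Lp ℂ 1 ν) := inferInstance
  infer_instance

/-- If every element of `L¹` is measurable for a countably generated sub-σ-algebra, then `L¹` is
separable. -/
theorem separable_of_forall_aestronglyMeasurable {α : Type*} {m m0 : MeasurableSpace α}
    (μ : Measure α) (hm : m ≤ m0) (hcg : @MeasurableSpace.CountablyGenerated α m)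
    (hsf : SigmaFinite (μ.trim hm)) (hall : ∀ y : Lp ℂ 1 μ, AEStronglyMeasurable[m] y μ) :
    TopologicalSpace.SeparableSpace (Lp ℂ 1 μ) := by
  have hsep := separable_of_countablyGenerated (μ.trim hm) hcg
  let e := lpMeasToLpTrimLie ℂ ℂ 1 μ hm
  have hsurj : Function.Surjective
      (Subtype.val ∘ e.symm : Lp ℂ 1 (μ.trim hm) → Lp ℂ 1 μ) := by
    intro y
    refine ⟨e ⟨y, mem_lpMeas_iff_aestronglyMeasurable.mpr (hall y)⟩, ?_⟩
    simp
  exact hsurj.denseRange.separableSpace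
    (continuous_subtype_val.comp e.symm.continuous)

/-- Let `μ` be a σ-finite measure such that `L¹(μ; ℂ)` is not
separable.  Then `L¹(μ; ℂ)` fails the ball-covering property. -/
theorem L1_not_BCP_of_not_separable {α : Type*} [MeasurableSpace α]
    (μ : Measure α) [SigmaFinite μ]
    (h_nonsep : ¬ TopologicalSpace.SeparableSpace (Lp ℂ 1 μ)) :
    ¬ HasBCP (Lp ℂ 1 μ) := by
  rintro ⟨c, r, hr, hcov⟩
  obtain ⟨m, hm, hcg, hsf, hc⟩ := exists_good_subalgebra μ c
  -- some `y` is not `m`-measurable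
  have hy : ∃ y : Lp ℂ 1 μ, ¬ AEStronglyMeasurable[m] y μ := by
    by_contra! hall
    exact h_nonsep (separable_of_forall_aestronglyMeasurable μ hm hcg hsf hall)
  obtain ⟨y, hy⟩ := hy
  let P := condExpL1CLM ℂ hm μ
  have hPy : AEStronglyMeasurable[m] (P y) μ := aestronglyMeasurable_condExpL1CLM y
  have hPP : P (P y) = P y := condExpL1CLM_of_aestronglyMeasurable' _ hPy
  have hne : y - P y ≠ 0 := by
    intro h0
    rw [sub_eq_zero] at h0
    rw [← h0] at hPy
    exact hy hPy
  have hn : ‖y - P y‖ ≠ 0 := norm_ne_zero_iff.mpr hne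
  obtain ⟨n, hlt⟩ := hcov (‖y - P y‖⁻¹ • (y - P y)) (by
    rw [norm_smul, norm_inv, norm_norm, inv_mul_cancel₀ hn])
  have h1 := norm_condExpL1CLM_apply_le μ hm (‖y - P y‖⁻¹ • (y - P y) - c n)
  have h2 : P (‖y - P y‖⁻¹ • (y - P y) - c n) = - c n := by
    rw [map_sub, map_smul, map_sub, hPP, sub_self, smul_zero, zero_sub]
    congr 1
    exact condExpL1CLM_of_aestronglyMeasurable' _ (hc n)
  change ‖P _‖ ≤ _ at h1
  rw [h2, norm_neg] at h1
  exact absurd (lt_of_le_of_lt h1 hlt) (not_lt.mpr (hr n))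
end
end
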